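/- Let (u, w, b, Π) be a smooth solution of the stationary magneto-micropolar equations on ℝ³ satisfying the potential growth hypothesis: there exist smooth Φ, Ψ, Υ : ℝ³ → ℝ^{3×3} with div Φ = u, div Ψ = b, div Υ = w, an exponent s ∈ (3, 6], and a constant C₀ > 0 such that the sum of the s-mean oscillations of Φ, Ψ, Υ over B_r is at most C₀ r^{1/3 − 1/s} for all r > 1. Then there is a constant C > 0 (depending on the solution, C₀ and s) such that for all 1 < ρ < R: ∫_{B_ρ} (|∇u|² + |∇b|² + |∇w|²) dx ≤ C R^{(s+6)/(s−3)} (R − ρ)^{−(s+6)/(s−3)}. -/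

import Mathlib

open MeasureTheory Real Filter Metric
open scoped Topology ENNReal

noncomputable section

/-- Three-dimensional Euclidean space. -/
abbrev E3 := EuclideanSpace ℝ (Fin 3)

/-- Partial derivative in the `i`-th coordinate direction. -/
def pd (i : Fin 3) (f : E3 → ℝ) (x : E3) : ℝ := fderiv ℝ f x (EuclideanSpace.single i 1)

/-- Laplacian of a scalar function. -/
def lap (f : E3 → ℝ) (x : E3) : ℝ := ∑ i, pd i (fun y => pd i f y) x

/-- Divergence of a vector field. -/
def vdiv (v : E3 → E3) (x : E3) : ℝ := ∑ i, pd i (fun y => v y i) x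

/-- Curl of a vector field on ℝ³. -/
def curl3 (v : E3 → E3) (x : E3) : Fin 3 → ℝ :=
  ![pd 1 (fun y => v y 2) x - pd 2 (fun y => v y 1) x,
    pd 2 (fun y => v y 0) x - pd 0 (fun y => v y 2) x,
    pd 0 (fun y => v y 1) x - pd 1 (fun y => v y 0) x]

/-- Squared norm of the full gradient of a vector field: |∇v|² = Σᵢⱼ (∂ᵢ vⱼ)². -/
def gradSq (v : E3 → E3) (x : E3) : ℝ := ∑ j, ∑ i, (pd i (fun y => v y j) x) ^ 2

/-- The open ball of radius `r` centered at the origin. -/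
def ball3 (r : ℝ) : Set E3 := Metric.ball (0 : E3) r

/-- `(u, w, b, Π)` is a smooth solution of the stationary magneto-micropolar equations on ℝ³
(with all physical constants set to 1):
−Δu + (u·∇)u + ∇Π = ∇×w + (b·∇)b; −Δw + (u·∇)w = ∇(div w) + ∇×u − 2w;
−Δb + (u·∇)b = (b·∇)u; div u = 0, div b = 0. -/
structure IsMMPSolution (u w b : E3 → E3) (P : E3 → ℝ) : Prop where
  smooth_u : ContDiff ℝ (⊤ : ℕ∞) u
  smooth_w : ContDiff ℝ (⊤ : ℕ∞) w
  smooth_b : ContDiff ℝ (⊤ : ℕ∞) b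
  smooth_P : ContDiff ℝ (⊤ : ℕ∞) P
  eq_u : ∀ x : E3, ∀ j : Fin 3,
    -(lap (fun y => u y j) x) + (∑ i, u x i * pd i (fun y => u y j) x) + pd j P x
      = curl3 w x j + ∑ i, b x i * pd i (fun y => b y j) x
  eq_w : ∀ x : E3, ∀ j : Fin 3,
    -(lap (fun y => w y j) x) + (∑ i, u x i * pd i (fun y => w y j) x)
      = pd j (fun y => vdiv w y) x + curl3 u x j - 2 * w x j
  eq_b : ∀ x : E3, ∀ j : Fin 3,
    -(lap (fun y => b y j) x) + (∑ i, u x i * pd i (fun y => b y j) x)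
      = ∑ i, b x i * pd i (fun y => u y j) x
  div_u : ∀ x : E3, vdiv u x = 0
  div_b : ∀ x : E3, vdiv b x = 0

/-- Divergence of a matrix-valued function: (div Φ)ⱼ = Σᵢ ∂ᵢ Φᵢⱼ. -/
def mdiv (Φ : E3 → Fin 3 → Fin 3 → ℝ) (x : E3) (j : Fin 3) : ℝ :=
  ∑ i, pd i (fun y => Φ y i j) x

/-- Mean value of a matrix-valued function over the ball of radius `r`. -/
def mavg (Φ : E3 → Fin 3 → Fin 3 → ℝ) (r : ℝ) (i j : Fin 3) : ℝ :=
  (volume (ball3 r)).toReal⁻¹ * ∫ x in ball3 r, Φ x i j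

/-- Frobenius norm of a 3×3 matrix. -/
def frob (A : Fin 3 → Fin 3 → ℝ) : ℝ := Real.sqrt (∑ i, ∑ j, (A i j) ^ 2)

/-- The `s`-mean oscillation of `Φ` over the ball of radius `r`:
`(|B_r|⁻¹ ∫_{B_r} |Φ − Φ_{B_r}|^s dx)^(1/s)`. -/
def meanOsc (Φ : E3 → Fin 3 → Fin 3 → ℝ) (s r : ℝ) : ℝ :=
  ((volume (ball3 r)).toReal⁻¹ *
      ∫ x in ball3 r, (frob fun i j => Φ x i j - mavg Φ r i j) ^ s) ^ (1 / s)

section Calculus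

lemma contDiff_pd {n m : WithTop ℕ∞} {f : E3 → ℝ} (i : Fin 3) (hf : ContDiff ℝ m f)
    (h : n + 1 ≤ m) : ContDiff ℝ n (pd i f) :=
  (hf.fderiv_right h).clm_apply contDiff_const

lemma continuous_pd {f : E3 → ℝ} (i : Fin 3) (hf : ContDiff ℝ 1 f) : Continuous (pd i f) :=
  (contDiff_pd (n := 0) i hf (by norm_num)).continuous

lemma contDiff_smooth_pd {f : E3 → ℝ} (i : Fin 3) (hf : ContDiff ℝ (⊤ : ℕ∞) f) :
    ContDiff ℝ (⊤ : ℕ∞) (pd i f) :=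
  contDiff_pd i hf (by norm_cast)

lemma ContDiff.smooth_one {f : E3 → ℝ} (hf : ContDiff ℝ (⊤ : ℕ∞) f) : ContDiff ℝ 1 f :=
  hf.of_le (by norm_cast)

lemma pd_mul {f g : E3 → ℝ} (i : Fin 3) (hf : ContDiff ℝ 1 f) (hg : ContDiff ℝ 1 g) (x : E3) :
    pd i (fun y => f y * g y) x = pd i f x * g x + f x * pd i g x := by
  have hf' := hf.differentiable one_ne_zero x
  have hg' := hg.differentiable one_ne_zero x
  simp only [pd]
  rw [fderiv_fun_mul hf' hg']
  simp
  ring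

lemma pd_add {f g : E3 → ℝ} (i : Fin 3) (hf : ContDiff ℝ 1 f) (hg : ContDiff ℝ 1 g) (x : E3) :
    pd i (fun y => f y + g y) x = pd i f x + pd i g x := by
  have hf' := hf.differentiable one_ne_zero x
  have hg' := hg.differentiable one_ne_zero x
  simp only [pd]
  rw [fderiv_fun_add hf' hg']
  simp

lemma pd_sub {f g : E3 → ℝ} (i : Fin 3) (hf : ContDiff ℝ 1 f) (hg : ContDiff ℝ 1 g) (x : E3) :
    pd i (fun y => f y - g y) x = pd i f x - pd i g x := by
  have hf' := hf.differentiable one_ne_zero x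
  have hg' := hg.differentiable one_ne_zero x
  simp only [pd]
  rw [fderiv_fun_sub hf' hg']
  simp

lemma pd_sum {ι : Type*} (t : Finset ι) {f : ι → E3 → ℝ} (i : Fin 3)
    (hf : ∀ k ∈ t, ContDiff ℝ 1 (f k)) (x : E3) :
    pd i (fun y => ∑ k ∈ t, f k y) x = ∑ k ∈ t, pd i (f k) x := by
  simp only [pd]
  rw [fderiv_fun_sum (fun k hk => (hf k hk).differentiable one_ne_zero x)]
  simp

lemma pd_sub_const {f : E3 → ℝ} (i : Fin 3) (c : ℝ) (x : E3) :
    pd i (fun y => f y - c) x = pd i f x := by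
  simp [pd, fderiv_sub_const]

/-- Second partial derivatives commute. -/
lemma pd_comm {f : E3 → ℝ} (i j : Fin 3) (hf : ContDiff ℝ 2 f) (x : E3) :
    pd i (pd j f) x = pd j (pd i f) x := by
  have h2 : ∀ i j : Fin 3, pd i (pd j f) x =
      fderiv ℝ (fderiv ℝ f) x (EuclideanSpace.single i 1) (EuclideanSpace.single j 1) := by
    intro i j
    have hd : DifferentiableAt ℝ (fderiv ℝ f) x :=
      (hf.fderiv_right (m := 1) (by norm_num)).differentiable one_ne_zero x
    have : pd j f = fun y => fderiv ℝ f y (EuclideanSpace.single j 1) := rfl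
    rw [this]
    simp only [pd]
    rw [fderiv_clm_apply hd (differentiableAt_const _)]
    simp
  rw [h2, h2]
  exact (hf.contDiffAt.isSymmSndFDerivAt (by simp)) _ _

/-- `f` vanishes outside the closed ball of radius `r`. -/
def SuppIn (r : ℝ) (f : E3 → ℝ) : Prop := ∀ x, r < ‖x‖ → f x = 0

lemma SuppIn.hasCompactSupport {r : ℝ} {f : E3 → ℝ} (h : SuppIn r f) : HasCompactSupport f :=
  HasCompactSupport.intro (isCompact_closedBall (0 : E3) r) fun x hx => h x (by simpa using hx)

lemma SuppIn.mono {r r' : ℝ} {f : E3 → ℝ} (h : SuppIn r f) (hr : r ≤ r') : SuppIn r' f :=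
  fun x hx => h x (hr.trans_lt hx)

lemma SuppIn.mul_right {r : ℝ} {f : E3 → ℝ} (h : SuppIn r f) (g : E3 → ℝ) :
    SuppIn r (fun x => f x * g x) := fun x hx => by simp [h x hx]

lemma SuppIn.mul_left {r : ℝ} {f : E3 → ℝ} (h : SuppIn r f) (g : E3 → ℝ) :
    SuppIn r (fun x => g x * f x) := fun x hx => by simp [h x hx]

lemma SuppIn.sub {r : ℝ} {f g : E3 → ℝ} (h : SuppIn r f) (h' : SuppIn r g) :
    SuppIn r (fun x => f x - g x) := fun x hx => by simp [h x hx, h' x hx]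

lemma SuppIn.add {r : ℝ} {f g : E3 → ℝ} (h : SuppIn r f) (h' : SuppIn r g) :
    SuppIn r (fun x => f x + g x) := fun x hx => by simp [h x hx, h' x hx]

lemma SuppIn.sum {ι : Type*} {t : Finset ι} {r : ℝ} {f : ι → E3 → ℝ}
    (h : ∀ k ∈ t, SuppIn r (f k)) : SuppIn r (fun x => ∑ k ∈ t, f k x) :=
  fun x hx => Finset.sum_eq_zero fun k hk => h k hk x hx

lemma SuppIn.pd {r : ℝ} {f : E3 → ℝ} (h : SuppIn r f) (i : Fin 3) : SuppIn r (pd i f) := by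
  intro x hx
  have : f =ᶠ[𝓝 x] fun _ => 0 := by
    filter_upwards [(isOpen_lt continuous_const continuous_norm).mem_nhds hx] with y hy
    exact h y hy
  simp [_root_.pd, this.fderiv_eq]

lemma integrable_of_suppIn {r : ℝ} {f : E3 → ℝ} (hf : Continuous f) (h : SuppIn r f) :
    Integrable f := hf.integrable_of_hasCompactSupport h.hasCompactSupport

lemma integral_mul_pd {r : ℝ} {f g : E3 → ℝ} (i : Fin 3) (hf : ContDiff ℝ 1 f)
    (hg : ContDiff ℝ 1 g) (h : SuppIn r f) :
    ∫ x, f x * pd i g x = -∫ x, pd i f x * g x := by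
  apply integral_mul_fderiv_eq_neg_fderiv_mul_of_integrable
  · exact integrable_of_suppIn ((continuous_pd i hf).mul hg.continuous) ((h.pd i).mul_right g)
  · exact integrable_of_suppIn (hf.continuous.mul (continuous_pd i hg)) (h.mul_right _)
  · exact integrable_of_suppIn (hf.continuous.mul hg.continuous) (h.mul_right _)
  · exact fun x _ => hf.differentiable one_ne_zero x
  · exact fun x _ => hg.differentiable one_ne_zero x

lemma integral_pd_eq_zero {r : ℝ} {f : E3 → ℝ} (i : Fin 3) (hf : ContDiff ℝ 1 f)
    (h : SuppIn r f) : ∫ x, pd i f x = 0 := by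
  have := integral_mul_pd (g := fun _ => (1 : ℝ)) i hf contDiff_const h
  simp only [mul_one] at this
  have h0 : ∀ x, pd i (fun _ : E3 => (1 : ℝ)) x = 0 := by intro x; simp [pd]
  simp only [h0, mul_zero, integral_zero] at this
  linarith

lemma setIntegral_eq_integral_of_suppIn {r r' : ℝ} {f : E3 → ℝ} (h : SuppIn r f) (hr : r < r') :
    ∫ x in ball3 r', f x = ∫ x, f x := by
  apply setIntegral_eq_integral_of_forall_compl_eq_zero
  intro x hx
  apply h
  simp only [ball3, mem_ball, dist_zero_right, not_lt] at hx
  linarith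

lemma integrableOn_ball3 {f : E3 → ℝ} (hf : Continuous f) (r : ℝ) :
    IntegrableOn f (ball3 r) :=
  (hf.continuousOn.integrableOn_compact (isCompact_closedBall 0 r)).mono_set ball_subset_closedBall

lemma measurableSet_ball3 (r : ℝ) : MeasurableSet (ball3 r) := measurableSet_ball

end Calculus


section ParametricIntegrals

lemma hasFDerivAt_integral_compact {G : E3 × (E3 × ℝ) → ℝ} (hG : ContDiff ℝ 1 G)
    {K : Set (E3 × ℝ)} (hK : IsCompact K) (x : E3) :
    HasFDerivAt (fun x => ∫ ω in K, G (x, ω))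
      (∫ ω in K, (fderiv ℝ G (x, ω)).comp (ContinuousLinearMap.inl ℝ E3 (E3 × ℝ))) x := by
  have hc : Continuous fun p : E3 × (E3 × ℝ) =>
      (fderiv ℝ G p).comp (ContinuousLinearMap.inl ℝ E3 (E3 × ℝ)) :=
    (hG.continuous_fderiv one_ne_zero).clm_comp continuous_const
  obtain ⟨C, hC⟩ := ((isCompact_closedBall x 1).prod hK).exists_bound_of_continuousOn
    hc.continuousOn
  have hfin : volume K < ⊤ := hK.measure_lt_top
  refine (hasFDerivAt_integral_of_dominated_of_fderiv_le (𝕜 := ℝ)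
    (F := fun x ω => G (x, ω)) (bound := fun _ => C)
    (F' := fun x ω => (fderiv ℝ G (x, ω)).comp (ContinuousLinearMap.inl ℝ E3 (E3 × ℝ)))
    (s := ball x 1) (ball_mem_nhds x one_pos) ?_ ?_ ?_ ?_ ?_ ?_)
  · exact Filter.Eventually.of_forall fun y =>
      (hG.continuous.comp (by fun_prop : Continuous fun ω : E3 × ℝ => (y, ω))).aestronglyMeasurable
  · exact (hG.continuous.comp (by fun_prop : Continuous fun ω : E3 × ℝ =>
      (x, ω))).continuousOn.integrableOn_compact hK
  · exact (hc.comp (by fun_prop : Continuous fun ω : E3 × ℝ => (x, ω))).aestronglyMeasurable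
  · filter_upwards [ae_restrict_mem hK.measurableSet] with ω hω y hy
    exact hC (y, ω) ⟨ball_subset_closedBall hy, hω⟩
  · exact integrableOn_const hfin.ne
  · refine Filter.Eventually.of_forall fun ω y _ => ?_
    have h1 : HasFDerivAt (fun y : E3 => (y, ω)) (ContinuousLinearMap.inl ℝ E3 (E3 × ℝ)) y :=
      hasFDerivAt_prodMk_left y ω
    exact ((hG.differentiable one_ne_zero (y, ω)).hasFDerivAt).comp y h1

lemma contDiff_integral_compact {G : E3 × (E3 × ℝ) → ℝ} (hG : ContDiff ℝ 1 G)
    {K : Set (E3 × ℝ)} (hK : IsCompact K) :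
    ContDiff ℝ 1 (fun x => ∫ ω in K, G (x, ω)) := by
  rw [contDiff_one_iff_fderiv]
  refine ⟨fun x => (hasFDerivAt_integral_compact hG hK x).differentiableAt, ?_⟩
  have : fderiv ℝ (fun x => ∫ ω in K, G (x, ω)) = fun x => ∫ ω in K,
      (fderiv ℝ G (x, ω)).comp (ContinuousLinearMap.inl ℝ E3 (E3 × ℝ)) :=
    funext fun x => (hasFDerivAt_integral_compact hG hK x).fderiv
  rw [this]
  refine continuous_parametric_integral_of_continuous (f := fun x ω =>
    (fderiv ℝ G (x, ω)).comp (ContinuousLinearMap.inl ℝ E3 (E3 × ℝ))) ?_ hK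
  exact ((hG.continuous_fderiv one_ne_zero).clm_comp continuous_const)

lemma pd_integral_compact {G : E3 × (E3 × ℝ) → ℝ} (hG : ContDiff ℝ 1 G)
    {K : Set (E3 × ℝ)} (hK : IsCompact K) (i : Fin 3) (x : E3) :
    pd i (fun x => ∫ ω in K, G (x, ω)) x = ∫ ω in K, pd i (fun y => G (y, ω)) x := by
  have hc : Continuous fun ω : E3 × ℝ =>
      (fderiv ℝ G (x, ω)).comp (ContinuousLinearMap.inl ℝ E3 (E3 × ℝ)) :=
    ((hG.continuous_fderiv one_ne_zero).comp
      (by fun_prop : Continuous fun ω : E3 × ℝ => (x, ω))).clm_comp continuous_const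
  rw [pd, (hasFDerivAt_integral_compact hG hK x).fderiv,
    ContinuousLinearMap.integral_apply (hc.continuousOn.integrableOn_compact hK)]
  congr 1
  ext ω
  have h1 : HasFDerivAt (fun y : E3 => (y, ω)) (ContinuousLinearMap.inl ℝ E3 (E3 × ℝ)) x :=
    hasFDerivAt_prodMk_left x ω
  have := ((hG.differentiable one_ne_zero (x, ω)).hasFDerivAt).comp x h1
  rw [pd]
  erw [this.fderiv]

lemma integral_comp_affine_le {h : E3 → ℝ} (h0 : ∀ x, 0 ≤ h x) {a : ℝ} (ha : 1 ≤ a) (τ : E3) :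
    ∫ x, h (a • x + τ) ≤ ∫ x, h x := by
  have := Measure.integral_comp_smul (volume : Measure E3) (fun x => h (x + τ)) a
  rw [this, integral_add_right_eq_self]
  have h3 : |(a ^ Module.finrank ℝ E3)⁻¹| ≤ 1 := by
    rw [abs_of_nonneg (by positivity)]
    exact inv_le_one_of_one_le₀ (one_le_pow₀ ha)
  have h4 : 0 ≤ ∫ x, h x := integral_nonneg h0
  rw [smul_eq_mul]
  nlinarith

/-- Averages over affine substitutions are bounded on `L^q`. -/
lemma integral_rpow_average_le {K : Set (E3 × ℝ)} (hK : IsCompact K) {m a : E3 × ℝ → ℝ}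
    {τ : E3 × ℝ → E3} (hm : Continuous m) (hm0 : ∀ ω, 0 ≤ m ω) (ha : Continuous a)
    (ha1 : ∀ ω ∈ K, 1 ≤ a ω) (hτ : Continuous τ) {f T : E3 → ℝ} (hf : Continuous f) {r r' : ℝ}
    (hfs : SuppIn r f) (hT : Continuous T) (hTs : SuppIn r' T)
    (hle : ∀ x, |T x| ≤ ∫ ω in K, m ω * |f (a ω • x + τ ω)|) {q : ℝ} (hq : 1 ≤ q) :
    ∫ x, |T x| ^ q ≤ (∫ ω in K, m ω) ^ q * ∫ x, |f x| ^ q := by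
  have hq0 : 0 < q := by linarith
  have hcq : ∀ {g : E3 → ℝ}, Continuous g → Continuous fun x => |g x| ^ q := fun hg =>
    hg.abs.rpow_const fun _ => Or.inr hq0.le
  have hsq : ∀ {g : E3 → ℝ} {r : ℝ}, SuppIn r g → SuppIn r fun x => |g x| ^ q := fun hg x hx => by
    simp [hg x hx, hq0.ne']
  have hfint : Integrable fun x => |f x| ^ q := integrable_of_suppIn (hcq hf) (hsq hfs)
  have hM : 0 ≤ ∫ ω in K, m ω := integral_nonneg hm0
  have hF : 0 ≤ ∫ x, |f x| ^ q := integral_nonneg fun x => by positivity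
  have hmint : IntegrableOn m K := hm.continuousOn.integrableOn_compact hK
  have hS : Continuous fun p : E3 × (E3 × ℝ) => a p.2 • p.1 + τ p.2 := by fun_prop
  set μ := (volume : Measure (E3 × ℝ)).restrict K with hμ
  have hmE : ∫⁻ ω, ENNReal.ofReal (m ω) ∂μ = ENNReal.ofReal (∫ ω in K, m ω) :=
    (ofReal_integral_eq_lintegral_ofReal hmint (ae_of_all _ hm0)).symm
  have hmm : Measurable fun ω => ENNReal.ofReal (m ω) := hm.measurable.ennreal_ofReal
  rw [← ENNReal.ofReal_le_ofReal_iff (by positivity), ofReal_integral_eq_lintegral_ofReal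
    (integrable_of_suppIn (hcq hT) (hsq hTs)) (ae_of_all _ fun x => by positivity)]
  have hpt : ∀ x, ENNReal.ofReal (|T x| ^ q) ≤
      ENNReal.ofReal (∫ ω in K, m ω) ^ (q - 1) *
        ∫⁻ ω, ENNReal.ofReal (m ω) * ENNReal.ofReal (|f (a ω • x + τ ω)| ^ q) ∂μ := by
    intro x
    have hcx : Continuous fun ω : E3 × ℝ => f (a ω • x + τ ω) := hf.comp (by fun_prop)
    have h1 : ENNReal.ofReal (|T x|) ≤
        ∫⁻ ω, ENNReal.ofReal (m ω) * ENNReal.ofReal |f (a ω • x + τ ω)| ∂μ := by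
      refine (ENNReal.ofReal_le_ofReal (hle x)).trans_eq ?_
      rw [ofReal_integral_eq_lintegral_ofReal]
      · congr 1; ext ω
        rw [ENNReal.ofReal_mul (hm0 ω)]
      · exact (hm.mul hcx.abs).continuousOn.integrableOn_compact hK
      · exact ae_of_all _ fun ω => mul_nonneg (hm0 ω) (abs_nonneg _)
    have h2 := ENNReal.lintegral_mul_norm_pow_le (μ := μ) (f := fun ω => ENNReal.ofReal (m ω))
      (g := fun ω => ENNReal.ofReal (m ω) * ENNReal.ofReal (|f (a ω • x + τ ω)| ^ q))
      hmm.aemeasurable (hmm.mul (hcx.abs.rpow_const fun _ =>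
        Or.inr hq0.le).measurable.ennreal_ofReal).aemeasurable
      (p := 1 - 1 / q) (q := 1 / q) (by
        rw [sub_nonneg, div_le_one hq0]; exact hq) (by positivity) (by ring)
    have h3 : ∀ ω, ENNReal.ofReal (m ω) ^ (1 - 1 / q) *
        (ENNReal.ofReal (m ω) * ENNReal.ofReal (|f (a ω • x + τ ω)| ^ q)) ^ (1 / q) =
        ENNReal.ofReal (m ω) * ENNReal.ofReal |f (a ω • x + τ ω)| := by
      intro ω
      rw [ENNReal.mul_rpow_of_nonneg _ _ (by positivity), ← mul_assoc,
        ← ENNReal.rpow_add_of_nonneg _ _ (by rw [sub_nonneg, div_le_one hq0]; exact hq)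
          (by positivity), sub_add_cancel, ENNReal.rpow_one,
        ENNReal.ofReal_rpow_of_nonneg (by positivity) (by positivity), ← Real.rpow_mul (abs_nonneg _),
        mul_one_div_cancel hq0.ne', Real.rpow_one]
    simp_rw [h3, hmE] at h2
    have h4 := ENNReal.rpow_le_rpow (h1.trans h2) hq0.le
    rw [ENNReal.ofReal_rpow_of_nonneg (abs_nonneg _) hq0.le, ENNReal.mul_rpow_of_nonneg _ _ hq0.le,
      ← ENNReal.rpow_mul, ← ENNReal.rpow_mul, one_div_mul_cancel hq0.ne', ENNReal.rpow_one] at h4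
    convert h4 using 3
    field_simp
  calc ∫⁻ x, ENNReal.ofReal (|T x| ^ q)
      ≤ ∫⁻ x, ENNReal.ofReal (∫ ω in K, m ω) ^ (q - 1) *
        ∫⁻ ω, ENNReal.ofReal (m ω) * ENNReal.ofReal (|f (a ω • x + τ ω)| ^ q) ∂μ :=
        lintegral_mono hpt
    _ = ENNReal.ofReal (∫ ω in K, m ω) ^ (q - 1) *
        ∫⁻ x, ∫⁻ ω, ENNReal.ofReal (m ω) * ENNReal.ofReal (|f (a ω • x + τ ω)| ^ q) ∂μ :=
        lintegral_const_mul' _ _ (ENNReal.rpow_ne_top_of_nonneg (by linarith) ENNReal.ofReal_ne_top)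
    _ = ENNReal.ofReal (∫ ω in K, m ω) ^ (q - 1) *
        ∫⁻ ω, ∫⁻ x, ENNReal.ofReal (m ω) * ENNReal.ofReal (|f (a ω • x + τ ω)| ^ q) ∂volume ∂μ := by
        rw [lintegral_lintegral_swap]
        refine Measurable.aemeasurable ?_
        refine (hmm.comp measurable_snd).mul ?_
        exact ((hf.comp hS).abs.rpow_const fun _ => Or.inr hq0.le).measurable.ennreal_ofReal
    _ ≤ ENNReal.ofReal (∫ ω in K, m ω) ^ (q - 1) *
        ∫⁻ ω, ENNReal.ofReal (m ω) * ENNReal.ofReal (∫ x, |f x| ^ q) ∂μ := by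
        refine mul_le_mul' le_rfl (lintegral_mono_ae ?_)
        filter_upwards [ae_restrict_mem hK.measurableSet] with ω hω
        rw [lintegral_const_mul' _ _ ENNReal.ofReal_ne_top]
        gcongr
        rw [← ofReal_integral_eq_lintegral_ofReal]
        · exact ENNReal.ofReal_le_ofReal (integral_comp_affine_le (h := fun x => |f x| ^ q)
            (fun x => by positivity) (ha1 ω hω) (τ ω))
        · have := (hfint.comp_add_right (τ ω)).comp_smul (R := a ω) (by
            have := ha1 ω hω; positivity)
          exact this
        · exact ae_of_all _ fun x => by positivity
    _ = ENNReal.ofReal ((∫ ω in K, m ω) ^ q * ∫ x, |f x| ^ q) := by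
        rw [lintegral_mul_const' _ _ ENNReal.ofReal_ne_top, hmE, ← mul_assoc,
          ENNReal.ofReal_mul (by positivity), ← ENNReal.ofReal_rpow_of_nonneg hM hq0.le]
        congr 1
        conv_lhs => rw [← ENNReal.rpow_one (ENNReal.ofReal (∫ ω in K, m ω))]
        rw [← ENNReal.rpow_mul, ← ENNReal.rpow_add_of_nonneg _ _ (by linarith) (by norm_num)]
        congr 1
        ring

end ParametricIntegrals


section Bogovskii

lemma fderiv_apply_eq_sum_pd (f : E3 → ℝ) (p v : E3) : fderiv ℝ f p v = ∑ i, v i * pd i f p := by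
  have hv : v = ∑ i, v i • EuclideanSpace.single i (1 : ℝ) := by
    ext j
    simp [Finset.sum_apply, Pi.single_apply]
  conv_lhs => rw [hv]
  simp [map_sum, pd]

lemma pd_comp_affine {f : E3 → ℝ} (hf : ContDiff ℝ 1 f) (i : Fin 3) (a : ℝ) (τ x : E3) :
    pd i (fun y => f (a • y + τ)) x = a * pd i f (a • x + τ) := by
  have h1 : HasFDerivAt (fun y : E3 => a • y + τ) (a • ContinuousLinearMap.id ℝ E3) x :=
    ((hasFDerivAt_id x).const_smul a).add_const τ
  have h2 := (hf.differentiable one_ne_zero (a • x + τ)).hasFDerivAt.comp x h1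
  rw [pd]
  erw [h2.fderiv]
  simp [pd]

lemma pd_coord_sub (i : Fin 3) (c : ℝ) (x : E3) : pd i (fun y : E3 => y i - c) x = 1 := by
  have h := (((EuclideanSpace.proj i : E3 →L[ℝ] ℝ).hasFDerivAt (x := x)).sub_const c).fderiv
  rw [pd]
  erw [h]
  simp

lemma contDiff_coord (i : Fin 3) {n : WithTop ℕ∞} : ContDiff ℝ n fun y : E3 => y i :=
  (EuclideanSpace.proj i : E3 →L[ℝ] ℝ).contDiff

/-- A compact set of parameters: a ball times the interval `[1, 2]`. -/
def ballIcc (r : ℝ) : Set (E3 × ℝ) := closedBall 0 r ×ˢ Set.Icc 1 2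

lemma isCompact_ballIcc (r : ℝ) : IsCompact (ballIcc r) :=
  (isCompact_closedBall 0 r).prod isCompact_Icc

/-- The integrand of the Bogovskii-type operator `bogKernel`. -/
def bogKernel (f ψ : E3 → ℝ) (i : Fin 3) (p : E3 × (E3 × ℝ)) : ℝ :=
  p.2.2 ^ 2 * ((p.1 i - p.2.1 i) * (ψ p.2.1 * f (p.2.2 • p.1 + (-(p.2.2 - 1)) • p.2.1)))

/-- A Bogovskii-type integral operator. -/
def bog (r : ℝ) (f ψ : E3 → ℝ) (i : Fin 3) (x : E3) : ℝ :=
  ∫ ω in ballIcc r, bogKernel f ψ i (x, ω)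

lemma contDiff_bogKernel {f ψ : E3 → ℝ} (hf : ContDiff ℝ 1 f) (hψ : ContDiff ℝ 1 ψ) (i : Fin 3) :
    ContDiff ℝ 1 (bogKernel f ψ i) := by
  unfold bogKernel
  have h1 : ContDiff ℝ 1 fun p : E3 × (E3 × ℝ) => p.1 i := (contDiff_coord i).comp contDiff_fst
  have h2 : ContDiff ℝ 1 fun p : E3 × (E3 × ℝ) => p.2.1 i :=
    (contDiff_coord i).comp contDiff_snd.fst
  have h3 : ContDiff ℝ 1 fun p : E3 × (E3 × ℝ) => ψ p.2.1 := hψ.comp contDiff_snd.fst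
  have h4 : ContDiff ℝ 1 fun p : E3 × (E3 × ℝ) => f (p.2.2 • p.1 + (-(p.2.2 - 1)) • p.2.1) :=
    hf.comp (by fun_prop)
  fun_prop

lemma contDiff_bog {f ψ : E3 → ℝ} (hf : ContDiff ℝ 1 f) (hψ : ContDiff ℝ 1 ψ) (r : ℝ)
    (i : Fin 3) : ContDiff ℝ 1 (bog r f ψ i) :=
  contDiff_integral_compact (contDiff_bogKernel hf hψ i) (isCompact_ballIcc r)

lemma suppIn_bog {f ψ : E3 → ℝ} {r : ℝ} (hf : SuppIn r f) (i : Fin 3) :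
    SuppIn r (bog r f ψ i) := by
  intro x hx
  refine setIntegral_eq_zero_of_forall_eq_zero fun ω hω => ?_
  obtain ⟨h1, h2, h3⟩ := hω
  rw [mem_closedBall_zero_iff] at h1
  have : r < ‖ω.2 • x + (-(ω.2 - 1)) • ω.1‖ := by
    have h4 := norm_sub_le_norm_add (ω.2 • x) ((-(ω.2 - 1)) • ω.1)
    rw [norm_smul, norm_smul, norm_neg, Real.norm_of_nonneg (by linarith : 0 ≤ ω.2),
      Real.norm_of_nonneg (by linarith : 0 ≤ ω.2 - 1)] at h4
    nlinarith
  simp only [bogKernel]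
  rw [hf _ this]
  simp

lemma abs_bog_le {f ψ : E3 → ℝ} {r : ℝ} (hr : 0 < r) (hf : ContDiff ℝ 1 f)
    (hψ : ContDiff ℝ 1 ψ) (hfs : SuppIn r f) (i : Fin 3) (x : E3) :
    |bog r f ψ i x| ≤
      ∫ ω in ballIcc r, (8 * r * |ψ ω.1|) * |f (ω.2 • x + (-(ω.2 - 1)) • ω.1)| := by
  have hcont : Continuous fun ω : E3 × ℝ =>
      (8 * r * |ψ ω.1|) * |f (ω.2 • x + (-(ω.2 - 1)) • ω.1)| := by
    have := hf.continuous
    have := hψ.continuous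
    fun_prop
  by_cases hx : r < ‖x‖
  · rw [suppIn_bog hfs i x hx, abs_zero]
    exact integral_nonneg fun ω => by positivity
  push Not at hx
  unfold bog
  rw [← Real.norm_eq_abs]
  refine norm_integral_le_of_norm_le (hcont.continuousOn.integrableOn_compact
    (isCompact_ballIcc r)) ?_
  filter_upwards [ae_restrict_mem (isCompact_ballIcc r).measurableSet] with ω hω
  obtain ⟨h1, h2, h3⟩ := hω
  rw [mem_closedBall_zero_iff] at h1
  have h4 : |x i - ω.1 i| ≤ 2 * r := by
    have := PiLp.norm_apply_le (x - ω.1) i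
    rw [Real.norm_eq_abs] at this
    have h5 := norm_sub_le x ω.1
    simp only [PiLp.sub_apply] at this
    linarith
  have h6 : |ω.2 ^ 2| ≤ 4 := by rw [abs_of_nonneg (sq_nonneg _)]; nlinarith
  simp only [bogKernel, Real.norm_eq_abs, abs_mul]
  calc |ω.2 ^ 2| * (|x i - ω.1 i| * (|ψ ω.1| * |f (ω.2 • x + (-(ω.2 - 1)) • ω.1)|))
      ≤ 4 * (2 * r * (|ψ ω.1| * |f (ω.2 • x + (-(ω.2 - 1)) • ω.1)|)) := by gcongr
    _ = _ := by ring

lemma integral_ballIcc_fst {h : E3 → ℝ} {r r' : ℝ} (hs : SuppIn r h) (hr : r ≤ r') :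
    ∫ ω in ballIcc r', h ω.1 = ∫ z, h z := by
  have h1 : ∫ ω in ballIcc r', h ω.1 =
      ∫ ω in closedBall (0 : E3) r' ×ˢ Set.Icc (1 : ℝ) 2, h ω.1 * 1 ∂(volume.prod volume) := by
    simp [ballIcc, Measure.volume_eq_prod]
  rw [h1, setIntegral_prod_mul (f := h) (g := fun _ => (1 : ℝ))]
  have : ∫ z in closedBall (0 : E3) r', h z = ∫ z, h z := by
    apply setIntegral_eq_integral_of_forall_compl_eq_zero
    intro z hz
    rw [mem_closedBall_zero_iff, not_le] at hz
    exact hs z (hr.trans_lt hz)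
  rw [this]
  norm_num

lemma integral_abs_bog_rpow_le {f ψ : E3 → ℝ} {r : ℝ} (hr : 0 < r) (hf : ContDiff ℝ 1 f)
    (hψ : ContDiff ℝ 1 ψ) (hfs : SuppIn r f) (hψs : SuppIn r ψ) (i : Fin 3) {q : ℝ}
    (hq : 1 ≤ q) :
    ∫ x, |bog r f ψ i x| ^ q ≤ (8 * r * ∫ z, |ψ z|) ^ q * ∫ x, |f x| ^ q := by
  have h := integral_rpow_average_le (isCompact_ballIcc r) (m := fun ω => 8 * r * |ψ ω.1|)
    (a := fun ω => ω.2) (τ := fun ω => (-(ω.2 - 1)) • ω.1) (f := f) (T := bog r f ψ i)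
    (by have := hψ.continuous; fun_prop) (fun ω => by positivity) (by fun_prop)
    (fun ω hω => hω.2.1) (by fun_prop) hf.continuous hfs
    (contDiff_bog hf hψ r i).continuous (suppIn_bog hfs i) (abs_bog_le hr hf hψ hfs i) hq
  rwa [integral_const_mul, integral_ballIcc_fst (h := fun z => |ψ z|)
    (fun x hx => by simp [hψs x hx]) le_rfl] at h

lemma pd_bogKernel {f ψ : E3 → ℝ} (hf : ContDiff ℝ 1 f) (i : Fin 3) (x : E3) (ω : E3 × ℝ) :
    pd i (fun y => bogKernel f ψ i (y, ω)) x =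
      ω.2 ^ 2 * ψ ω.1 * (f (ω.2 • x + (-(ω.2 - 1)) • ω.1) +
        (x i - ω.1 i) * (ω.2 * pd i f (ω.2 • x + (-(ω.2 - 1)) • ω.1))) := by
  have h1 : (fun y => bogKernel f ψ i (y, ω)) = fun y => (fun _ => ω.2 ^ 2 * ψ ω.1) y *
      ((fun y => y i - ω.1 i) y * (fun y => f (ω.2 • y + (-(ω.2 - 1)) • ω.1)) y) := by
    ext y; simp only [bogKernel]; ring
  have hc1 : ContDiff ℝ 1 fun y : E3 => y i - ω.1 i := (contDiff_coord i).sub contDiff_const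
  have hc2 : ContDiff ℝ 1 fun y => f (ω.2 • y + (-(ω.2 - 1)) • ω.1) := hf.comp (by fun_prop)
  rw [h1, pd_mul i contDiff_const (hc1.mul hc2), pd_mul i hc1 hc2, pd_coord_sub,
    pd_comp_affine hf]
  simp [pd]

lemma sum_pd_bog {f ψ : E3 → ℝ} {r : ℝ} (hf : ContDiff ℝ 1 f) (hψ : ContDiff ℝ 1 ψ)
    (hψs : SuppIn r ψ) (x : E3) :
    ∑ i, pd i (bog r f ψ i) x = 8 * (∫ z, ψ z * f ((2 : ℝ) • x - z)) - f x * ∫ z, ψ z := by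
  have hK := isCompact_ballIcc r
  have hG : ∀ i, ContDiff ℝ 1 (bogKernel f ψ i) := contDiff_bogKernel hf hψ
  have hcp : Continuous fun ω : E3 × ℝ => ω.2 • x + (-(ω.2 - 1)) • ω.1 := by fun_prop
  have hcf := hf.continuous.comp hcp
  have hcpd : ∀ i, Continuous fun ω : E3 × ℝ => pd i f (ω.2 • x + (-(ω.2 - 1)) • ω.1) :=
    fun i => (continuous_pd i hf).comp hcp
  have hψc := hψ.continuous
  have h1 : ∀ i, pd i (bog r f ψ i) x = ∫ ω in ballIcc r,
      ω.2 ^ 2 * ψ ω.1 * (f (ω.2 • x + (-(ω.2 - 1)) • ω.1) +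
        (x i - ω.1 i) * (ω.2 * pd i f (ω.2 • x + (-(ω.2 - 1)) • ω.1))) := by
    intro i
    have := pd_integral_compact (hG i) hK i x
    simp_rw [pd_bogKernel hf] at this
    exact this
  simp_rw [h1]
  have hcc : ∀ i : Fin 3, Continuous fun ω : E3 × ℝ => ω.2 ^ 2 * ψ ω.1 *
      (f (ω.2 • x + (-(ω.2 - 1)) • ω.1) +
        (x i - ω.1 i) * (ω.2 * pd i f (ω.2 • x + (-(ω.2 - 1)) • ω.1))) := by
    intro i
    have h2 : Continuous fun ω : E3 × ℝ => ω.1 i := (contDiff_coord i (n := 1)).continuous.comp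
      continuous_fst
    have h3 := hcpd i
    have h4 : Continuous fun ω : E3 × ℝ => ψ ω.1 := hψc.comp continuous_fst
    have h5 : Continuous fun ω : E3 × ℝ => f (ω.2 • x + (-(ω.2 - 1)) • ω.1) := hcf
    fun_prop
  rw [← integral_finsetSum _ fun i _ => (hcc i).continuousOn.integrableOn_compact hK]
  have hsumc : Continuous fun ω : E3 × ℝ => ∑ i, ω.2 ^ 2 * ψ ω.1 *
      (f (ω.2 • x + (-(ω.2 - 1)) • ω.1) +
        (x i - ω.1 i) * (ω.2 * pd i f (ω.2 • x + (-(ω.2 - 1)) • ω.1))) :=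
    continuous_finsetSum _ fun i _ => hcc i
  rw [ballIcc, Measure.volume_eq_prod, setIntegral_prod _
    (by rw [← Measure.volume_eq_prod]; exact hsumc.continuousOn.integrableOn_compact hK)]
  have hin : ∀ z : E3, ∫ l in Set.Icc (1 : ℝ) 2, ∑ i, l ^ 2 * ψ z *
      (f (l • x + (-(l - 1)) • z) + (x i - z i) * (l * pd i f (l • x + (-(l - 1)) • z))) =
      ψ z * (8 * f ((2 : ℝ) • x - z) - f x) := by
    intro z
    have hd : ∀ l ∈ Set.uIcc (1 : ℝ) 2, HasDerivAt
        (fun l : ℝ => ψ z * (l ^ 3 * f (l • x + (-(l - 1)) • z)))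
        (∑ i, l ^ 2 * ψ z * (f (l • x + (-(l - 1)) • z) +
          (x i - z i) * (l * pd i f (l • x + (-(l - 1)) • z)))) l := by
      intro l _
      have e1 : HasDerivAt (fun l : ℝ => l • x + (-(l - 1)) • z) (x - z) l := by
        have := ((hasDerivAt_id l).smul_const x).add
          ((((hasDerivAt_id l).sub_const 1).neg).smul_const z)
        exact this.congr_deriv (by simp [sub_eq_add_neg])
      have e2 := (hf.differentiable one_ne_zero (l • x + (-(l - 1)) • z)).hasFDerivAt.comp_hasDerivAt
        l e1
      have e3 := ((hasDerivAt_pow 3 l).mul e2).const_mul (ψ z)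
      refine e3.congr_deriv ?_
      rw [fderiv_apply_eq_sum_pd]
      simp only [Fin.sum_univ_three, PiLp.sub_apply, Function.comp_apply]
      push_cast
      ring
    have hci : Continuous fun l : ℝ => ∑ i, l ^ 2 * ψ z *
        (f (l • x + (-(l - 1)) • z) + (x i - z i) * (l * pd i f (l • x + (-(l - 1)) • z))) :=
      hsumc.comp (by fun_prop : Continuous fun l : ℝ => (z, l))
    rw [integral_Icc_eq_integral_Ioc, ← intervalIntegral.integral_of_le (by norm_num),
      intervalIntegral.integral_eq_sub_of_hasDerivAt hd (hci.intervalIntegrable 1 2)]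
    have e : (2 : ℝ) • x + (-((2 : ℝ) - 1)) • z = (2 : ℝ) • x - z := by
      norm_num [sub_eq_add_neg]
    rw [e]
    norm_num
    ring
  simp_rw [hin]
  have hi1 : Integrable fun z => ψ z * f ((2 : ℝ) • x - z) :=
    integrable_of_suppIn (by have := hf.continuous; fun_prop) (hψs.mul_right _)
  have hi2 : Integrable fun z => ψ z := integrable_of_suppIn hψc hψs
  rw [setIntegral_eq_integral_of_forall_compl_eq_zero]
  · have : ∀ z, ψ z * (8 * f ((2 : ℝ) • x - z) - f x) =
        8 * (ψ z * f ((2 : ℝ) • x - z)) - f x * ψ z := fun z => by ring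
    simp_rw [this]
    rw [integral_sub (hi1.const_mul 8) (hi2.const_mul _), integral_const_mul, integral_const_mul]
  · intro z hz
    rw [mem_closedBall_zero_iff, not_le] at hz
    rw [hψs z hz, zero_mul]

lemma abs_sub_rpow_le {a b q : ℝ} (hq : 1 ≤ q) :
    |a - b| ^ q ≤ 2 ^ q * (|a| ^ q + |b| ^ q) := by
  have h1 : |a - b| ≤ 2 * max |a| |b| := by
    have := abs_sub a b
    have := le_max_left |a| |b|
    have := le_max_right |a| |b|
    linarith
  have hq0 : 0 ≤ q := by linarith
  calc |a - b| ^ q ≤ (2 * max |a| |b|) ^ q := by gcongr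
    _ = 2 ^ q * (max |a| |b|) ^ q := by
        rw [Real.mul_rpow (by norm_num) (le_max_of_le_left (abs_nonneg a))]
    _ ≤ _ := by
        gcongr
        rcases max_choice |a| |b| with h | h <;> rw [h]
        · linarith [Real.rpow_nonneg (abs_nonneg b) q]
        · linarith [Real.rpow_nonneg (abs_nonneg a) q]

/-- Hölder's inequality against the constant function on a ball. -/
lemma integral_abs_rpow_le_of_suppIn {f : E3 → ℝ} {r : ℝ} (hf : Continuous f) (hfs : SuppIn r f)
    {q : ℝ} (hq : 1 < q) :
    (∫ x, |f x|) ^ q ≤ (volume.real (closedBall (0 : E3) r)) ^ (q - 1) * ∫ x, |f x| ^ q := by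
  have hq0 : 0 < q := by linarith
  set B := closedBall (0 : E3) r with hB
  have hB' : volume B ≠ ⊤ := (isCompact_closedBall (0 : E3) r).measure_lt_top.ne
  have hset : ∀ g : E3 → ℝ, SuppIn r g → ∫ x in B, g x = ∫ x, g x := by
    intro g hg
    apply setIntegral_eq_integral_of_forall_compl_eq_zero
    intro z hz
    rw [mem_closedBall_zero_iff, not_le] at hz
    exact hg z hz
  have h1 := integral_mul_le_Lp_mul_Lq_of_nonneg (μ := volume.restrict B)
    (Real.HolderConjugate.conjExponent hq) (f := fun x => |f x|) (g := fun _ => 1)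
    (ae_of_all _ fun x => abs_nonneg _) (ae_of_all _ fun x => zero_le_one) (by
      have := hf.abs.memLp_of_hasCompactSupport (p := ENNReal.ofReal q) (μ := volume)
        (SuppIn.hasCompactSupport (r := r) fun x hx => by simp [hfs x hx])
      exact this.restrict B) (by
      have : IsFiniteMeasure (volume.restrict B) := ⟨by simpa using hB'.lt_top⟩
      exact memLp_const 1)
  simp only [mul_one, Real.one_rpow, integral_const, smul_eq_mul] at h1
  rw [hset (fun x => |f x|) (fun x hx => by simp [hfs x hx]),
    hset (fun x => |f x| ^ q) (fun x hx => by simp [hfs x hx, hq0.ne'])] at h1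
  have hI : 0 ≤ ∫ x, |f x| ^ q := integral_nonneg fun x => by positivity
  have hI1 : 0 ≤ ∫ x, |f x| := integral_nonneg fun x => by positivity
  have h2 := Real.rpow_le_rpow hI1 h1 hq0.le
  rw [Real.mul_rpow (by positivity) (by positivity), ← Real.rpow_mul hI, one_div_mul_cancel hq0.ne',
    Real.rpow_one, ← Real.rpow_mul (by positivity), mul_comm] at h2
  convert h2 using 3
  · simp [Measure.real]
  · rw [Real.conjExponent]; field_simp

/-- Solvability of the divergence equation with `L^q` bounds and support control. -/
lemma exists_sum_pd_eq {q : ℝ} (hq : 1 < q) {r : ℝ} (hr : 0 < r) {f : E3 → ℝ}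
    (hf : ContDiff ℝ 1 f) (hfs : SuppIn r f) (hf0 : ∫ x, f x = 0) :
    ∃ V : Fin 3 → E3 → ℝ, (∀ i, ContDiff ℝ 1 (V i)) ∧ (∀ i, SuppIn r (V i)) ∧
      (∀ x, ∑ i, pd i (V i) x = f x) ∧
      ∀ i, ∫ x, |V i x| ^ q ≤ (2 : ℝ) ^ q * (2 * 64 ^ q) * r ^ q * ∫ x, |f x| ^ q := by
  have hq0 : 0 < q := by linarith
  let φ : ContDiffBump (0 : E3) := ⟨r / 2, r, by positivity, by linarith⟩
  set ψ : E3 → ℝ := φ.normed volume with hψdef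
  have hψ : ContDiff ℝ 1 ψ := φ.contDiff_normed
  have hψ0 : ∀ x, 0 ≤ ψ x := fun x => φ.nonneg_normed x
  have hψ1 : ∫ x, ψ x = 1 := φ.integral_normed
  have hψabs : ∫ x, |ψ x| = 1 := by simp_rw [abs_of_nonneg (hψ0 _)]; exact hψ1
  have hψs : SuppIn r ψ := by
    intro x hx
    have h := φ.support_normed_eq (μ := volume)
    by_contra hne
    have : x ∈ Function.support (φ.normed volume) := hne
    rw [h, mem_ball_zero_iff] at this
    exact absurd this (not_lt.2 hx.le)
  set v := volume.real (closedBall (0 : E3) (r / 2)) with hv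
  have hvpos : 0 < v := by
    rw [hv, Measure.real, ENNReal.toReal_pos_iff]
    exact ⟨measure_closedBall_pos _ _ (by positivity), measure_closedBall_lt_top⟩
  have hvr : volume.real (closedBall (0 : E3) r) = 8 * v := by
    rw [hv, Measure.addHaar_real_closedBall' _ _ hr.le,
      Measure.addHaar_real_closedBall' _ _ (by positivity : 0 ≤ r / 2)]
    simp
    ring
  have hψle : ∀ x, ψ x ≤ v⁻¹ := by
    intro x
    have := φ.normed_le_div_measure_closedBall_rIn volume x
    rwa [one_div] at this
  refine ⟨fun i x => bog r ψ f i x - bog r f ψ i x, fun i => (contDiff_bog hψ hf r i).sub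
    (contDiff_bog hf hψ r i), fun i => (suppIn_bog hψs i).sub (suppIn_bog hfs i), ?_, ?_⟩
  · intro x
    simp_rw [fun i => pd_sub i (contDiff_bog hψ hf r i) (contDiff_bog hf hψ r i) x]
    rw [Finset.sum_sub_distrib, sum_pd_bog hψ hf hfs, sum_pd_bog hf hψ hψs, hf0, hψ1]
    have : ∫ z, ψ z * f ((2 : ℝ) • x - z) = ∫ z, f z * ψ ((2 : ℝ) • x - z) := by
      rw [← integral_sub_left_eq_self _ volume ((2 : ℝ) • x)]
      congr 1; ext z
      rw [sub_sub_cancel, mul_comm]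
    rw [this]; ring
  · intro i
    set I := ∫ x, |f x| ^ q with hI
    have hI0 : 0 ≤ I := integral_nonneg fun x => by positivity
    have e1 := integral_abs_bog_rpow_le hr hψ hf hψs hfs i hq.le
    have e2 := integral_abs_bog_rpow_le hr hf hψ hfs hψs i hq.le
    rw [hψabs, mul_one, ← hI] at e2
    have hFn : 0 ≤ ∫ z, |f z| := integral_nonneg fun x => by positivity
    have e3 : (8 * r * ∫ z, |f z|) ^ q * ∫ x, |ψ x| ^ q ≤ (64 * r) ^ q * I := by
      have e4 := integral_abs_rpow_le_of_suppIn hf.continuous hfs hq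
      have e5 : ∫ x, |ψ x| ^ q ≤ (v⁻¹) ^ (q - 1) := by
        calc ∫ x, |ψ x| ^ q ≤ ∫ x, (v⁻¹) ^ (q - 1) * |ψ x| := by
              apply integral_mono_of_nonneg (ae_of_all _ fun x => by positivity)
                ((integrable_of_suppIn hψ.continuous hψs).abs.const_mul _)
              refine ae_of_all _ fun x => ?_
              have : |ψ x| ^ q = |ψ x| ^ (q - 1) * |ψ x| := by
                rw [← Real.rpow_add_one' (abs_nonneg _) (by linarith), sub_add_cancel]
              simp only [this]
              have hle : |ψ x| ≤ v⁻¹ := by rw [abs_of_nonneg (hψ0 x)]; exact hψle x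
              have := Real.rpow_le_rpow (abs_nonneg _) hle (by linarith : 0 ≤ q - 1)
              gcongr
          _ = _ := by rw [integral_const_mul, hψabs, mul_one]
      rw [hvr] at e4
      calc (8 * r * ∫ z, |f z|) ^ q * ∫ x, |ψ x| ^ q
          ≤ (8 * r) ^ q * ((8 * v) ^ (q - 1) * I) * (v⁻¹) ^ (q - 1) := by
            rw [Real.mul_rpow (by positivity) hFn]
            gcongr
        _ = (8 * r) ^ q * 8 ^ (q - 1) * (v * v⁻¹) ^ (q - 1) * I := by
            rw [Real.mul_rpow (by norm_num : (0 : ℝ) ≤ 8) hvpos.le,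
              Real.mul_rpow hvpos.le (by positivity)]
            ring
        _ ≤ (8 * r) ^ q * 8 ^ q * 1 * I := by
            rw [mul_inv_cancel₀ hvpos.ne', Real.one_rpow]
            have : (8 : ℝ) ^ (q - 1) ≤ 8 ^ q :=
              Real.rpow_le_rpow_of_exponent_le (by norm_num) (by linarith)
            gcongr
        _ = (64 * r) ^ q * I := by
            rw [mul_one, ← Real.mul_rpow (by positivity) (by norm_num)]
            ring_nf
    have hgint : ∀ {g : E3 → ℝ}, Continuous g → SuppIn r g → Integrable fun x => |g x| ^ q :=
      fun hg hgs => integrable_of_suppIn (r := r) (hg.abs.rpow_const fun _ => Or.inr hq0.le)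
        fun x hx => by simp [hgs x hx, hq0.ne']
    have i1 := hgint (contDiff_bog hψ hf r i).continuous (suppIn_bog hψs i)
    have i2 := hgint (contDiff_bog hf hψ r i).continuous (suppIn_bog hfs i)
    calc ∫ x, |bog r ψ f i x - bog r f ψ i x| ^ q
        ≤ ∫ x, 2 ^ q * (|bog r ψ f i x| ^ q + |bog r f ψ i x| ^ q) :=
          integral_mono_of_nonneg (ae_of_all _ fun x => by positivity)
            ((i1.add i2).const_mul _) (ae_of_all _ fun x => abs_sub_rpow_le hq.le)
      _ = 2 ^ q * ((∫ x, |bog r ψ f i x| ^ q) + ∫ x, |bog r f ψ i x| ^ q) := by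
          rw [integral_const_mul, integral_add i1 i2]
      _ ≤ 2 ^ q * ((64 * r) ^ q * I + (64 * r) ^ q * I) := by
          have : (8 * r) ^ q * I ≤ (64 * r) ^ q * I := by gcongr; norm_num
          gcongr
          · exact e1.trans e3
          · exact e2.trans this
      _ = _ := by
          rw [Real.mul_rpow (by norm_num) hr.le]
          ring

end Bogovskii


section Regularization

/-- A fixed mollifier supported in the unit ball. -/
def mollifier : E3 → ℝ :=
  ContDiffBump.normed (⟨1 / 2, 1, by norm_num, by norm_num⟩ : ContDiffBump (0 : E3)) volume

lemma contDiff_mollifier : ContDiff ℝ 1 mollifier := ContDiffBump.contDiff_normed _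

lemma mollifier_nonneg (x : E3) : 0 ≤ mollifier x := ContDiffBump.nonneg_normed _ x

lemma integral_mollifier : ∫ x, mollifier x = 1 := ContDiffBump.integral_normed _

lemma suppIn_mollifier : SuppIn 1 mollifier := by
  intro x hx
  by_contra hne
  have : x ∈ Function.support mollifier := hne
  rw [mollifier, ContDiffBump.support_normed_eq, mem_ball_zero_iff] at this
  exact absurd this (not_lt.2 hx.le)

/-- Weighted average of translates. -/
def avg (m : E3 × ℝ → ℝ) (τ : E3 × ℝ → E3) (g : E3 → ℝ) (x : E3) : ℝ :=
  ∫ ω in ballIcc 1, m ω * g (x + τ ω)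

variable {m : E3 × ℝ → ℝ} {τ : E3 × ℝ → E3} {g : E3 → ℝ}

lemma contDiff_avgKernel (hm : ContDiff ℝ 1 m) (hτ : ContDiff ℝ 1 τ) (hg : ContDiff ℝ 1 g) :
    ContDiff ℝ 1 fun p : E3 × (E3 × ℝ) => m p.2 * g (p.1 + τ p.2) :=
  (hm.comp contDiff_snd).mul (hg.comp (contDiff_fst.add (hτ.comp contDiff_snd)))

lemma contDiff_avg (hm : ContDiff ℝ 1 m) (hτ : ContDiff ℝ 1 τ) (hg : ContDiff ℝ 1 g) :
    ContDiff ℝ 1 (avg m τ g) :=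
  contDiff_integral_compact (contDiff_avgKernel hm hτ hg) (isCompact_ballIcc 1)

lemma continuous_avg (hm : Continuous m) (hτ : Continuous τ) (hg : Continuous g) :
    Continuous (avg m τ g) :=
  continuous_parametric_integral_of_continuous (f := fun x ω => m ω * g (x + τ ω))
    (by fun_prop) (isCompact_ballIcc 1)

lemma pd_avg (hm : ContDiff ℝ 1 m) (hτ : ContDiff ℝ 1 τ) (hg : ContDiff ℝ 1 g) (k : Fin 3) :
    pd k (avg m τ g) = avg m τ (pd k g) := by
  ext x
  have h := pd_integral_compact (contDiff_avgKernel hm hτ hg) (isCompact_ballIcc 1) k x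
  have h2 : ∀ ω, pd k (fun y => m ω * g (y + τ ω)) x = m ω * pd k g (x + τ ω) := by
    intro ω
    have hc : ContDiff ℝ 1 fun y => g (y + τ ω) := hg.comp (by fun_prop)
    have e := pd_mul k (f := fun _ => m ω) contDiff_const hc x
    have e2 := pd_comp_affine hg k 1 (τ ω) x
    simp only [one_smul, one_mul] at e2
    rw [e, e2]
    simp [pd]
  simp only [h2] at h
  exact h

lemma suppIn_avg {r δ : ℝ} (hτ : ∀ ω ∈ ballIcc 1, ‖τ ω‖ ≤ δ) (hg : SuppIn r g) :
    SuppIn (r + δ) (avg m τ g) := by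
  intro x hx
  refine setIntegral_eq_zero_of_forall_eq_zero fun ω hω => ?_
  have h1 := norm_sub_le_norm_add x (τ ω)
  have h2 := hτ ω hω
  rw [hg _ (by linarith), mul_zero]

lemma integral_abs_avg_rpow_le (hm : Continuous m) (hτ : Continuous τ) (hg : Continuous g)
    {r δ : ℝ} (hτb : ∀ ω ∈ ballIcc 1, ‖τ ω‖ ≤ δ) (hgs : SuppIn r g) {q : ℝ} (hq : 1 ≤ q) :
    ∫ x, |avg m τ g x| ^ q ≤ (∫ ω in ballIcc 1, |m ω|) ^ q * ∫ x, |g x| ^ q := by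
  refine integral_rpow_average_le (isCompact_ballIcc 1) (m := fun ω => |m ω|)
    (a := fun _ => 1) hm.abs (fun ω => abs_nonneg _) continuous_const (fun _ _ => le_rfl) hτ hg hgs
    (continuous_avg hm hτ hg) (suppIn_avg hτb hgs) (fun x => ?_) hq
  simp only [one_smul, ← abs_mul]
  exact abs_integral_le_integral_abs

lemma integral_abs_avg_rpow_le_of_le (hm : Continuous m) (hτ : Continuous τ) (hg : Continuous g)
    {r δ : ℝ} (hτb : ∀ ω ∈ ballIcc 1, ‖τ ω‖ ≤ δ) (hgs : SuppIn r g) {q : ℝ} (hq : 1 ≤ q)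
    {c : ℝ} {φ : E3 → ℝ} (hφc : Continuous φ) (hφs : SuppIn 1 φ)
    (hmφ : ∀ ω, |m ω| ≤ c * |φ ω.1|) :
    ∫ x, |avg m τ g x| ^ q ≤ (c * ∫ x, |φ x|) ^ q * ∫ x, |g x| ^ q := by
  refine (integral_abs_avg_rpow_le hm hτ hg hτb hgs hq).trans ?_
  have h0 : 0 ≤ ∫ x, |g x| ^ q := integral_nonneg fun x => by positivity
  have h1 : 0 ≤ ∫ ω in ballIcc 1, |m ω| := integral_nonneg fun x => by positivity
  refine mul_le_mul_of_nonneg_right (Real.rpow_le_rpow h1 ?_ (by linarith)) h0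
  rw [← integral_ballIcc_fst (h := fun x => |φ x|) (fun x hx => by simp [hφs x hx]) le_rfl,
    ← integral_const_mul]
  refine integral_mono (hm.abs.continuousOn.integrableOn_compact (isCompact_ballIcc 1))
    (ContinuousOn.integrableOn_compact (f := fun ω : E3 × ℝ => c * |φ ω.1|)
      (isCompact_ballIcc 1) (by fun_prop)) hmφ

lemma setIntegral_closedBall_of_suppIn {r : ℝ} {h : E3 → ℝ} (hs : SuppIn r h) :
    ∫ z in closedBall (0 : E3) r, h z = ∫ z, h z := by
  apply setIntegral_eq_integral_of_forall_compl_eq_zero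
  intro z hz
  rw [mem_closedBall_zero_iff, not_le] at hz
  exact hs z hz

/-- A vector field with given divergence `f` can be replaced by a field with the same divergence,
split in a part controlled by `f` and a mollified part. -/
lemma exists_regularization : ∃ C : ℝ, 0 < C ∧ ∀ (r δ : ℝ) (Z : Fin 3 → E3 → ℝ) (f : E3 → ℝ),
    0 < δ → (∀ i, ContDiff ℝ 1 (Z i)) → (∀ i, SuppIn r (Z i)) → ContDiff ℝ 1 f →
    (∀ x, ∑ i, pd i (Z i) x = f x) →
    ∃ ξ₁ ξ₂ : Fin 3 → E3 → ℝ, (∀ i, ContDiff ℝ 1 (ξ₁ i)) ∧ (∀ i, ContDiff ℝ 1 (ξ₂ i)) ∧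
      (∀ i, SuppIn (r + δ) (ξ₁ i)) ∧ (∀ i, SuppIn (r + δ) (ξ₂ i)) ∧
      (∀ x, ∑ i, pd i (ξ₁ i) x + ∑ i, pd i (ξ₂ i) x = f x) ∧
      (∀ q : ℝ, 1 ≤ q → ∀ i, ∫ x, |ξ₁ i x| ^ q ≤ δ ^ q * ∫ x, |f x| ^ q) ∧
      (∀ q : ℝ, 1 ≤ q → ∀ i k, ∫ x, |pd k (ξ₁ i) x| ^ q ≤ δ ^ q * ∫ x, |pd k f x| ^ q) ∧
      (∀ q : ℝ, 1 ≤ q → ∀ i, ∫ x, |ξ₂ i x| ^ q ≤ ∫ x, |Z i x| ^ q) ∧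
      (∀ q : ℝ, 1 ≤ q → ∀ i k, ∫ x, |pd k (ξ₂ i) x| ^ q ≤ (C * δ⁻¹) ^ q * ∫ x, |Z i x| ^ q) := by
  set φ := mollifier with hφdef
  have hφ : ContDiff ℝ 1 φ := contDiff_mollifier
  have hφs : SuppIn 1 φ := suppIn_mollifier
  have hφabs : ∫ x, |φ x| = 1 := by
    simp_rw [hφdef, abs_of_nonneg (mollifier_nonneg _)]; exact integral_mollifier
  have hP : ∀ k, 0 ≤ ∫ x, |pd k φ x| := fun k => integral_nonneg fun x => abs_nonneg _
  have hφfst : ContDiff ℝ 1 fun ω : E3 × ℝ => φ ω.1 := hφ.comp contDiff_fst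
  refine ⟨1 + ∑ k, ∫ x, |pd k φ x|, by positivity, ?_⟩
  intro r δ Z f hδ hZ hZs hf hdiv
  have hfs : SuppIn r f := fun x hx => by
    rw [← hdiv]
    exact Finset.sum_eq_zero fun i _ => (hZs i).pd i x hx
  let m1 : Fin 3 → E3 × ℝ → ℝ := fun i ω => φ ω.1 * (δ * ω.1 i)
  let τ1 : E3 × ℝ → E3 := fun ω => (-((ω.2 - 1) * δ)) • ω.1
  let m2 : E3 × ℝ → ℝ := fun ω => φ ω.1
  let τ2 : E3 × ℝ → E3 := fun ω => (-δ) • ω.1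
  have hm1 : ∀ i, ContDiff ℝ 1 (m1 i) := fun i =>
    hφfst.mul (contDiff_const.mul ((contDiff_coord i).comp contDiff_fst))
  have hτ1 : ContDiff ℝ 1 τ1 := by unfold τ1; fun_prop
  have hτ2 : ContDiff ℝ 1 τ2 := by unfold τ2; fun_prop
  have hm2 : ContDiff ℝ 1 m2 := hφfst
  have hτ1b : ∀ ω ∈ ballIcc 1, ‖τ1 ω‖ ≤ δ := by
    intro ω hω
    obtain ⟨h1, h2, h3⟩ := hω
    rw [mem_closedBall_zero_iff] at h1
    rw [norm_smul, norm_neg, Real.norm_of_nonneg (by nlinarith)]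
    have : (ω.2 - 1) * δ * ‖ω.1‖ ≤ 1 * δ * 1 := by gcongr; linarith
    linarith
  have hτ2b : ∀ ω ∈ ballIcc 1, ‖τ2 ω‖ ≤ δ := by
    intro ω hω
    obtain ⟨h1, h2, h3⟩ := hω
    rw [mem_closedBall_zero_iff] at h1
    rw [norm_smul, norm_neg, Real.norm_of_nonneg hδ.le]
    nlinarith
  have hm1le : ∀ i ω, |m1 i ω| ≤ δ * |φ ω.1| := by
    intro i ω
    by_cases h : 1 < ‖ω.1‖
    · simp [m1, hφs _ h]
    · push Not at h
      have h1 : |ω.1 i| ≤ 1 := (PiLp.norm_apply_le ω.1 i).trans h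
      simp only [m1, abs_mul, abs_of_pos hδ]
      calc |φ ω.1| * (δ * |ω.1 i|) ≤ |φ ω.1| * (δ * 1) := by gcongr
        _ = _ := by ring
  have hm2le : ∀ ω, |m2 ω| ≤ 1 * |φ ω.1| := fun ω => by simp [m2]
  have hpdξ₂ : ∀ i k, pd k (avg m2 τ2 (Z i)) =
      avg (fun ω => δ⁻¹ * pd k φ ω.1) τ2 (Z i) := by
    intro i k
    rw [pd_avg hm2 hτ2 (hZ i)]
    ext x
    have hsub : ∀ h k' : E3 → ℝ, SuppIn 1 h → ∫ ω in ballIcc 1, h ω.1 * k' (x + (-δ) • ω.1) =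
        ∫ z, h z * k' (x + (-δ) • z) := fun h k' hh =>
      integral_ballIcc_fst (h := fun z => h z * k' (x + (-δ) • z)) (hh.mul_right _) le_rfl
    unfold avg
    rw [hsub φ _ hφs, hsub (fun z => δ⁻¹ * pd k φ z) _ ((hφs.pd k).mul_left _)]
    have hc : ContDiff ℝ 1 fun z => Z i ((-δ) • z + x) := (hZ i).comp (by fun_prop)
    have h := integral_mul_pd k hφ hc hφs
    simp_rw [pd_comp_affine (hZ i)] at h
    simp_rw [add_comm x, mul_assoc]
    rw [integral_const_mul]
    have h3 : ∀ z, φ z * (-δ * pd k (Z i) (-δ • z + x)) =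
      (-δ) * (φ z * pd k (Z i) (-δ • z + x)) := fun z => by ring
    simp_rw [h3] at h
    rw [integral_const_mul] at h
    field_simp
    linarith
  refine ⟨fun i => avg (m1 i) τ1 f, fun i => avg m2 τ2 (Z i),
    fun i => contDiff_avg (hm1 i) hτ1 hf, fun i => contDiff_avg hm2 hτ2 (hZ i),
    fun i => suppIn_avg hτ1b hfs, fun i => suppIn_avg hτ2b (hZs i), ?_, ?_, ?_, ?_, ?_⟩
  · intro x
    have hK := isCompact_ballIcc 1
    have hcp : Continuous fun ω : E3 × ℝ => x + τ1 ω := continuous_const.add hτ1.continuous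
    have e2 : ∑ i, pd i (avg m2 τ2 (Z i)) x = ∫ z, φ z * f (x + (-δ) • z) := by
      simp_rw [fun i => pd_avg hm2 hτ2 (hZ i) i]
      unfold avg
      rw [← integral_finsetSum]
      · simp_rw [← Finset.mul_sum, hdiv]
        exact integral_ballIcc_fst (h := fun z => φ z * f (x + (-δ) • z)) (hφs.mul_right _) le_rfl
      · intro i _
        exact (hm2.continuous.mul ((continuous_pd i (hZ i)).comp
          (continuous_const.add hτ2.continuous))).continuousOn.integrableOn_compact hK
    have e1 : ∑ i, pd i (avg (m1 i) τ1 f) x = f x - ∫ z, φ z * f (x + (-δ) • z) := by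
      simp_rw [fun i => pd_avg (hm1 i) hτ1 hf i]
      unfold avg
      have hcc : ∀ i : Fin 3, Continuous fun ω : E3 × ℝ => m1 i ω * pd i f (x + τ1 ω) :=
        fun i => (hm1 i).continuous.mul ((continuous_pd i hf).comp hcp)
      have hsumc : Continuous fun ω : E3 × ℝ => ∑ i, m1 i ω * pd i f (x + τ1 ω) :=
        continuous_finsetSum _ fun i _ => hcc i
      rw [← integral_finsetSum _ fun i _ => (hcc i).continuousOn.integrableOn_compact hK]
      rw [ballIcc, Measure.volume_eq_prod, setIntegral_prod _
        (by rw [← Measure.volume_eq_prod]; exact hsumc.continuousOn.integrableOn_compact hK)]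
      have hin : ∀ z : E3, ∫ l in Set.Icc (1 : ℝ) 2, ∑ i, m1 i (z, l) * pd i f (x + τ1 (z, l)) =
          φ z * f x - φ z * f (x + (-δ) • z) := by
        intro z
        have hd : ∀ l ∈ Set.uIcc (1 : ℝ) 2, HasDerivAt
            (fun l : ℝ => -(φ z * f (x + τ1 (z, l))))
            (∑ i, m1 i (z, l) * pd i f (x + τ1 (z, l))) l := by
          intro l _
          have e1 : HasDerivAt (fun l : ℝ => x + τ1 (z, l)) ((-δ) • z) l := by
            have := (((((hasDerivAt_id l).sub_const 1).mul_const δ).neg).smul_const z).const_add x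
            exact this.congr_deriv (by simp)
          have e2 := (hf.differentiable one_ne_zero (x + τ1 (z, l))).hasFDerivAt.comp_hasDerivAt l e1
          refine ((e2.const_mul (φ z)).neg).congr_deriv ?_
          rw [fderiv_apply_eq_sum_pd]
          simp only [Fin.sum_univ_three, PiLp.smul_apply, m1, smul_eq_mul]
          ring
        have hci : Continuous fun l : ℝ => ∑ i, m1 i (z, l) * pd i f (x + τ1 (z, l)) :=
          hsumc.comp (by fun_prop : Continuous fun l : ℝ => (z, l))
        rw [integral_Icc_eq_integral_Ioc, ← intervalIntegral.integral_of_le (by norm_num),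
          intervalIntegral.integral_eq_sub_of_hasDerivAt hd (hci.intervalIntegrable 1 2)]
        simp only [τ1]
        norm_num
        ring
      simp_rw [hin]
      have hi1 : Integrable fun z => φ z * f (x + (-δ) • z) :=
        integrable_of_suppIn (by have := hf.continuous; have := hφ.continuous; fun_prop)
          (hφs.mul_right _)
      have hi2 : Integrable fun z => φ z := integrable_of_suppIn hφ.continuous hφs
      rw [setIntegral_closedBall_of_suppIn ((hφs.mul_right _).sub (hφs.mul_right _)),
        integral_sub (hi2.mul_const _) hi1, integral_mul_const, hφdef, integral_mollifier, one_mul]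
    rw [e1, e2]; ring
  · intro q hq i
    have := integral_abs_avg_rpow_le_of_le (hm1 i).continuous hτ1.continuous hf.continuous hτ1b
      hfs hq hφ.continuous hφs (hm1le i)
    rwa [hφabs, mul_one] at this
  · intro q hq i k
    rw [pd_avg (hm1 i) hτ1 hf]
    have := integral_abs_avg_rpow_le_of_le (hm1 i).continuous hτ1.continuous (continuous_pd k hf)
      hτ1b (hfs.pd k) hq hφ.continuous hφs (hm1le i)
    rwa [hφabs, mul_one] at this
  · intro q hq i
    have := integral_abs_avg_rpow_le_of_le hm2.continuous hτ2.continuous (hZ i).continuous hτ2b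
      (hZs i) hq hφ.continuous hφs hm2le
    rwa [hφabs, mul_one, Real.one_rpow, one_mul] at this
  · intro q hq i k
    rw [hpdξ₂]
    have hpc : Continuous (pd k φ) := continuous_pd k hφ
    have := integral_abs_avg_rpow_le_of_le (m := fun ω => δ⁻¹ * pd k φ ω.1) (by fun_prop)
      hτ2.continuous (hZ i).continuous hτ2b (hZs i) hq hpc (hφs.pd k)
      (fun ω => by rw [abs_mul, abs_of_pos (inv_pos.2 hδ)])
    refine this.trans ?_
    have hI : 0 ≤ ∫ x, |Z i x| ^ q := integral_nonneg fun x => by positivity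
    have h4 : ∫ x, |pd k φ x| ≤ 1 + ∑ k, ∫ x, |pd k φ x| := by
      have := Finset.single_le_sum (f := fun k => ∫ x, |pd k φ x|) (fun k _ => hP k)
        (Finset.mem_univ k)
      linarith
    have := hP k
    rw [mul_comm δ⁻¹]
    gcongr

end Regularization


section Tools

lemma pd_comp {h : ℝ → ℝ} {g : E3 → ℝ} (hh : ContDiff ℝ 1 h) (hg : ContDiff ℝ 1 g) (i : Fin 3)
    (x : E3) : pd i (fun y => h (g y)) x = deriv h (g x) * pd i g x := by
  have h1 := (hh.differentiable one_ne_zero (g x)).hasDerivAt.comp_hasFDerivAt x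
    (hg.differentiable one_ne_zero x).hasFDerivAt
  rw [pd]
  erw [h1.fderiv]
  simp [pd]

lemma pd_const_mul {f : E3 → ℝ} (i : Fin 3) (c : ℝ) (hf : ContDiff ℝ 1 f) (x : E3) :
    pd i (fun y => c * f y) x = c * pd i f x := by
  rw [pd_mul i contDiff_const hf]
  simp [pd]

lemma pd_norm_sq (i : Fin 3) (x : E3) : pd i (fun y : E3 => ‖y‖ ^ 2) x = 2 * x i := by
  rw [pd, ((hasStrictFDerivAt_norm_sq x).hasFDerivAt).fderiv]
  have := EuclideanSpace.inner_single_right i (1 : ℝ) x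
  simp [this]

lemma pd_coord (i k : Fin 3) (x : E3) : |pd k (fun y : E3 => y i) x| ≤ 1 := by
  have h := ((EuclideanSpace.proj i : E3 →L[ℝ] ℝ).hasFDerivAt (x := x)).fderiv
  rw [pd]
  erw [h]
  by_cases hik : i = k <;> simp [hik]

/-- Smooth cutoff functions with controlled first and second derivatives. -/
lemma exists_cutoff : ∃ C : ℝ, 0 < C ∧ ∀ ρ τ : ℝ, 0 < ρ → 0 < τ → ∃ η : E3 → ℝ,
    ContDiff ℝ (⊤ : ℕ∞) η ∧ (∀ x, 0 ≤ η x) ∧ (∀ x, η x ≤ 1) ∧ (∀ x, ‖x‖ ≤ ρ → η x = 1) ∧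
    SuppIn (ρ + τ) η ∧ (∀ i x, |pd i η x| ≤ C * τ⁻¹) ∧
    (∀ i k x, |pd k (pd i η) x| ≤ C * τ⁻¹ ^ 2) := by
  let θ : ℝ → ℝ := smoothTransition
  have hθ : ∀ {n : ℕ∞}, ContDiff ℝ n θ := smoothTransition.contDiff
  have hθ' : ContDiff ℝ 1 (deriv θ) := by
    have : ContDiff ℝ (1 + 1) θ := by
      have := hθ (n := 2)
      norm_num at this ⊢
      exact this
    exact ((contDiff_succ_iff_deriv (n := 1)).1 this).2.2
  have hθ'' : Continuous (deriv (deriv θ)) := hθ'.continuous_deriv le_rfl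
  have hc1 : HasCompactSupport (deriv θ) := by
    refine HasCompactSupport.intro (K := Set.Icc 0 1) isCompact_Icc fun x hx => ?_
    rw [Set.mem_Icc, not_and_or, not_le, not_le] at hx
    rcases hx with hx | hx
    · have : θ =ᶠ[𝓝 x] fun _ => 0 := by
        filter_upwards [Iio_mem_nhds hx] with y hy using smoothTransition.zero_of_nonpos (le_of_lt hy)
      simp [this.deriv_eq]
    · have : θ =ᶠ[𝓝 x] fun _ => 1 := by
        filter_upwards [Ioi_mem_nhds hx] with y hy using smoothTransition.one_of_one_le (le_of_lt hy)
      simp [this.deriv_eq]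
  obtain ⟨A, hA⟩ := hc1.exists_bound_of_continuous hθ'.continuous
  obtain ⟨B, hB⟩ := hc1.deriv.exists_bound_of_continuous hθ''
  have hA0 : 0 ≤ A := (norm_nonneg _).trans (hA 0)
  have hB0 : 0 ≤ B := (norm_nonneg _).trans (hB 0)
  refine ⟨4 * B + 2 * A + 1, by positivity, fun ρ τ hρ hτ => ?_⟩
  set L := τ * (2 * ρ + τ) with hL
  have hL0 : 0 < L := by positivity
  let g : E3 → ℝ := fun x => L⁻¹ * ((ρ + τ) ^ 2 - ‖x‖ ^ 2)
  have hg : ∀ {n : WithTop ℕ∞}, ContDiff ℝ n g := by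
    intro n
    exact contDiff_const.mul (contDiff_const.sub (contDiff_norm_sq ℝ))
  have hpg : ∀ i x, pd i g x = -2 * L⁻¹ * x i := by
    intro i x
    have h1 : ContDiff ℝ 1 fun x : E3 => ‖x‖ ^ 2 := contDiff_norm_sq ℝ
    rw [pd_const_mul i L⁻¹ (contDiff_const.sub h1), pd_sub i contDiff_const h1, pd_norm_sq]
    simp [pd]
    ring
  let η : E3 → ℝ := fun x => θ (g x)
  have hη : ContDiff ℝ (⊤ : ℕ∞) η := (hθ (n := ⊤)).comp hg
  have hηs : SuppIn (ρ + τ) η := by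
    intro x hx
    refine smoothTransition.zero_of_nonpos ?_
    have : (ρ + τ) ^ 2 - ‖x‖ ^ 2 ≤ 0 := by nlinarith
    have := inv_pos.2 hL0
    simp only [g]
    nlinarith
  have hp1 : ∀ i x, pd i η x = deriv θ (g x) * (-2 * L⁻¹ * x i) := by
    intro i x
    rw [pd_comp (hθ (n := 1)) hg, hpg]
  have hLx : ∀ i (x : E3), ‖x‖ ≤ ρ + τ → |-2 * L⁻¹ * x i| ≤ 2 * τ⁻¹ := by
    intro i x hx
    have h1 : |x i| ≤ ρ + τ := (PiLp.norm_apply_le x i).trans hx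
    rw [abs_mul, abs_mul, abs_of_pos (inv_pos.2 hL0), abs_neg, abs_two]
    calc 2 * L⁻¹ * |x i| ≤ 2 * L⁻¹ * (2 * ρ + τ) := by gcongr; linarith
      _ = 2 * τ⁻¹ := by rw [hL]; field_simp
  have hτi : 0 < τ⁻¹ := inv_pos.2 hτ
  refine ⟨η, hη, fun x => smoothTransition.nonneg _, fun x => smoothTransition.le_one _, ?_, hηs,
    ?_, ?_⟩
  · intro x hx
    refine smoothTransition.one_of_one_le ?_
    have h1 : L ≤ (ρ + τ) ^ 2 - ‖x‖ ^ 2 := by nlinarith [norm_nonneg x]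
    calc (1 : ℝ) = L⁻¹ * L := (inv_mul_cancel₀ hL0.ne').symm
      _ ≤ g x := by simp only [g]; gcongr
  · intro i x
    by_cases hx : ρ + τ < ‖x‖
    · rw [hηs.pd i x hx, abs_zero]; positivity
    push Not at hx
    rw [hp1, abs_mul]
    calc |deriv θ (g x)| * |-2 * L⁻¹ * x i| ≤ A * (2 * τ⁻¹) :=
          mul_le_mul (hA _) (hLx i x hx) (abs_nonneg _) hA0
      _ ≤ _ := by nlinarith
  · intro i k x
    by_cases hx : ρ + τ < ‖x‖
    · rw [(hηs.pd i).pd k x hx, abs_zero]; positivity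
    push Not at hx
    have h2 : pd i η = fun x => deriv θ (g x) * (-2 * L⁻¹ * x i) := funext (hp1 i)
    have hc2 : ContDiff ℝ 1 fun x => deriv θ (g x) := hθ'.comp hg
    have hc3 : ContDiff ℝ 1 fun x : E3 => -2 * L⁻¹ * x i := contDiff_const.mul (contDiff_coord i)
    rw [h2, pd_mul k hc2 hc3, pd_comp hθ' hg, hpg, pd_const_mul k _ (contDiff_coord i)]
    have hLi : L⁻¹ ≤ τ⁻¹ ^ 2 := by
      rw [inv_pow]
      apply inv_anti₀ (by positivity)
      nlinarith
    have hτ2 : 0 < τ⁻¹ ^ 2 := by positivity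
    have t1 : |deriv (deriv θ) (g x) * (-2 * L⁻¹ * x k) * (-2 * L⁻¹ * x i)| ≤
        B * (2 * τ⁻¹) * (2 * τ⁻¹) := by
      rw [abs_mul, abs_mul]
      gcongr
      · exact hB _
      · exact hLx k x hx
      · exact hLx i x hx
    have t2 : |deriv θ (g x) * (-2 * L⁻¹ * pd k (fun y : E3 => y i) x)| ≤
        A * (2 * τ⁻¹ ^ 2 * 1) := by
      rw [abs_mul, abs_mul, abs_mul, abs_of_pos (inv_pos.2 hL0), abs_neg, abs_two]
      gcongr
      · exact hA _
      · exact pd_coord i k x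
    calc _ ≤ _ := abs_add_le _ _
      _ ≤ _ := add_le_add t1 t2
      _ ≤ _ := by nlinarith

/-- Hölder's inequality for finitely many continuous functions on a ball. -/
lemma integral_ball3_prod_rpow_le {ι : Type*} [Fintype ι] (r : ℝ) {h : ι → E3 → ℝ}
    (hc : ∀ k, Continuous (h k)) (h0 : ∀ k x, 0 ≤ h k x) {p : ι → ℝ} (hp0 : ∀ k, 0 ≤ p k)
    (hp1 : ∑ k, p k = 1) :
    ∫ x in ball3 r, ∏ k, h k x ^ p k ≤ ∏ k, (∫ x in ball3 r, h k x) ^ p k := by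
  have hi0 : ∀ k, 0 ≤ ∫ x in ball3 r, h k x := fun k => integral_nonneg (h0 k)
  have hcp : Continuous fun x => ∏ k, h k x ^ p k :=
    continuous_finsetProd _ fun k _ => (hc k).rpow_const fun _ => Or.inr (hp0 k)
  have hprod : ∀ x, 0 ≤ ∏ k, h k x ^ p k :=
    fun x => Finset.prod_nonneg fun k _ => Real.rpow_nonneg (h0 k x) _
  rw [← ENNReal.ofReal_le_ofReal_iff (Finset.prod_nonneg fun k _ => Real.rpow_nonneg (hi0 k) _),
    ofReal_integral_eq_lintegral_ofReal (integrableOn_ball3 hcp r) (ae_of_all _ hprod),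
    ENNReal.ofReal_prod_of_nonneg fun k _ => Real.rpow_nonneg (hi0 k) _]
  have := ENNReal.lintegral_prod_norm_pow_le (μ := volume.restrict (ball3 r)) Finset.univ
    (f := fun k x => ENNReal.ofReal (h k x)) (fun k _ => (hc k).measurable.ennreal_ofReal.aemeasurable)
    hp1 (fun k _ => hp0 k)
  convert this using 1
  · congr 1; ext x
    rw [ENNReal.ofReal_prod_of_nonneg fun k _ => Real.rpow_nonneg (h0 k x) _]
    exact Finset.prod_congr rfl fun k _ =>
      (ENNReal.ofReal_rpow_of_nonneg (h0 k x) (hp0 k)).symm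
  · refine Finset.prod_congr rfl fun k _ => ?_
    rw [← ofReal_integral_eq_lintegral_ofReal (integrableOn_ball3 (hc k) r) (ae_of_all _ (h0 k)),
      ENNReal.ofReal_rpow_of_nonneg (hi0 k) (hp0 k)]

lemma holder_two (r : ℝ) {a b : E3 → ℝ} (ha : Continuous a) (hb : Continuous b)
    (ha0 : ∀ x, 0 ≤ a x) (hb0 : ∀ x, 0 ≤ b x) {p q : ℝ} (hp : 0 ≤ p) (hq : 0 ≤ q)
    (hpq : p + q = 1) :
    ∫ x in ball3 r, a x ^ p * b x ^ q ≤ (∫ x in ball3 r, a x) ^ p * (∫ x in ball3 r, b x) ^ q := by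
  have := integral_ball3_prod_rpow_le r (h := ![a, b]) (p := ![p, q])
    (by intro k; fin_cases k <;> simpa) (by intro k; fin_cases k <;> simpa)
    (by intro k; fin_cases k <;> simpa) (by simpa [Fin.sum_univ_two] using hpq)
  simpa [Fin.prod_univ_two] using this

lemma holder_three (r : ℝ) {a b c : E3 → ℝ} (ha : Continuous a) (hb : Continuous b)
    (hc : Continuous c) (ha0 : ∀ x, 0 ≤ a x) (hb0 : ∀ x, 0 ≤ b x) (hc0 : ∀ x, 0 ≤ c x)
    {p q t : ℝ} (hp : 0 ≤ p) (hq : 0 ≤ q) (ht : 0 ≤ t) (hpq : p + q + t = 1) :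
    ∫ x in ball3 r, a x ^ p * b x ^ q * c x ^ t ≤
      (∫ x in ball3 r, a x) ^ p * (∫ x in ball3 r, b x) ^ q * (∫ x in ball3 r, c x) ^ t := by
  have := integral_ball3_prod_rpow_le r (h := ![a, b, c]) (p := ![p, q, t])
    (by intro k; fin_cases k <;> simpa) (by intro k; fin_cases k <;> simpa)
    (by intro k; fin_cases k <;> simpa) (by simpa [Fin.sum_univ_three] using hpq)
  simpa [Fin.prod_univ_three] using this

lemma holder_four (r : ℝ) {a b c d : E3 → ℝ} (ha : Continuous a) (hb : Continuous b)
    (hc : Continuous c) (hd : Continuous d) (ha0 : ∀ x, 0 ≤ a x) (hb0 : ∀ x, 0 ≤ b x)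
    (hc0 : ∀ x, 0 ≤ c x) (hd0 : ∀ x, 0 ≤ d x)
    {p q t v : ℝ} (hp : 0 ≤ p) (hq : 0 ≤ q) (ht : 0 ≤ t) (hv : 0 ≤ v) (hpq : p + q + t + v = 1) :
    ∫ x in ball3 r, a x ^ p * b x ^ q * c x ^ t * d x ^ v ≤
      (∫ x in ball3 r, a x) ^ p * (∫ x in ball3 r, b x) ^ q * (∫ x in ball3 r, c x) ^ t *
        (∫ x in ball3 r, d x) ^ v := by
  have := integral_ball3_prod_rpow_le r (h := ![a, b, c, d]) (p := ![p, q, t, v])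
    (by intro k; fin_cases k <;> simpa) (by intro k; fin_cases k <;> simpa)
    (by intro k; fin_cases k <;> simpa) (by simpa [Fin.sum_univ_four] using hpq)
  simpa [Fin.prod_univ_four] using this

lemma hasDerivAt_abs_mul_self (x : ℝ) : HasDerivAt (fun y : ℝ => |y| * y) (2 * |x|) x := by
  rcases lt_trichotomy x 0 with h | h | h
  · have : (fun y : ℝ => |y| * y) =ᶠ[𝓝 x] fun y => -(y ^ 2) := by
      filter_upwards [Iio_mem_nhds h] with y hy
      rw [abs_of_neg hy]; ring
    rw [abs_of_neg h]
    exact ((hasDerivAt_pow 2 x).neg.congr_deriv (by norm_num)).congr_of_eventuallyEq this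
  · subst h
    rw [hasDerivAt_iff_isLittleO]
    simp only [abs_zero, mul_zero, sub_zero, smul_zero]
    have h1 : (fun y : ℝ => |y|) =o[𝓝 0] fun _ => (1 : ℝ) := by
      rw [Asymptotics.isLittleO_one_iff]
      exact continuous_abs.tendsto' 0 0 abs_zero
    simpa using h1.mul_isBigO (Asymptotics.isBigO_refl (fun y : ℝ => y) (𝓝 0))
  · have : (fun y : ℝ => |y| * y) =ᶠ[𝓝 x] fun y => y ^ 2 := by
      filter_upwards [Ioi_mem_nhds h] with y hy
      rw [abs_of_pos hy]; ring
    rw [abs_of_pos h]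
    exact ((hasDerivAt_pow 2 x).congr_deriv (by norm_num)).congr_of_eventuallyEq this

lemma deriv_abs_mul_self : deriv (fun y : ℝ => |y| * y) = fun x => 2 * |x| :=
  funext fun x => (hasDerivAt_abs_mul_self x).deriv

lemma contDiff_abs_mul_self : ContDiff ℝ 1 fun y : ℝ => |y| * y := by
  rw [contDiff_one_iff_deriv]
  refine ⟨fun x => (hasDerivAt_abs_mul_self x).differentiableAt, ?_⟩
  rw [deriv_abs_mul_self]
  fun_prop

lemma norm_fderiv_sq_le (f : E3 → ℝ) (x : E3) : ‖fderiv ℝ f x‖ ^ 2 ≤ ∑ i, pd i f x ^ 2 := by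
  have h0 : 0 ≤ ∑ i, pd i f x ^ 2 := Finset.sum_nonneg fun i _ => sq_nonneg _
  have : ‖fderiv ℝ f x‖ ≤ Real.sqrt (∑ i, pd i f x ^ 2) := by
    refine ContinuousLinearMap.opNorm_le_bound _ (Real.sqrt_nonneg _) fun v => ?_
    rw [fderiv_apply_eq_sum_pd, Real.norm_eq_abs, EuclideanSpace.norm_eq, mul_comm,
      ← Real.sqrt_mul (Finset.sum_nonneg fun i _ => sq_nonneg _)]
    refine Real.abs_le_sqrt ?_
    have := Finset.sum_mul_sq_le_sq_mul_sq Finset.univ (fun i => v i) (fun i => pd i f x)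
    simpa using this
  calc ‖fderiv ℝ f x‖ ^ 2 ≤ Real.sqrt (∑ i, pd i f x ^ 2) ^ 2 := by gcongr
    _ = _ := Real.sq_sqrt h0

/-- The Sobolev inequality `L⁶ ⊆ Ḣ¹` for compactly supported functions. -/
lemma exists_sobolev : ∃ C : ℝ, 0 < C ∧ ∀ (r : ℝ) (f : E3 → ℝ), ContDiff ℝ 1 f → SuppIn r f →
    ∫ x, f x ^ 6 ≤ C * (∫ x, ∑ i, pd i f x ^ 2) ^ 3 := by
  set c := eLpNormLESNormFDerivOfEqInnerConst (volume : Measure E3) (2 : NNReal) with hc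
  refine ⟨(c : ℝ) ^ 6 + 1, by positivity, fun r f hf hfs => ?_⟩
  have h := eLpNorm_le_eLpNorm_fderiv_of_eq_inner (volume : Measure E3) hf hfs.hasCompactSupport
    (p := 2) (p' := 6) (by norm_num) (by simp) (by simp; norm_num)
  rw [← hc] at h
  have hcd : Continuous (fderiv ℝ f) := hf.continuous_fderiv one_ne_zero
  have hI : 0 ≤ ∫ x, ∑ i, pd i f x ^ 2 :=
    integral_nonneg fun x => Finset.sum_nonneg fun i _ => sq_nonneg _
  have m1 : MemLp f (6 : NNReal) := hf.continuous.memLp_of_hasCompactSupport hfs.hasCompactSupport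
  have m2 : MemLp (fderiv ℝ f) (2 : NNReal) :=
    hcd.memLp_of_hasCompactSupport (hfs.hasCompactSupport.fderiv (𝕜 := ℝ))
  rw [m1.eLpNorm_eq_integral_rpow_norm (by norm_num) (by simp),
    m2.eLpNorm_eq_integral_rpow_norm (by norm_num) (by simp)] at h
  have e1 : ∀ x, ‖f x‖ ^ ((6 : NNReal) : ENNReal).toReal = f x ^ 6 := by
    intro x
    simp only [ENNReal.coe_toReal, NNReal.coe_ofNat, Real.norm_eq_abs]
    rw [show (6 : ℝ) = ((6 : ℕ) : ℝ) by norm_num, Real.rpow_natCast]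
    exact Even.pow_abs (by decide) _
  have e2 : ∀ x, ‖fderiv ℝ f x‖ ^ ((2 : NNReal) : ENNReal).toReal = ‖fderiv ℝ f x‖ ^ 2 := by
    intro x; simp
  simp_rw [e1, e2] at h
  have hA : 0 ≤ ∫ x, f x ^ 6 := integral_nonneg fun x => by positivity
  have hB : 0 ≤ ∫ x, ‖fderiv ℝ f x‖ ^ 2 := integral_nonneg fun x => by positivity
  have hBle : ∫ x, ‖fderiv ℝ f x‖ ^ 2 ≤ ∫ x, ∑ i, pd i f x ^ 2 := by
    refine integral_mono_of_nonneg (ae_of_all _ fun x => sq_nonneg _) ?_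
      (ae_of_all _ fun x => norm_fderiv_sq_le f x)
    exact integrable_finsetSum _ fun i _ => integrable_of_suppIn (r := r)
      ((continuous_pd i hf).pow 2) fun x hx => by simp [hfs.pd i x hx]
  rw [show (c : ENNReal) = ENNReal.ofReal (c : ℝ) by simp,
    ← ENNReal.ofReal_mul (by positivity), ENNReal.ofReal_le_ofReal_iff (by positivity)] at h
  simp only [ENNReal.coe_toReal, NNReal.coe_ofNat] at h
  have h6 := pow_le_pow_left₀ (by positivity) h 6
  rw [mul_pow, ← Real.rpow_natCast, ← Real.rpow_natCast (_ ^ _), ← Real.rpow_mul hA, ← Real.rpow_mul hB] at h6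
  norm_num at h6
  calc ∫ x, f x ^ 6 ≤ (c : ℝ) ^ 6 * (∫ x, ‖fderiv ℝ f x‖ ^ 2) ^ 3 := h6
    _ ≤ (c : ℝ) ^ 6 * (∫ x, ∑ i, pd i f x ^ 2) ^ 3 := by gcongr
    _ ≤ _ := by
      have : 0 ≤ (∫ x, ∑ i, pd i f x ^ 2) ^ 3 := by positivity
      nlinarith

end Tools


section CubicEstimate

lemma exists_exp_eq {a : ℝ} (ha : 1 ≤ a) : ∃ t, 0 ≤ t ∧ a = Real.exp t :=
  ⟨Real.log a, Real.log_nonneg ha, (Real.exp_log (by linarith)).symm⟩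

/-- Closing the cubic estimate: an elementary absorption argument. -/
lemma cubic_absorption {σ γ c R κ D X M : ℝ} (h6 : 1 / 6 ≤ σ) (h3 : σ ≤ 1 / 3)
    (hγ : γ * (1 + 6 * σ) = 9 * σ) (hc : 1 ≤ c) (hR : 1 ≤ R) (hκ : 1 ≤ κ) (hD : 1 ≤ D)
    (hM : M = D ∨ M = κ ^ 2 * R⁻¹ * X ^ ((2 : ℝ) / 3))
    (h : X ≤ c * (R ^ (1 / 3 + 2 * σ) * X ^ (2 / 3 - 2 * σ) * M ^ (3 * σ - 1 / 2) * D ^ ((1 : ℝ) / 2)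
      + κ * R ^ (1 / 3 - σ) * X ^ ((2 : ℝ) / 3))) :
    X ≤ (2 * c) ^ 3 * (κ ^ 3 * R * D ^ γ) := by
  set Y := κ ^ 3 * R * D ^ γ with hY
  have hD0 : 0 < D := by linarith
  have hY0 : 0 < Y := by positivity
  have hc8 : 1 ≤ (2 * c) ^ 3 := one_le_pow₀ (by linarith)
  by_cases hXY : X ≤ Y
  · nlinarith
  push Not at hXY
  have hX0 : 0 < X := hY0.trans hXY
  obtain ⟨r, hr, rfl⟩ := exists_exp_eq hR
  obtain ⟨k, hk, rfl⟩ := exists_exp_eq hκ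
  obtain ⟨d, hd, rfl⟩ := exists_exp_eq hD
  obtain ⟨ξ, rfl⟩ : ∃ ξ, X = Real.exp ξ := ⟨Real.log X, (Real.exp_log hX0).symm⟩
  have hYe : Y = Real.exp (3 * k + r + γ * d) := by
    rw [hY, ← Real.exp_nat_mul, ← Real.exp_mul, ← Real.exp_add, ← Real.exp_add]
    push_cast; ring_nf
  have hξ : 3 * k + r + γ * d < ξ := by
    rw [hYe] at hXY
    exact Real.exp_lt_exp.1 hXY
  have hγ34 : 3 / 4 ≤ γ := by nlinarith
  have t1 : Real.exp r ^ (1 / 3 + 2 * σ) * Real.exp ξ ^ (2 / 3 - 2 * σ) * M ^ (3 * σ - 1 / 2) *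
      Real.exp d ^ ((1 : ℝ) / 2) ≤ Real.exp ((3 * k + r + γ * d) / 3 + 2 * ξ / 3) := by
    rcases hM with hM | hM
    · rw [hM]
      simp only [← Real.exp_mul, ← Real.exp_add]
      rw [Real.exp_le_exp]
      have h1 : 0 ≤ σ * (ξ - (3 * k + r + γ * d)) := by
        apply mul_nonneg <;> linarith
      have h2 : 0 ≤ σ * k := by apply mul_nonneg <;> linarith
      have h3 : γ * (1 + 6 * σ) * d = 9 * σ * d := by rw [hγ]
      nlinarith
    · have hMe : M = Real.exp (2 * k - r + 2 / 3 * ξ) := by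
        rw [hM, ← Real.exp_nat_mul, ← Real.exp_neg, ← Real.exp_mul, ← Real.exp_add, ← Real.exp_add]
        push_cast; ring_nf
      rw [hMe]
      simp only [← Real.exp_mul, ← Real.exp_add]
      rw [Real.exp_le_exp]
      have h2 : 0 ≤ (1 / 3 - σ) * k := by apply mul_nonneg <;> linarith
      have h3 : 0 ≤ (σ - 1 / 6) * r := by apply mul_nonneg <;> linarith
      have h4 : 0 ≤ (γ - 3 / 4) * d := by apply mul_nonneg <;> linarith
      nlinarith
  have t2 : Real.exp k * Real.exp r ^ (1 / 3 - σ) * Real.exp ξ ^ ((2 : ℝ) / 3) ≤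
      Real.exp ((3 * k + r + γ * d) / 3 + 2 * ξ / 3) := by
    simp only [← Real.exp_mul, ← Real.exp_add]
    rw [Real.exp_le_exp]
    have h1 : 0 ≤ σ * r := by apply mul_nonneg <;> linarith
    have h4 : 0 ≤ γ * d := by apply mul_nonneg <;> linarith
    nlinarith
  have h5 : Real.exp ξ ≤ (2 * c) * Real.exp ((3 * k + r + γ * d) / 3 + 2 * ξ / 3) := by
    refine h.trans ?_
    have := mul_le_mul_of_nonneg_left (add_le_add t1 t2) (by linarith : 0 ≤ c)
    linarith
  have h6 : Real.exp (ξ / 3) ≤ (2 * c) * Real.exp ((3 * k + r + γ * d) / 3) := by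
    have e1 : Real.exp ξ = Real.exp (ξ / 3) * Real.exp (2 * ξ / 3) := by
      rw [← Real.exp_add]; ring_nf
    rw [e1, Real.exp_add, ← mul_assoc] at h5
    exact le_of_mul_le_mul_right h5 (Real.exp_pos _)
  have h7 := pow_le_pow_left₀ (Real.exp_pos _).le h6 3
  rw [mul_pow, ← Real.exp_nat_mul, ← Real.exp_nat_mul] at h7
  rw [hYe]
  have e2 : ((3 : ℕ) : ℝ) * (ξ / 3) = ξ := by push_cast; ring
  have e3 : ((3 : ℕ) : ℝ) * ((3 * k + r + γ * d) / 3) = 3 * k + r + γ * d := by push_cast; ring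
  rwa [e2, e3] at h7

lemma exists_volume_ball3_le : ∃ c : ℝ, 1 ≤ c ∧ ∀ R : ℝ, 0 ≤ R →
    volume.real (ball3 (2 * R)) ≤ c * R ^ 3 := by
  refine ⟨1 + 8 * volume.real (closedBall (0 : E3) 1), by
    have : 0 ≤ volume.real (closedBall (0 : E3) 1) := by positivity
    linarith, fun R hR => ?_⟩
  have h1 : volume.real (ball3 (2 * R)) ≤ volume.real (closedBall (0 : E3) (2 * R)) :=
    measureReal_mono ball_subset_closedBall measure_closedBall_lt_top.ne
  rw [Measure.addHaar_real_closedBall' _ _ (by positivity)] at h1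
  simp only [finrank_euclideanSpace, Fintype.card_fin] at h1
  have : 0 ≤ R ^ 3 := by positivity
  nlinarith

lemma integral_ball3_mono_radius {f : E3 → ℝ} (hf : Continuous f) (h0 : ∀ x, 0 ≤ f x) {r r' : ℝ}
    (h : r ≤ r') : ∫ x in ball3 r, f x ≤ ∫ x in ball3 r', f x :=
  setIntegral_mono_set (integrableOn_ball3 hf r') (ae_of_all _ h0)
    (ae_of_all _ (ball_subset_ball h))

lemma integral_ball3_mono {f g : E3 → ℝ} (hf : Continuous f) (hg : Continuous g) {r : ℝ}
    (h : ∀ x, f x ≤ g x) : ∫ x in ball3 r, f x ≤ ∫ x in ball3 r, g x :=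
  integral_mono (integrableOn_ball3 hf r) (integrableOn_ball3 hg r) h

lemma pow_three_rpow_two_thirds {a : ℝ} (ha : 0 ≤ a) : (a ^ 3) ^ ((2 : ℝ) / 3) = a ^ 2 := by
  rw [← Real.rpow_natCast, ← Real.rpow_mul ha]
  norm_num

/-- Interpolation of the `L²` norm between `L³` and the volume. -/
lemma integral_sq_le_cube {f : E3 → ℝ} (hf : Continuous f) (h0 : ∀ x, 0 ≤ f x) (r : ℝ) :
    ∫ x in ball3 r, f x ^ 2 ≤
      (∫ x in ball3 r, f x ^ 3) ^ ((2 : ℝ) / 3) * (volume.real (ball3 r)) ^ ((1 : ℝ) / 3) := by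
  have := holder_two r (a := fun x => f x ^ 3) (b := fun _ => 1) (by fun_prop) (by fun_prop)
    (fun x => pow_nonneg (h0 x) 3) (fun _ => zero_le_one) (p := 2 / 3) (q := 1 / 3) (by norm_num)
    (by norm_num) (by norm_num)
  simp only [pow_three_rpow_two_thirds (h0 _), Real.one_rpow, mul_one] at this
  simpa [Measure.real] using this

end CubicEstimate


section CubicBound

/-- The Sobolev inequality for a function localised by the square of a cutoff. -/
lemma exists_localized_sobolev : ∃ C : ℝ, 0 < C ∧ ∀ (r' r G : ℝ) (ζ f : E3 → ℝ), r' < r →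
    ContDiff ℝ 1 ζ → (∀ x, 0 ≤ ζ x) → (∀ x, ζ x ≤ 1) → SuppIn r' ζ → (∀ i x, |pd i ζ x| ≤ G) →
    ContDiff ℝ 1 f →
    ∫ x in ball3 r, (ζ x ^ 2 * f x) ^ 6 ≤
      C * (24 * G ^ 2 * (∫ x in ball3 r, (ζ x * |f x|) ^ 2) +
        2 * ∫ x in ball3 r, ∑ i, pd i f x ^ 2) ^ 3 := by
  obtain ⟨C, hC, h⟩ := exists_sobolev
  refine ⟨C, hC, fun r' r G ζ f hr hζ h0 h1 hs hG hf => ?_⟩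
  have hg1 : ContDiff ℝ 1 fun x => ζ x ^ 2 * f x := by fun_prop
  have hgs : SuppIn r' fun x => ζ x ^ 2 * f x := fun x hx => by simp [hs x hx]
  have hpd : ∀ i, Continuous (pd i f) := fun i => continuous_pd i hf
  have hpg : ∀ i, Continuous (pd i fun x => ζ x ^ 2 * f x) := fun i => continuous_pd i hg1
  have key := h r' _ hg1 hgs
  rw [setIntegral_eq_integral_of_suppIn (fun x hx => by simp [hs x hx]) hr]
  refine key.trans ?_
  refine mul_le_mul_of_nonneg_left (pow_le_pow_left₀ (integral_nonneg fun x =>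
    Finset.sum_nonneg fun i _ => sq_nonneg _) ?_ 3) hC.le
  rw [← setIntegral_eq_integral_of_suppIn (r := r') (r' := r) (SuppIn.sum fun i _ => fun x hx => by
    simp [hgs.pd i x hx]) hr, ← integral_const_mul, ← integral_const_mul, ← integral_add]
  rotate_left
  · exact integrableOn_ball3 (by fun_prop) r
  · exact integrableOn_ball3 (by fun_prop) r
  apply integral_ball3_mono (by fun_prop) (by fun_prop)
  intro x
  have hterm : ∀ i, pd i (fun x => ζ x ^ 2 * f x) x ^ 2 ≤
      8 * G ^ 2 * (ζ x * |f x|) ^ 2 + 2 * pd i f x ^ 2 := by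
    intro i
    have e : pd i (fun x => ζ x ^ 2 * f x) x =
        2 * pd i ζ x * (ζ x * f x) + ζ x ^ 2 * pd i f x := by
      have := pd_mul i (f := fun x => ζ x ^ 2) (g := f) (by fun_prop) hf x
      rw [this]
      have := pd_mul i hζ hζ x
      simp only [← pow_two] at this
      rw [this]; ring
    rw [e]
    have hz2 : (ζ x ^ 2) ^ 2 ≤ 1 := by
      rw [← pow_mul]; exact pow_le_one₀ (h0 x) (h1 x)
    have hG2 : pd i ζ x ^ 2 ≤ G ^ 2 := by
      rw [← sq_abs]; exact pow_le_pow_left₀ (abs_nonneg _) (hG i x) 2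
    have a1 := mul_le_mul_of_nonneg_right hz2 (sq_nonneg (pd i f x))
    have a2 := mul_le_mul_of_nonneg_right hG2 (sq_nonneg (ζ x * f x))
    have a3 : (ζ x * |f x|) ^ 2 = (ζ x * f x) ^ 2 := by rw [mul_pow, sq_abs, mul_pow]
    rw [a3]
    nlinarith [sq_nonneg (2 * pd i ζ x * (ζ x * f x) - ζ x ^ 2 * pd i f x)]
  refine (Finset.sum_le_sum fun i _ => hterm i).trans ?_
  simp only [Fin.sum_univ_three]
  linarith

/-- Integration by parts in the cubic integral of a divergence. -/
lemma integral_cube_le_of_divergence {r' r G : ℝ} {ζ f : E3 → ℝ} {F : Fin 3 → E3 → ℝ} (hr : r' < r)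
    (hζ : ContDiff ℝ 1 ζ) (h0 : ∀ x, 0 ≤ ζ x) (hs : SuppIn r' ζ) (hG : ∀ i x, |pd i ζ x| ≤ G)
    (hf : ContDiff ℝ 1 f) (hF : ∀ i, ContDiff ℝ 1 (F i)) (hdiv : ∀ x, ∑ i, pd i (F i) x = f x) :
    ∫ x in ball3 r, ζ x ^ 3 * |f x| ^ 3 ≤
      ∑ i, (2 * (∫ x in ball3 r, |F i x| * (ζ x ^ 3 * |f x|) * |pd i f x|) +
        3 * G * ∫ x in ball3 r, |F i x| * (ζ x ^ 2 * |f x| ^ 2)) := by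
  have hff : ContDiff ℝ 1 fun x => |f x| * f x := contDiff_abs_mul_self.comp hf
  have hg : ContDiff ℝ 1 fun x => ζ x ^ 3 * (|f x| * f x) := by fun_prop
  have hgs : SuppIn r' fun x => ζ x ^ 3 * (|f x| * f x) := fun x hx => by simp [hs x hx]
  have hpd : ∀ i, Continuous (pd i f) := fun i => continuous_pd i hf
  have hpg : ∀ i, Continuous (pd i fun x => ζ x ^ 3 * (|f x| * f x)) := fun i => continuous_pd i hg
  have hpF : ∀ i, Continuous (pd i (F i)) := fun i => continuous_pd i (hF i)
  have hFc : ∀ i, Continuous (F i) := fun i => (hF i).continuous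
  have e1 : ∫ x in ball3 r, ζ x ^ 3 * |f x| ^ 3 =
      ∑ i, -∫ x, pd i (fun x => ζ x ^ 3 * (|f x| * f x)) x * F i x := by
    rw [setIntegral_eq_integral_of_suppIn (r := r') (fun x hx => by simp [hs x hx]) hr]
    have : ∀ x, ζ x ^ 3 * |f x| ^ 3 = ∑ i, ζ x ^ 3 * (|f x| * f x) * pd i (F i) x := by
      intro x
      rw [← Finset.mul_sum, hdiv]
      have : |f x| ^ 3 = |f x| * (f x * f x) := by rw [← abs_mul_abs_self (f x)]; ring
      rw [this]; ring
    simp only [this]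
    rw [integral_finsetSum _ fun i _ => integrable_of_suppIn (by fun_prop) (hgs.mul_right _)]
    exact Finset.sum_congr rfl fun i _ => integral_mul_pd i hg (hF i) hgs
  rw [e1]
  refine Finset.sum_le_sum fun i _ => ?_
  rw [← integral_neg, ← setIntegral_eq_integral_of_suppIn (r := r') (r' := r) (fun x hx => by
    simp [hgs.pd i x hx]) hr, ← integral_const_mul, ← integral_const_mul, ← integral_add]
  rotate_left
  · exact integrableOn_ball3 (by fun_prop) r
  · exact integrableOn_ball3 (by fun_prop) r
  apply integral_ball3_mono (by fun_prop) (by fun_prop)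
  intro x
  have e : pd i (fun x => ζ x ^ 3 * (|f x| * f x)) x =
      3 * ζ x ^ 2 * pd i ζ x * (|f x| * f x) + ζ x ^ 3 * (2 * |f x| * pd i f x) := by
    rw [pd_mul i (f := fun x => ζ x ^ 3) (by fun_prop) hff x,
      pd_comp contDiff_abs_mul_self hf, deriv_abs_mul_self,
      pd_comp (h := fun y => y ^ 3) (by fun_prop) hζ]
    simp
  rw [e]
  refine (neg_le_abs _).trans ?_
  rw [abs_mul]
  have : |3 * ζ x ^ 2 * pd i ζ x * (|f x| * f x) + ζ x ^ 3 * (2 * |f x| * pd i f x)| ≤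
      3 * ζ x ^ 2 * G * |f x| ^ 2 + ζ x ^ 3 * (2 * |f x| * |pd i f x|) := by
    refine (abs_add_le _ _).trans ?_
    simp only [abs_mul, abs_pow, abs_abs, abs_of_nonneg (h0 x), Nat.abs_ofNat, ← pow_two]
    gcongr
    exact hG i x
  refine (mul_le_mul_of_nonneg_right this (abs_nonneg (F i x))).trans (le_of_eq ?_)
  ring

lemma cube_mul_le_rpow_mul_rpow {σ z a : ℝ} (h3 : σ ≤ 1 / 3) (hz0 : 0 ≤ z)
    (hz1 : z ≤ 1) (ha : 0 ≤ a) :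
    z ^ 3 * a ≤ (z ^ 3 * a ^ 3) ^ (2 / 3 - 2 * σ) * ((z ^ 2 * a) ^ 6) ^ (σ - 1 / 6) := by
  rcases hz0.eq_or_lt with rfl | hz0
  · rw [zero_pow (by norm_num), zero_mul]; positivity
  rcases ha.eq_or_lt with rfl | ha
  · rw [mul_zero]; positivity
  obtain ⟨t, rfl⟩ : ∃ t, z = Real.exp t := ⟨Real.log z, (Real.exp_log hz0).symm⟩
  obtain ⟨α, rfl⟩ : ∃ t, a = Real.exp t := ⟨Real.log a, (Real.exp_log ha).symm⟩
  have ht : t ≤ 0 := by rwa [← Real.exp_le_one_iff]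
  simp only [← Real.exp_nat_mul, ← Real.exp_add, ← Real.exp_mul]
  rw [Real.exp_le_exp]
  push_cast
  have : 0 ≤ (1 / 3 - σ) * -t := by apply mul_nonneg <;> linarith
  nlinarith

set_option maxHeartbeats 2000000 in
/-- The `L³` and `L⁶` bounds of a divergence whose potential has controlled mean oscillation. -/
lemma exists_cubic_bound {s : ℝ} (hs3 : 3 < s) (hs6 : s ≤ 6) {N : ℝ} (hN : 0 < N) :
    ∃ C : ℝ, 0 < C ∧ ∀ (R ρ τ D : ℝ) (f : E3 → ℝ) (F : Fin 3 → E3 → ℝ), 1 ≤ R → 0 < τ → τ ≤ R →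
    0 < ρ → ρ + τ ≤ 2 * R → 1 ≤ D → ContDiff ℝ 1 f → (∀ i, ContDiff ℝ 1 (F i)) →
    (∀ x, ∑ i, pd i (F i) x = f x) → (∀ i, ∫ x in ball3 (2 * R), |F i x| ^ s ≤ N * R ^ (2 + s / 3)) →
    (∫ x in ball3 (ρ + τ), ∑ i, pd i f x ^ 2) ≤ D →
    (∫ x in ball3 (ρ + τ / 2), |f x| ^ 3) ≤ C * ((R / τ) ^ 3 * R * D ^ (9 / (s + 6))) ∧
    (∫ x in ball3 (ρ + τ / 2), |f x| ^ 6) ≤ C * ((R / τ) ^ 12 * D ^ 3) := by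
  obtain ⟨C₁, hC₁, hcut⟩ := exists_cutoff
  obtain ⟨C₂, hC₂, hsob⟩ := exists_localized_sobolev
  obtain ⟨c₀, hc₀, hvol⟩ := exists_volume_ball3_le
  set σ := 1 / s with hσ
  have hs0 : 0 < s := by linarith
  have h6 : 1 / 6 ≤ σ := by rw [hσ]; exact one_div_le_one_div_of_le hs0 hs6
  have h3 : σ ≤ 1 / 3 := by rw [hσ]; exact one_div_le_one_div_of_le (by norm_num) hs3.le
  have hγ : 9 / (s + 6) * (1 + 6 * σ) = 9 * σ := by
    rw [hσ]; field_simp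
  have hsσ : s * σ = 1 := by rw [hσ]; field_simp
  -- constants
  set A := 24 * (16 * C₁ ^ 2) * c₀ ^ ((1 : ℝ) / 3) + 2 with hA
  have hA0 : 0 < A := by positivity
  set C₃ := C₂ * (2 * A) ^ 3 with hC₃
  have hC₃0 : 0 < C₃ := by positivity
  set c := 1 + 6 * (N ^ σ * C₃ ^ (σ - 1 / 6)) + 36 * C₁ * (N ^ σ * c₀ ^ (1 / 3 - σ)) with hc
  have hc1 : 1 ≤ c := by
    have h1 : 0 ≤ 6 * (N ^ σ * C₃ ^ (σ - 1 / 6)) := by positivity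
    have h2 : 0 ≤ 36 * C₁ * (N ^ σ * c₀ ^ (1 / 3 - σ)) := by positivity
    linarith
  refine ⟨(2 * c) ^ 3 + C₃ * (1 + (2 * c) ^ 6), by positivity, ?_⟩
  intro R ρ τ D f F hR hτ hτR hρ hρR hD hf hF hdiv hFs hfD
  obtain ⟨ζ, hζ, h0, h1, hζ1, hζs, hζd, -⟩ := hcut (ρ + τ / 2) (τ / 4) (by positivity) (by positivity)
  have hR0 : 0 < R := by linarith
  have hD0 : 0 < D := by linarith
  have hζC := hζ.smooth_one
  have hr' : ρ + τ / 2 + τ / 4 < ρ + τ := by linarith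
  set κ := R / τ with hκ
  have hκ1 : 1 ≤ κ := by rw [hκ, le_div_iff₀ hτ]; linarith
  have hG : ∀ i x, |pd i ζ x| ≤ 4 * C₁ * (κ * R⁻¹) := by
    intro i x
    refine (hζd i x).trans (le_of_eq ?_)
    rw [hκ]; field_simp
  have hpd : ∀ i, Continuous (pd i f) := fun i => continuous_pd i hf
  have hFc : ∀ i, Continuous (F i) := fun i => (hF i).continuous
  set X := ∫ x in ball3 (ρ + τ), ζ x ^ 3 * |f x| ^ 3 with hX
  set S := ∫ x in ball3 (ρ + τ), (ζ x ^ 2 * |f x|) ^ 6 with hS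
  have hX0 : 0 ≤ X := integral_nonneg fun x => by have := h0 x; positivity
  have hS0 : 0 ≤ S := integral_nonneg fun x => by have := h0 x; positivity
  have hV : volume.real (ball3 (ρ + τ)) ≤ c₀ * R ^ 3 :=
    (measureReal_mono (ball_subset_ball hρR) measure_ball_lt_top.ne).trans (hvol R hR0.le)
  set M := max D (κ ^ 2 * R⁻¹ * X ^ ((2 : ℝ) / 3)) with hM
  have hM0 : 0 < M := hD0.trans_le (le_max_left _ _)
  have hSM : S ≤ C₃ * M ^ 3 := by
    have e : S = ∫ x in ball3 (ρ + τ), (ζ x ^ 2 * f x) ^ 6 := by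
      rw [hS]; congr 1; ext x; rw [mul_pow, mul_pow, Even.pow_abs (by decide)]
    rw [e]
    refine (hsob _ _ _ ζ f hr' hζC h0 h1 hζs hG hf).trans ?_
    have hA2 : 24 * (4 * C₁ * (κ * R⁻¹)) ^ 2 * (∫ x in ball3 (ρ + τ), (ζ x * |f x|) ^ 2) +
        2 * ∫ x in ball3 (ρ + τ), ∑ i, pd i f x ^ 2 ≤ 2 * A * M := by
      have i1 := integral_sq_le_cube (f := fun x => ζ x * |f x|) (by fun_prop)
        (fun x => by have := h0 x; positivity) (ρ + τ)
      simp only [mul_pow] at i1 ⊢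
      have i2 : volume.real (ball3 (ρ + τ)) ^ ((1 : ℝ) / 3) ≤ c₀ ^ ((1 : ℝ) / 3) * R := by
        calc _ ≤ (c₀ * R ^ 3) ^ ((1 : ℝ) / 3) :=
              Real.rpow_le_rpow measureReal_nonneg hV (by norm_num)
          _ = _ := by
            rw [Real.mul_rpow (by positivity) (by positivity), ← Real.rpow_natCast R 3,
              ← Real.rpow_mul hR0.le]
            norm_num
      have i3 := i1.trans (mul_le_mul_of_nonneg_left i2 (by positivity))
      have i4 := mul_le_mul_of_nonneg_left i3
        (by positivity : (0 : ℝ) ≤ 24 * (16 * C₁ ^ 2 * (κ ^ 2 * R⁻¹ ^ 2)))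
      have i5 : 24 * (16 * C₁ ^ 2 * (κ ^ 2 * R⁻¹ ^ 2)) * (X ^ ((2 : ℝ) / 3) * (c₀ ^ ((1 : ℝ) / 3) * R)) =
          24 * (16 * C₁ ^ 2) * c₀ ^ ((1 : ℝ) / 3) * (κ ^ 2 * R⁻¹ * X ^ ((2 : ℝ) / 3)) := by
        field_simp
      have i6 : κ ^ 2 * R⁻¹ * X ^ ((2 : ℝ) / 3) ≤ M := le_max_right _ _
      have i7 : D ≤ M := le_max_left _ _
      have i8 := mul_le_mul_of_nonneg_left i6
        (by positivity : 0 ≤ 24 * (16 * C₁ ^ 2) * c₀ ^ ((1 : ℝ) / 3))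
      rw [hA]
      have i9 : 0 ≤ 24 * (16 * C₁ ^ 2) * c₀ ^ ((1 : ℝ) / 3) * M := by positivity
      have i10 : 24 * (4 * C₁ * (κ * R⁻¹)) ^ 2 * (∫ x in ball3 (ρ + τ), ζ x ^ 2 * |f x| ^ 2) =
          24 * (16 * C₁ ^ 2 * (κ ^ 2 * R⁻¹ ^ 2)) * ∫ x in ball3 (ρ + τ), ζ x ^ 2 * |f x| ^ 2 := by
        ring
      have i11 := i4.trans (i5.le.trans i8)
      simp only [mul_pow] at i10 i11
      linarith
    calc _ ≤ C₂ * (2 * A * M) ^ 3 := by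
          refine mul_le_mul_of_nonneg_left (pow_le_pow_left₀ ?_ hA2 3) hC₂.le
          have : 0 ≤ ∫ x in ball3 (ρ + τ), (ζ x * |f x|) ^ 2 := integral_nonneg fun x => sq_nonneg _
          have : 0 ≤ ∫ x in ball3 (ρ + τ), ∑ i, pd i f x ^ 2 :=
            integral_nonneg fun x => Finset.sum_nonneg fun i _ => sq_nonneg _
          positivity
      _ = _ := by rw [hC₃]; ring
  have hFσ : ∀ i, (∫ x in ball3 (ρ + τ), |F i x| ^ s) ^ σ ≤ N ^ σ * R ^ (1 / 3 + 2 * σ) := by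
    intro i
    have : ∫ x in ball3 (ρ + τ), |F i x| ^ s ≤ N * R ^ (2 + s / 3) :=
      (integral_ball3_mono_radius ((hFc i).abs.rpow_const fun _ => Or.inr hs0.le)
        (fun x => by positivity) hρR).trans (hFs i)
    calc _ ≤ (N * R ^ (2 + s / 3)) ^ σ := Real.rpow_le_rpow
          (integral_nonneg fun x => by positivity) this (by linarith)
      _ = _ := by
        rw [Real.mul_rpow hN.le (by positivity), ← Real.rpow_mul hR0.le]
        congr 2; linear_combination (1 / 3) * hsσ
  have hFp : ∀ i x, (|F i x| ^ s) ^ σ = |F i x| := by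
    intro i x
    rw [← Real.rpow_mul (abs_nonneg _), hsσ, Real.rpow_one]
  have hSσ : S ^ (σ - 1 / 6) ≤ C₃ ^ (σ - 1 / 6) * M ^ (3 * σ - 1 / 2) := by
    calc _ ≤ (C₃ * M ^ 3) ^ (σ - 1 / 6) := Real.rpow_le_rpow hS0 hSM (by linarith)
      _ = _ := by
        rw [Real.mul_rpow hC₃0.le (by positivity), ← Real.rpow_natCast M 3, ← Real.rpow_mul hM0.le]
        congr 2; push_cast; ring
  have hT1 : ∀ i, ∫ x in ball3 (ρ + τ), |F i x| * (ζ x ^ 3 * |f x|) * |pd i f x| ≤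
      N ^ σ * C₃ ^ (σ - 1 / 6) * (R ^ (1 / 3 + 2 * σ) * X ^ (2 / 3 - 2 * σ) * M ^ (3 * σ - 1 / 2) *
        D ^ ((1 : ℝ) / 2)) := by
    intro i
    have hh := holder_four (ρ + τ) (a := fun x => |F i x| ^ s) (b := fun x => ζ x ^ 3 * |f x| ^ 3)
      (c := fun x => (ζ x ^ 2 * |f x|) ^ 6) (d := fun x => ∑ i, pd i f x ^ 2)
      ((hFc i).abs.rpow_const fun _ => Or.inr hs0.le) (by fun_prop) (by fun_prop) (by fun_prop)
      (fun x => by positivity) (fun x => by have := h0 x; positivity)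
      (fun x => by have := h0 x; positivity) (fun x => by positivity)
      (p := σ) (q := 2 / 3 - 2 * σ) (t := σ - 1 / 6) (v := 1 / 2) (by linarith) (by linarith)
      (by linarith) (by norm_num) (by ring)
    have hcont : Continuous fun x => (|F i x| ^ s) ^ σ * (ζ x ^ 3 * |f x| ^ 3) ^ (2 / 3 - 2 * σ) *
        ((ζ x ^ 2 * |f x|) ^ 6) ^ (σ - 1 / 6) * (∑ i, pd i f x ^ 2) ^ ((1 : ℝ) / 2) := by
      refine (((((hFc i).abs.rpow_const fun _ => Or.inr hs0.le).rpow_const fun _ => Or.inr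
        (by linarith)).mul (Continuous.rpow_const (by fun_prop) fun _ => Or.inr (by linarith))).mul
        (Continuous.rpow_const (by fun_prop) fun _ => Or.inr (by linarith))).mul
        (Continuous.rpow_const (by fun_prop) fun _ => Or.inr (by norm_num))
    refine (integral_ball3_mono (by fun_prop) hcont fun x => ?_).trans (hh.trans ?_)
    · rw [hFp, mul_assoc |F i x|, mul_assoc |F i x|, mul_assoc |F i x|]
      refine mul_le_mul_of_nonneg_left (mul_le_mul
        (cube_mul_le_rpow_mul_rpow h3 (h0 x) (h1 x) (abs_nonneg _)) ?_ (abs_nonneg _) ?_)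
        (abs_nonneg _)
      · rw [← Real.sqrt_eq_rpow]
        refine Real.abs_le_sqrt ?_
        exact Finset.single_le_sum (f := fun i => pd i f x ^ 2) (fun i _ => sq_nonneg _)
          (Finset.mem_univ i)
      · have := h0 x; positivity
    · have d1 : (∫ x in ball3 (ρ + τ), ∑ i, pd i f x ^ 2) ^ ((1 : ℝ) / 2) ≤ D ^ ((1 : ℝ) / 2) :=
        Real.rpow_le_rpow (integral_nonneg fun x => by positivity) hfD (by norm_num)
      calc _ ≤ (N ^ σ * R ^ (1 / 3 + 2 * σ)) * X ^ (2 / 3 - 2 * σ) *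
            (C₃ ^ (σ - 1 / 6) * M ^ (3 * σ - 1 / 2)) * D ^ ((1 : ℝ) / 2) := by
            gcongr
            · exact hFσ i
        _ = _ := by ring
  have hT2 : ∀ i, ∫ x in ball3 (ρ + τ), |F i x| * (ζ x ^ 2 * |f x| ^ 2) ≤
      N ^ σ * c₀ ^ (1 / 3 - σ) * (R ^ (4 / 3 - σ) * X ^ ((2 : ℝ) / 3)) := by
    intro i
    have hh := holder_three (ρ + τ) (a := fun x => |F i x| ^ s) (b := fun x => ζ x ^ 3 * |f x| ^ 3)
      (c := fun _ => 1)
      ((hFc i).abs.rpow_const fun _ => Or.inr hs0.le) (by fun_prop) (by fun_prop)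
      (fun x => by positivity) (fun x => by have := h0 x; positivity) (fun x => zero_le_one)
      (p := σ) (q := 2 / 3) (t := 1 / 3 - σ) (by linarith) (by norm_num) (by linarith) (by ring)
    have e : ∀ x, (ζ x ^ 3 * |f x| ^ 3) ^ ((2 : ℝ) / 3) = ζ x ^ 2 * |f x| ^ 2 := by
      intro x
      rw [← mul_pow, pow_three_rpow_two_thirds (mul_nonneg (h0 x) (abs_nonneg _)), mul_pow]
    simp only [hFp, e, Real.one_rpow, mul_one] at hh
    refine hh.trans ?_
    have v1 : (∫ _ in ball3 (ρ + τ), (1 : ℝ)) ^ (1 / 3 - σ) ≤ (c₀ * R ^ 3) ^ (1 / 3 - σ) := by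
      refine Real.rpow_le_rpow (integral_nonneg fun x => zero_le_one) ?_ (by linarith)
      simpa using hV
    have v2 : (c₀ * R ^ 3) ^ (1 / 3 - σ) = c₀ ^ (1 / 3 - σ) * R ^ (1 - 3 * σ) := by
      rw [Real.mul_rpow (by linarith) (by positivity), ← Real.rpow_natCast R 3,
        ← Real.rpow_mul hR0.le]
      congr 2; push_cast; ring
    rw [v2] at v1
    calc _ ≤ (N ^ σ * R ^ (1 / 3 + 2 * σ)) * X ^ ((2 : ℝ) / 3) *
          (c₀ ^ (1 / 3 - σ) * R ^ (1 - 3 * σ)) := by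
          gcongr
          exact hFσ i
      _ = N ^ σ * c₀ ^ (1 / 3 - σ) * (R ^ (1 / 3 + 2 * σ) * R ^ (1 - 3 * σ) * X ^ ((2 : ℝ) / 3)) := by
          ring
      _ = _ := by
          rw [← Real.rpow_add hR0]; congr 3; ring_nf
  have hmain : X ≤ c * (R ^ (1 / 3 + 2 * σ) * X ^ (2 / 3 - 2 * σ) * M ^ (3 * σ - 1 / 2) *
      D ^ ((1 : ℝ) / 2) + κ * R ^ (1 / 3 - σ) * X ^ ((2 : ℝ) / 3)) := by
    have hi := integral_cube_le_of_divergence hr' hζC h0 hζs hG hf hF hdiv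
    set T := R ^ (1 / 3 + 2 * σ) * X ^ (2 / 3 - 2 * σ) * M ^ (3 * σ - 1 / 2) * D ^ ((1 : ℝ) / 2)
    set T' := κ * R ^ (1 / 3 - σ) * X ^ ((2 : ℝ) / 3)
    have hT0 : 0 ≤ T := by positivity
    have hT'0 : 0 ≤ T' := by positivity
    have hRe : R⁻¹ * R ^ (4 / 3 - σ) = R ^ (1 / 3 - σ) := by
      rw [← Real.rpow_neg_one, ← Real.rpow_add hR0]; congr 1; ring
    calc X ≤ ∑ i : Fin 3, (2 * (N ^ σ * C₃ ^ (σ - 1 / 6) * T) + 3 * (4 * C₁ * (κ * R⁻¹)) *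
          (N ^ σ * c₀ ^ (1 / 3 - σ) * (R ^ (4 / 3 - σ) * X ^ ((2 : ℝ) / 3)))) := by
          refine hi.trans (Finset.sum_le_sum fun i _ => ?_)
          have := hT1 i
          have := hT2 i
          gcongr
      _ = 6 * (N ^ σ * C₃ ^ (σ - 1 / 6)) * T + 36 * C₁ * (N ^ σ * c₀ ^ (1 / 3 - σ)) * T' := by
          simp only [Finset.sum_const, Finset.card_univ, Fintype.card_fin, nsmul_eq_mul]
          rw [show T' = κ * (R⁻¹ * R ^ (4 / 3 - σ)) * X ^ ((2 : ℝ) / 3) by rw [hRe]]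
          push_cast; ring
      _ ≤ c * T + c * T' := by
          have p1 : 0 ≤ 6 * (N ^ σ * C₃ ^ (σ - 1 / 6)) := by positivity
          have p2 : 0 ≤ 36 * C₁ * (N ^ σ * c₀ ^ (1 / 3 - σ)) := by positivity
          gcongr <;> linarith
      _ = _ := by ring
  have hXb := cubic_absorption h6 h3 hγ hc1 hR hκ1 hD (max_choice _ _) hmain
  have hin : ∀ x ∈ ball3 (ρ + τ / 2), ζ x = 1 := fun x hx => hζ1 x (by
    simp only [ball3, mem_ball, dist_zero_right] at hx; exact hx.le)
  have hp1 : 0 ≤ κ ^ 3 * R * D ^ (9 / (s + 6)) := by positivity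
  have hκ0 : 0 < κ := by linarith
  constructor
  · calc _ = ∫ x in ball3 (ρ + τ / 2), ζ x ^ 3 * |f x| ^ 3 :=
          setIntegral_congr_fun (measurableSet_ball3 _) fun x hx => by simp [hin x hx]
      _ ≤ X := integral_ball3_mono_radius (by fun_prop) (fun x => by have := h0 x; positivity)
          (by linarith)
      _ ≤ (2 * c) ^ 3 * (κ ^ 3 * R * D ^ (9 / (s + 6))) := hXb
      _ ≤ _ := by
          refine mul_le_mul_of_nonneg_right ?_ hp1
          have : 0 ≤ C₃ * (1 + (2 * c) ^ 6) := by positivity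
          linarith
  · have hγ1 : 2 * (9 / (s + 6)) ≤ 3 := by
      rw [← mul_div_assoc, div_le_iff₀ (by linarith)]; linarith
    have hκ12 : 1 ≤ κ ^ 12 := one_le_pow₀ hκ1
    have hM3 : M ^ 3 ≤ (1 + (2 * c) ^ 6) * (κ ^ 12 * D ^ 3) := by
      have hD3 : 0 < D ^ 3 := by positivity
      have hc6 : 0 ≤ (2 * c) ^ 6 := by positivity
      rcases max_choice D (κ ^ 2 * R⁻¹ * X ^ ((2 : ℝ) / 3)) with h | h
      · rw [hM, h]
        have : 1 * D ^ 3 ≤ κ ^ 12 * D ^ 3 := mul_le_mul_of_nonneg_right hκ12 hD3.le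
        nlinarith
      · rw [hM, h]
        have e1 : (X ^ ((2 : ℝ) / 3)) ^ 3 = X ^ 2 := by
          rw [← Real.rpow_natCast, ← Real.rpow_mul hX0]; norm_num
        have e2 : X ^ 2 ≤ ((2 * c) ^ 3 * (κ ^ 3 * R * D ^ (9 / (s + 6)))) ^ 2 :=
          pow_le_pow_left₀ hX0 hXb 2
        have e3 : (D ^ (9 / (s + 6))) ^ 2 ≤ D ^ 3 := by
          rw [← Real.rpow_natCast, ← Real.rpow_natCast, ← Real.rpow_mul hD0.le]
          apply Real.rpow_le_rpow_of_exponent_le hD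
          push_cast; linarith
        have e4 : R⁻¹ ≤ 1 := inv_le_one_of_one_le₀ hR
        calc (κ ^ 2 * R⁻¹ * X ^ ((2 : ℝ) / 3)) ^ 3 = κ ^ 6 * R⁻¹ ^ 3 * X ^ 2 := by
              rw [mul_pow, e1]; ring
          _ ≤ κ ^ 6 * R⁻¹ ^ 3 * ((2 * c) ^ 3 * (κ ^ 3 * R * D ^ (9 / (s + 6)))) ^ 2 := by gcongr
          _ = (2 * c) ^ 6 * κ ^ 12 * R⁻¹ * (D ^ (9 / (s + 6))) ^ 2 := by field_simp
          _ ≤ (2 * c) ^ 6 * κ ^ 12 * 1 * D ^ 3 := by gcongr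
          _ ≤ _ := by
            have : 0 ≤ κ ^ 12 * D ^ 3 := by positivity
            nlinarith
    calc _ = ∫ x in ball3 (ρ + τ / 2), (ζ x ^ 2 * |f x|) ^ 6 :=
          setIntegral_congr_fun (measurableSet_ball3 _) fun x hx => by simp [hin x hx]
      _ ≤ S := integral_ball3_mono_radius (by fun_prop) (fun x => by have := h0 x; positivity)
          (by linarith)
      _ ≤ C₃ * M ^ 3 := hSM
      _ ≤ C₃ * ((1 + (2 * c) ^ 6) * (κ ^ 12 * D ^ 3)) := by gcongr
      _ ≤ _ := by
          have : 0 ≤ (2 * c) ^ 3 * (κ ^ 12 * D ^ 3) := by positivity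
          linarith

end CubicBound


section EnergyAlgebra

lemma abs_mul_three_le {a b c A B C : ℝ} (ha : |a| ≤ A) (hb : |b| ≤ B) (hc : |c| ≤ C) :
    |a * b * c| ≤ A * B * C := by
  rw [abs_mul, abs_mul]
  have := (abs_nonneg a).trans ha
  have := (abs_nonneg b).trans hb
  gcongr

lemma abs_sum_sum_le {f : Fin 3 → Fin 3 → ℝ} {K : ℝ} (h : ∀ i j, |f i j| ≤ K) :
    |∑ i, ∑ j, f i j| ≤ 9 * K := by
  refine (Finset.abs_sum_le_sum_abs _ _).trans ?_
  refine (Finset.sum_le_sum fun i _ => (Finset.abs_sum_le_sum_abs _ _).trans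
    (Finset.sum_le_sum fun j _ => h i j)).trans (le_of_eq ?_)
  simp
  ring

/-- The curl of a vector field in terms of its matrix of partial derivatives `d i j = ∂ᵢ vⱼ`. -/
def curlMat (d : Fin 3 → Fin 3 → ℝ) : Fin 3 → ℝ :=
  ![d 1 2 - d 2 1, d 2 0 - d 0 2, d 0 1 - d 1 0]

/-- The cross product. -/
def cross (a b : Fin 3 → ℝ) : Fin 3 → ℝ :=
  ![a 1 * b 2 - a 2 * b 1, a 2 * b 0 - a 0 * b 2, a 0 * b 1 - a 1 * b 0]

/-- The local energy balance, written in terms of the values of the fields and their first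
derivatives. -/
def energyBalance (η : ℝ) (e u b w ξ : Fin 3 → ℝ) (du db dw dξ : Fin 3 → Fin 3 → ℝ) : ℝ :=
  (∑ j, ∑ i, (e i * u j + η * du i j - dξ i j) * du i j)
    + (∑ j, (η * u j - ξ j) * (∑ i, u i * du i j - curlMat dw j - ∑ i, b i * db i j))
    + (∑ j, ∑ i, (e i * b j + η * db i j) * db i j)
    + (∑ j, η * b j * (∑ i, u i * db i j - ∑ i, b i * du i j))
    + (∑ j, ∑ i, (e i * w j + η * dw i j) * dw i j)
    + (∑ j, η * w j * (∑ i, u i * dw i j - curlMat du j + 2 * w j))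
    + (∑ j, (e j * w j + η * dw j j)) * ∑ k, dw k k
    - (∑ i, (e i * u i * (∑ j, (u j ^ 2 + b j ^ 2 + w j ^ 2) / 2)
        + η * u i * ∑ j, (u j * du i j + b j * db i j + w j * dw i j)))
    + (∑ i, (e i * b i * (∑ j, u j * b j) + η * b i * ∑ j, (du i j * b j + u j * db i j)))
    + (∑ i, (e i * cross w u i + η * (u i * curlMat dw i - w i * curlMat du i)
        + (w i * curlMat dξ i - ξ i * curlMat dw i)))
    - 3 / 4 * ∑ i, ∑ j, (e i * u j * du j i + η * du i j * du j i)

set_option maxHeartbeats 1000000 in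
lemma le_energyBalance {η G m g X Y : ℝ} {e u b w ξ : Fin 3 → ℝ} {du db dw dξ : Fin 3 → Fin 3 → ℝ}
    (hη : 0 ≤ η) (he : ∀ i, |e i| ≤ G) (hum : ∀ j, |u j| ≤ m) (hbm : ∀ j, |b j| ≤ m)
    (hwm : ∀ j, |w j| ≤ m) (hwg : ∀ j, |w j| ≤ g) (hdu : ∀ i j, |du i j| ≤ g)
    (hdb : ∀ i j, |db i j| ≤ g) (hdw : ∀ i j, |dw i j| ≤ g) (hξ : ∀ j, |ξ j| ≤ X)
    (hdξ : ∀ i j, |dξ i j| ≤ Y) :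
    1 / 4 * (η * (∑ j, ∑ i, du i j ^ 2 + ∑ j, ∑ i, db i j ^ 2 + ∑ j, ∑ i, dw i j ^ 2 +
      ∑ j, w j ^ 2)) ≤ energyBalance η e u b w ξ du db dw dξ +
        100 * (G * m * g + G * m ^ 3 + X * m * g + Y * g) := by
  have hid : energyBalance η e u b w ξ du db dw dξ =
      η * (1 / 4 * ∑ j, ∑ i, du i j ^ 2 + ∑ j, ∑ i, db i j ^ 2 + ∑ j, ∑ i, dw i j ^ 2
        + (∑ i, dw i i) ^ 2 + 2 / 3 * ∑ j, w j ^ 2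
        + 3 / 4 * ∑ j, (curlMat du j - 4 / 3 * w j) ^ 2)
      + (∑ j, ∑ i, e i * u j * du i j) - (∑ j, ∑ i, 1 * dξ i j * du i j)
      - (∑ j, ∑ i, ξ j * u i * du i j) + (∑ j, ∑ i, ξ j * b i * db i j)
      + (∑ j, ∑ i, e i * b j * db i j) + (∑ j, ∑ i, e i * w j * dw i j)
      + (∑ j, ∑ i, e j * w j * dw i i)
      - 1 / 2 * (∑ i, ∑ j, e i * u i * (u j * u j)) - 1 / 2 * (∑ i, ∑ j, e i * u i * (b j * b j))
      - 1 / 2 * (∑ i, ∑ j, e i * u i * (w j * w j)) + (∑ i, ∑ j, e i * b i * (u j * b j))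
      + (∑ i, e i * cross w u i) + (∑ i, w i * curlMat dξ i)
      - 3 / 4 * (∑ i, ∑ j, e i * u j * du j i) := by
    simp only [energyBalance, Fin.sum_univ_three, curlMat, cross, Matrix.cons_val_zero,
      Matrix.cons_val_one, Matrix.cons_val]
    ring
  have hmul : ∀ {a b A B : ℝ}, |a| ≤ A → |b| ≤ B → |a * b| ≤ A * B := fun {a b A B} ha hb => by
    rw [abs_mul]; exact mul_le_mul ha hb (abs_nonneg _) ((abs_nonneg _).trans ha)
  have t1 := neg_le_of_abs_le (abs_sum_sum_le fun j i => abs_mul_three_le (he i) (hum j) (hdu i j))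
  have t2 := le_of_abs_le (abs_sum_sum_le fun j i =>
    abs_mul_three_le (abs_one (α := ℝ)).le (hdξ i j) (hdu i j))
  have t3 := le_of_abs_le (abs_sum_sum_le fun j i => abs_mul_three_le (hξ j) (hum i) (hdu i j))
  have t4 := neg_le_of_abs_le (abs_sum_sum_le fun j i => abs_mul_three_le (hξ j) (hbm i) (hdb i j))
  have t5 := neg_le_of_abs_le (abs_sum_sum_le fun j i => abs_mul_three_le (he i) (hbm j) (hdb i j))
  have t6 := neg_le_of_abs_le (abs_sum_sum_le fun j i => abs_mul_three_le (he i) (hwm j) (hdw i j))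
  have t7 := neg_le_of_abs_le (abs_sum_sum_le fun j i => abs_mul_three_le (he j) (hwm j) (hdw i i))
  have t8 := le_of_abs_le (abs_sum_sum_le fun i j =>
    abs_mul_three_le (he i) (hum i) (hmul (hum j) (hum j)))
  have t9 := le_of_abs_le (abs_sum_sum_le fun i j =>
    abs_mul_three_le (he i) (hum i) (hmul (hbm j) (hbm j)))
  have t10 := le_of_abs_le (abs_sum_sum_le fun i j =>
    abs_mul_three_le (he i) (hum i) (hmul (hwm j) (hwm j)))
  have t11 := neg_le_of_abs_le (abs_sum_sum_le fun i j =>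
    abs_mul_three_le (he i) (hbm i) (hmul (hum j) (hbm j)))
  have t12 := le_of_abs_le (abs_sum_sum_le fun i j => abs_mul_three_le (he i) (hum j) (hdu j i))
  have c1 : -(6 * (G * m * g)) ≤ ∑ i, e i * cross w u i := by
    have k : ∀ i j k, |e i * u k * w j| ≤ G * m * g := fun i j k =>
      abs_mul_three_le (he i) (hum k) (hwg j)
    have k' : ∀ i j k, -(G * m * g) ≤ e i * u k * w j ∧ e i * u k * w j ≤ G * m * g :=
      fun i j l => abs_le.1 (k i j l)
    simp only [cross, Fin.sum_univ_three, Matrix.cons_val_zero, Matrix.cons_val_one, Matrix.cons_val]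
    linarith [(k' 0 1 2).1, (k' 0 2 1).2, (k' 1 2 0).1, (k' 1 0 2).2, (k' 2 0 1).1, (k' 2 1 0).2]
  have c2 : -(6 * (Y * g)) ≤ ∑ i, w i * curlMat dξ i := by
    have k' : ∀ i j k, -(Y * g) ≤ dξ i j * w k ∧ dξ i j * w k ≤ Y * g :=
      fun i j k => abs_le.1 (hmul (hdξ i j) (hwg k))
    simp only [curlMat, Fin.sum_univ_three, Matrix.cons_val_zero, Matrix.cons_val_one,
      Matrix.cons_val]
    linarith [(k' 1 2 0).1, (k' 2 1 0).2, (k' 2 0 1).1, (k' 0 2 1).2, (k' 0 1 2).1, (k' 1 0 2).2]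
  have hG : 0 ≤ G := (abs_nonneg _).trans (he 0)
  have hm : 0 ≤ m := (abs_nonneg _).trans (hum 0)
  have hg : 0 ≤ g := (abs_nonneg _).trans (hwg 0)
  have hX : 0 ≤ X := (abs_nonneg _).trans (hξ 0)
  have hY : 0 ≤ Y := (abs_nonneg _).trans (hdξ 0 0)
  have q1 : 0 ≤ G * m * g := by positivity
  have q2 : 0 ≤ G * m ^ 3 := by positivity
  have q3 : 0 ≤ X * m * g := by positivity
  have q4 : 0 ≤ Y * g := by positivity
  have q5 : G * m * (m * m) = G * m ^ 3 := by ring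
  have p1 : 0 ≤ η * ∑ j, ∑ i, db i j ^ 2 := by positivity
  have p2 : 0 ≤ η * ∑ j, ∑ i, dw i j ^ 2 := by positivity
  have p3 : 0 ≤ η * (∑ i, dw i i) ^ 2 := by positivity
  have p4 : 0 ≤ η * ∑ j, w j ^ 2 := by positivity
  have p5 : 0 ≤ η * ∑ j, (curlMat du j - 4 / 3 * w j) ^ 2 := by positivity
  rw [hid]
  rw [q5] at t8 t9 t10 t11
  simp only [mul_add] at *
  linarith

end EnergyAlgebra


section EnergyInequality

/-- The pointwise size of the fields. -/
def fieldSize (u w b : E3 → E3) (x : E3) : ℝ := ∑ j, (|u x j| + |b x j| + |w x j|)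

/-- The pointwise size of the first derivatives of the fields, together with that of `w`. -/
def derivSize (u w b : E3 → E3) (x : E3) : ℝ :=
  ∑ j, (∑ i, (|pd i (fun y => u y j) x| + |pd i (fun y => b y j) x| + |pd i (fun y => w y j) x|)
    + |w x j|)

/-- The energy density. -/
def energyDensity (u w b : E3 → E3) (x : E3) : ℝ :=
  gradSq u x + gradSq b x + gradSq w x + ∑ j, w x j ^ 2

lemma contDiff_component {n : WithTop ℕ∞} {v : E3 → E3} (hv : ContDiff ℝ n v) (j : Fin 3) :
    ContDiff ℝ n fun y => v y j := by fun_prop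

lemma integral_sum_pd_eq_zero {ι : Type*} (t : Finset ι) {r : ℝ} {A : ι → E3 → ℝ} (k : ι → Fin 3)
    (hA : ∀ i, ContDiff ℝ 1 (A i)) (hs : ∀ i, SuppIn r (A i)) :
    Integrable (fun x => ∑ i ∈ t, pd (k i) (A i) x) ∧ ∫ x, ∑ i ∈ t, pd (k i) (A i) x = 0 := by
  have hi : ∀ i, Integrable (pd (k i) (A i)) := fun i =>
    integrable_of_suppIn (continuous_pd _ (hA i)) ((hs i).pd _)
  refine ⟨integrable_finsetSum _ fun i _ => hi i, ?_⟩
  rw [integral_finsetSum _ fun i _ => hi i]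
  exact Finset.sum_eq_zero fun i _ => integral_pd_eq_zero _ (hA i) (hs i)

lemma pd_mul_three {f g h : E3 → ℝ} (i : Fin 3) (hf : ContDiff ℝ 1 f) (hg : ContDiff ℝ 1 g)
    (hh : ContDiff ℝ 1 h) (x : E3) :
    pd i (fun y => f y * g y * h y) x =
      pd i f x * g x * h x + f x * pd i g x * h x + f x * g x * pd i h x := by
  rw [pd_mul i (hf.mul hg) hh, pd_mul i hf hg]
  ring

/-- The matrix of partial derivatives `∂ᵢ vⱼ`. -/
def jac (v : E3 → E3) (x : E3) (i j : Fin 3) : ℝ := pd i (fun y => v y j) x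

lemma curl3_eq_curlMat (v : E3 → E3) (x : E3) : curl3 v x = curlMat (jac v x) := rfl

set_option maxHeartbeats 1000000 in
/-- The local energy balance of a solution, tested with a divergence-free field, integrates to
zero. -/
lemma integral_energyBalance {u w b : E3 → E3} {P : E3 → ℝ} (hsol : IsMMPSolution u w b P) {r : ℝ} {η : E3 → ℝ}
    (hη : ContDiff ℝ 1 η) (hηs : SuppIn r η) {ξ : Fin 3 → E3 → ℝ} (hξ : ∀ j, ContDiff ℝ 1 (ξ j))
    (hξs : ∀ j, SuppIn r (ξ j)) (hdiv : ∀ x, ∑ j, pd j (ξ j) x = ∑ j, u x j * pd j η x) :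
    Integrable (fun x => energyBalance (η x) (fun i => pd i η x) (u x) (b x) (w x)
      (fun j => ξ j x) (jac u x) (jac b x) (jac w x) (fun i j => pd i (ξ j) x)) ∧
    ∫ x, energyBalance (η x) (fun i => pd i η x) (u x) (b x) (w x)
      (fun j => ξ j x) (jac u x) (jac b x) (jac w x) (fun i j => pd i (ξ j) x) = 0 := by
  have su : ∀ j, ContDiff ℝ (⊤ : ℕ∞) fun y => u y j := contDiff_component hsol.smooth_u
  have sb : ∀ j, ContDiff ℝ (⊤ : ℕ∞) fun y => b y j := contDiff_component hsol.smooth_b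
  have sw : ∀ j, ContDiff ℝ (⊤ : ℕ∞) fun y => w y j := contDiff_component hsol.smooth_w
  have cu : ∀ j, ContDiff ℝ 1 fun y => u y j := fun j => (su j).smooth_one
  have cb : ∀ j, ContDiff ℝ 1 fun y => b y j := fun j => (sb j).smooth_one
  have cw : ∀ j, ContDiff ℝ 1 fun y => w y j := fun j => (sw j).smooth_one
  have cdu : ∀ i j, ContDiff ℝ 1 (pd i fun y => u y j) :=
    fun i j => (contDiff_smooth_pd i (su j)).smooth_one
  have cdb : ∀ i j, ContDiff ℝ 1 (pd i fun y => b y j) :=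
    fun i j => (contDiff_smooth_pd i (sb j)).smooth_one
  have cdw : ∀ i j, ContDiff ℝ 1 (pd i fun y => w y j) :=
    fun i j => (contDiff_smooth_pd i (sw j)).smooth_one
  have cP : ContDiff ℝ 1 P := hsol.smooth_P.smooth_one
  have cv : ∀ j, ContDiff ℝ 1 fun y => η y * u y j - ξ j y := fun j => by
    have := cu j; have := hξ j; fun_prop
  have vs : ∀ j, SuppIn r fun y => η y * u y j - ξ j y := fun j => (hηs.mul_right _).sub (hξs j)
  have cdiv : ContDiff ℝ 1 fun x => vdiv w x := by
    unfold vdiv; exact ContDiff.sum fun i _ => cdw i i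
  have cE : ContDiff ℝ 1 fun x => ∑ j, (u x j ^ 2 + b x j ^ 2 + w x j ^ 2) / 2 :=
    ContDiff.sum fun j _ => by have := cu j; have := cb j; have := cw j; fun_prop
  have cF : ContDiff ℝ 1 fun x => ∑ j, u x j * b x j :=
    ContDiff.sum fun j _ => (cu j).mul (cb j)
  have hv : ∀ i j x, pd i (fun y => η y * u y j - ξ j y) x =
      pd i η x * u x j + η x * jac u x i j - pd i (ξ j) x := fun i j x => by
    rw [pd_sub i (hη.mul (cu j)) (hξ j), pd_mul i hη (cu j)]; rfl
  have hE : ∀ i x, pd i (fun x => ∑ j, (u x j ^ 2 + b x j ^ 2 + w x j ^ 2) / 2) x =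
      ∑ j, (u x j * jac u x i j + b x j * jac b x i j + w x j * jac w x i j) := fun i x => by
    rw [pd_sum _ _ fun j _ => by have := cu j; have := cb j; have := cw j; fun_prop]
    refine Finset.sum_congr rfl fun j _ => ?_
    have e : (fun x => (u x j ^ 2 + b x j ^ 2 + w x j ^ 2) / 2) =
        fun x => (1 / 2) * (u x j * u x j + b x j * b x j + w x j * w x j) := by
      ext x; ring
    have c1 := (cu j).mul (cu j)
    have c2 := (cb j).mul (cb j)
    have c3 := (cw j).mul (cw j)
    rw [e, pd_const_mul i _ ((c1.add c2).add c3), pd_add i (c1.add c2) c3, pd_add i c1 c2,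
      pd_mul i (cu j) (cu j), pd_mul i (cb j) (cb j), pd_mul i (cw j) (cw j)]
    simp only [jac]; ring
  have hF : ∀ i x, pd i (fun x => ∑ j, u x j * b x j) x =
      ∑ j, (jac u x i j * b x j + u x j * jac b x i j) := fun i x => by
    rw [pd_sum _ _ fun j _ => (cu j).mul (cb j)]
    exact Finset.sum_congr rfl fun j _ => pd_mul i (cu j) (cb j) x
  have I1 := integral_sum_pd_eq_zero Finset.univ (r := r) (fun p : Fin 3 × Fin 3 => p.2)
    (A := fun p y => (η y * u y p.1 - ξ p.1 y) * pd p.2 (fun y => u y p.1) y)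
    (fun p => (cv p.1).mul (cdu _ _)) (fun p => (vs p.1).mul_right _)
  have I2 := integral_sum_pd_eq_zero Finset.univ (r := r) (fun j : Fin 3 => j)
    (A := fun j y => (η y * u y j - ξ j y) * P y)
    (fun j => (cv j).mul cP) (fun j => (vs j).mul_right _)
  have I3 := integral_sum_pd_eq_zero Finset.univ (r := r) (fun p : Fin 3 × Fin 3 => p.2)
    (A := fun p y => η y * b y p.1 * pd p.2 (fun y => b y p.1) y)
    (fun p => (hη.mul (cb _)).mul (cdb _ _)) (fun p => (hηs.mul_right _).mul_right _)
  have I4 := integral_sum_pd_eq_zero Finset.univ (r := r) (fun p : Fin 3 × Fin 3 => p.2)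
    (A := fun p y => η y * w y p.1 * pd p.2 (fun y => w y p.1) y)
    (fun p => (hη.mul (cw _)).mul (cdw _ _)) (fun p => (hηs.mul_right _).mul_right _)
  have I5 := integral_sum_pd_eq_zero Finset.univ (r := r) (fun j : Fin 3 => j)
    (A := fun j y => η y * w y j * vdiv w y)
    (fun p => (hη.mul (cw _)).mul cdiv) (fun p => (hηs.mul_right _).mul_right _)
  have I6 := integral_sum_pd_eq_zero Finset.univ (r := r) (fun j : Fin 3 => j)
    (A := fun i y => η y * u y i * ∑ j, (u y j ^ 2 + b y j ^ 2 + w y j ^ 2) / 2)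
    (fun p => (hη.mul (cu _)).mul cE) (fun p => (hηs.mul_right _).mul_right _)
  have I7 := integral_sum_pd_eq_zero Finset.univ (r := r) (fun j : Fin 3 => j)
    (A := fun i y => η y * b y i * ∑ j, u y j * b y j)
    (fun p => (hη.mul (cb _)).mul cF) (fun p => (hηs.mul_right _).mul_right _)
  have I8 := integral_sum_pd_eq_zero Finset.univ (r := r) (fun j : Fin 3 => j)
    (A := fun i y => η y * (w y (i + 1) * u y (i + 2) - w y (i + 2) * u y (i + 1)))
    (fun i => hη.mul (((cw _).mul (cu _)).sub ((cw _).mul (cu _)))) (fun p => hηs.mul_right _)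
  have I9 := integral_sum_pd_eq_zero Finset.univ (r := r) (fun j : Fin 3 => j)
    (A := fun i y => ξ (i + 1) y * w y (i + 2) - ξ (i + 2) y * w y (i + 1))
    (fun i => ((hξ _).mul (cw _)).sub ((hξ _).mul (cw _)))
    (fun p => ((hξs _).mul_right _).sub ((hξs _).mul_right _))
  have I10 := integral_sum_pd_eq_zero Finset.univ (r := r) (fun p : Fin 3 × Fin 3 => p.1)
    (A := fun p y => η y * u y p.2 * pd p.2 (fun y => u y p.1) y)
    (fun p => (hη.mul (cu _)).mul (cdu _ _)) (fun p => (hηs.mul_right _).mul_right _)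
  simp only [Fintype.sum_prod_type] at I1 I3 I4 I10
  have dux : ∀ x, ∑ i, jac u x i i = 0 := hsol.div_u
  have dbx : ∀ x, ∑ i, jac b x i i = 0 := hsol.div_b
  have E12 : ∀ x, (∑ j, ∑ i, pd i (fun y => (η y * u y j - ξ j y) * pd i (fun y => u y j) y) x)
      - ∑ j, pd j (fun y => (η y * u y j - ξ j y) * P y) x =
      (∑ j, ∑ i, (pd i η x * u x j + η x * jac u x i j - pd i (ξ j) x) * jac u x i j)
      + (∑ j, (η x * u x j - ξ j x) * (∑ i, u x i * jac u x i j - curlMat (jac w x) j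
        - ∑ i, b x i * jac b x i j)) := by
    intro x
    have e1 : ∀ j, ∑ i, pd i (fun y => (η y * u y j - ξ j y) * pd i (fun y => u y j) y) x =
        ∑ i, (pd i η x * u x j + η x * jac u x i j - pd i (ξ j) x) * jac u x i j +
        (η x * u x j - ξ j x) * lap (fun y => u y j) x := fun j => by
      rw [lap, Finset.mul_sum, ← Finset.sum_add_distrib]
      exact Finset.sum_congr rfl fun i _ => by rw [pd_mul i (cv j) (cdu i j), hv]; rfl
    have e2 : ∑ j, pd j (fun y => (η y * u y j - ξ j y) * P y) x =
        ∑ j, (η x * u x j - ξ j x) * pd j P x := by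
      have : ∀ j, pd j (fun y => (η y * u y j - ξ j y) * P y) x =
          (u x j * pd j η x + η x * jac u x j j - pd j (ξ j) x) * P x +
          (η x * u x j - ξ j x) * pd j P x := fun j => by
        rw [pd_mul j (cv j) cP, hv]; ring
      simp only [this]
      rw [Finset.sum_add_distrib, ← Finset.sum_mul, Finset.sum_sub_distrib, Finset.sum_add_distrib,
        ← Finset.mul_sum, dux, hdiv]
      ring
    simp only [e1]
    rw [e2, Finset.sum_add_distrib, add_sub_assoc, ← Finset.sum_sub_distrib]
    congr 1
    refine Finset.sum_congr rfl fun j _ => ?_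
    rw [← mul_sub]
    congr 1
    have := hsol.eq_u x j
    rw [curl3_eq_curlMat] at this
    simp only [jac] at this ⊢
    linarith
  have E3 : ∀ x, (∑ j, ∑ i, pd i (fun y => η y * b y j * pd i (fun y => b y j) y) x) =
      (∑ j, ∑ i, (pd i η x * b x j + η x * jac b x i j) * jac b x i j)
      + (∑ j, η x * b x j * (∑ i, u x i * jac b x i j - ∑ i, b x i * jac u x i j)) := by
    intro x
    rw [← Finset.sum_add_distrib]
    refine Finset.sum_congr rfl fun j _ => ?_
    have h := hsol.eq_b x j
    have h' : ∑ i, u x i * jac b x i j - ∑ i, b x i * jac u x i j = lap (fun y => b y j) x := by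
      simp only [jac]; linarith
    rw [h', lap, Finset.mul_sum, ← Finset.sum_add_distrib]
    refine Finset.sum_congr rfl fun i _ => ?_
    rw [pd_mul_three i hη (cb j) (cdb i j)]
    simp only [jac]; ring
  have E45 : ∀ x, (∑ j, ∑ i, pd i (fun y => η y * w y j * pd i (fun y => w y j) y) x)
      + ∑ j, pd j (fun y => η y * w y j * vdiv w y) x =
      (∑ j, ∑ i, (pd i η x * w x j + η x * jac w x i j) * jac w x i j)
      + (∑ j, η x * w x j * (∑ i, u x i * jac w x i j - curlMat (jac u x) j + 2 * w x j))
      + (∑ j, (pd j η x * w x j + η x * jac w x j j)) * ∑ k, jac w x k k := by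
    intro x
    have e0 : vdiv w x = ∑ k, jac w x k k := rfl
    rw [← e0, Finset.sum_mul, ← Finset.sum_add_distrib, ← Finset.sum_add_distrib,
      ← Finset.sum_add_distrib]
    refine Finset.sum_congr rfl fun j _ => ?_
    have h := hsol.eq_w x j
    rw [curl3_eq_curlMat] at h
    have h' : ∑ i, u x i * jac w x i j - curlMat (jac u x) j + 2 * w x j =
        lap (fun y => w y j) x + pd j (fun y => vdiv w y) x := by
      simp only [jac] at h ⊢; linarith
    have e1 : ∑ i, pd i (fun y => η y * w y j * pd i (fun y => w y j) y) x =
        ∑ i, (pd i η x * w x j + η x * jac w x i j) * jac w x i j +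
        η x * w x j * lap (fun y => w y j) x := by
      rw [lap, Finset.mul_sum, ← Finset.sum_add_distrib]
      refine Finset.sum_congr rfl fun i _ => ?_
      rw [pd_mul_three i hη (cw j) (cdw i j)]
      simp only [jac]; ring
    rw [h', e1, pd_mul_three j hη (cw j) cdiv]
    simp only [jac]; ring
  have E6 : ∀ x, ∑ i, pd i (fun y => η y * u y i * ∑ j, (u y j ^ 2 + b y j ^ 2 + w y j ^ 2) / 2) x =
      ∑ i, (pd i η x * u x i * (∑ j, (u x j ^ 2 + b x j ^ 2 + w x j ^ 2) / 2)
        + η x * u x i * ∑ j, (u x j * jac u x i j + b x j * jac b x i j + w x j * jac w x i j)) := by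
    intro x
    have : ∀ i, pd i (fun y => η y * u y i * ∑ j, (u y j ^ 2 + b y j ^ 2 + w y j ^ 2) / 2) x =
        (pd i η x * u x i * (∑ j, (u x j ^ 2 + b x j ^ 2 + w x j ^ 2) / 2)
        + η x * u x i * ∑ j, (u x j * jac u x i j + b x j * jac b x i j + w x j * jac w x i j))
        + jac u x i i * (η x * ∑ j, (u x j ^ 2 + b x j ^ 2 + w x j ^ 2) / 2) := fun i => by
      rw [pd_mul_three i hη (cu i) cE, hE]; simp only [jac]; ring
    simp only [this]
    rw [Finset.sum_add_distrib, ← Finset.sum_mul, dux]; ring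
  have E7 : ∀ x, ∑ i, pd i (fun y => η y * b y i * ∑ j, u y j * b y j) x =
      ∑ i, (pd i η x * b x i * (∑ j, u x j * b x j)
        + η x * b x i * ∑ j, (jac u x i j * b x j + u x j * jac b x i j)) := by
    intro x
    have : ∀ i, pd i (fun y => η y * b y i * ∑ j, u y j * b y j) x =
        (pd i η x * b x i * (∑ j, u x j * b x j)
        + η x * b x i * ∑ j, (jac u x i j * b x j + u x j * jac b x i j))
        + jac b x i i * (η x * ∑ j, u x j * b x j) := fun i => by
      rw [pd_mul_three i hη (cb i) cF, hF]; simp only [jac]; ring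
    simp only [this]
    rw [Finset.sum_add_distrib, ← Finset.sum_mul, dbx]; ring
  have E89 : ∀ x, (∑ i, pd i (fun y => η y * (w y (i + 1) * u y (i + 2) - w y (i + 2) * u y (i + 1))) x)
      + ∑ i, pd i (fun y => ξ (i + 1) y * w y (i + 2) - ξ (i + 2) y * w y (i + 1)) x =
      ∑ i, (pd i η x * cross (w x) (u x) i
        + η x * (u x i * curlMat (jac w x) i - w x i * curlMat (jac u x) i)
        + (w x i * curlMat (fun i j => pd i (ξ j) x) i - ξ i x * curlMat (jac w x) i)) := by
    intro x
    have e1 : ∀ i, pd i (fun y => η y * (w y (i + 1) * u y (i + 2) - w y (i + 2) * u y (i + 1))) x =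
        pd i η x * (w x (i + 1) * u x (i + 2) - w x (i + 2) * u x (i + 1)) +
        η x * (jac w x i (i + 1) * u x (i + 2) + w x (i + 1) * jac u x i (i + 2) -
          (jac w x i (i + 2) * u x (i + 1) + w x (i + 2) * jac u x i (i + 1))) := fun i => by
      rw [pd_mul i hη (((cw _).mul (cu _)).sub ((cw _).mul (cu _))),
        pd_sub i ((cw _).mul (cu _)) ((cw _).mul (cu _)), pd_mul i (cw _) (cu _),
        pd_mul i (cw _) (cu _)]
      rfl
    have e2 : ∀ i, pd i (fun y => ξ (i + 1) y * w y (i + 2) - ξ (i + 2) y * w y (i + 1)) x =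
        pd i (ξ (i + 1)) x * w x (i + 2) + ξ (i + 1) x * jac w x i (i + 2) -
          (pd i (ξ (i + 2)) x * w x (i + 1) + ξ (i + 2) x * jac w x i (i + 1)) := fun i => by
      rw [pd_sub i ((hξ _).mul (cw _)) ((hξ _).mul (cw _)), pd_mul i (hξ _) (cw _),
        pd_mul i (hξ _) (cw _)]
      rfl
    simp only [e1, e2, curlMat, cross, Fin.sum_univ_three, Matrix.cons_val_zero,
      Matrix.cons_val_one, Matrix.cons_val]
    have f1 : (1 : Fin 3) + 1 = 2 := rfl
    have f2 : (1 : Fin 3) + 2 = 0 := rfl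
    have f3 : (2 : Fin 3) + 1 = 0 := rfl
    have f4 : (2 : Fin 3) + 2 = 1 := rfl
    simp only [zero_add, f1, f2, f3, f4]
    ring
  have E10 : ∀ x, ∑ i, ∑ j, pd i (fun y => η y * u y j * pd j (fun y => u y i) y) x =
      ∑ i, ∑ j, (pd i η x * u x j * jac u x j i + η x * jac u x i j * jac u x j i) := by
    intro x
    have e : ∀ i j, pd i (fun y => η y * u y j * pd j (fun y => u y i) y) x =
        (pd i η x * u x j * jac u x j i + η x * jac u x i j * jac u x j i) +
        η x * u x j * pd j (pd i fun y => u y i) x := fun i j => by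
      rw [pd_mul_three i hη (cu j) (cdu j i), pd_comm j i ((su i).of_le (by norm_cast))]
      rfl
    have e' : ∀ j, ∑ i, pd j (pd i fun y => u y i) x = 0 := fun j => by
      rw [← pd_sum _ _ fun i _ => cdu i i]
      have : (fun y => ∑ i, pd i (fun y => u y i) y) = fun _ => 0 := funext dux
      rw [this]; simp [pd]
    simp only [e, Finset.sum_add_distrib]
    rw [Finset.sum_comm (f := fun i j => η x * u x j * pd j (pd i fun y => u y i) x)]
    simp only [← Finset.mul_sum, e', mul_zero, Finset.sum_const_zero, add_zero]
  have key : (fun x => energyBalance (η x) (fun i => pd i η x) (u x) (b x) (w x)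
      (fun j => ξ j x) (jac u x) (jac b x) (jac w x) (fun i j => pd i (ξ j) x)) = fun x =>
      (∑ j, ∑ i, pd i (fun y => (η y * u y j - ξ j y) * pd i (fun y => u y j) y) x)
      - (∑ j, pd j (fun y => (η y * u y j - ξ j y) * P y) x)
      + (∑ j, ∑ i, pd i (fun y => η y * b y j * pd i (fun y => b y j) y) x)
      + ((∑ j, ∑ i, pd i (fun y => η y * w y j * pd i (fun y => w y j) y) x)
      + ∑ j, pd j (fun y => η y * w y j * vdiv w y) x)
      - (∑ i, pd i (fun y => η y * u y i * ∑ j, (u y j ^ 2 + b y j ^ 2 + w y j ^ 2) / 2) x)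
      + (∑ i, pd i (fun y => η y * b y i * ∑ j, u y j * b y j) x)
      + ((∑ i, pd i (fun y => η y * (w y (i + 1) * u y (i + 2) - w y (i + 2) * u y (i + 1))) x)
      + ∑ i, pd i (fun y => ξ (i + 1) y * w y (i + 2) - ξ (i + 2) y * w y (i + 1)) x)
      - 3 / 4 * ∑ i, ∑ j, pd i (fun y => η y * u y j * pd j (fun y => u y i) y) x := by
    funext x
    rw [E12, E3, E45, E6, E7, E89, E10, energyBalance]
    ring
  rw [key]
  have J3 := (I1.1.sub I2.1).add I3.1
  have J45 := I4.1.add I5.1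
  have J6 := (J3.add J45).sub I6.1
  have J89 := I8.1.add I9.1
  refine ⟨(((J6.add I7.1).add J89).sub (I10.1.const_mul (3 / 4)) :), ?_⟩
  refine (integral_sub ((J6.add I7.1).add J89) (I10.1.const_mul (3 / 4))).trans ?_
  have k1 := integral_add (J6.add I7.1) J89
  have k2 := integral_add J6 I7.1
  have k3 := integral_sub (J3.add J45) I6.1
  have k4 := integral_add J3 J45
  have k5 := integral_add (I1.1.sub I2.1) I3.1
  have k6 := integral_sub I1.1 I2.1
  have k7 := integral_add I4.1 I5.1
  have k8 := integral_add I8.1 I9.1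
  have k9 := integral_const_mul (μ := volume) (3 / 4 : ℝ)
    (fun x => ∑ i, ∑ j, pd i (fun y => η y * u y j * pd j (fun y => u y i) y) x)
  simp only [Pi.add_apply, Pi.sub_apply] at k1 k2 k3 k4 k5 k6 k7 k8 k9 ⊢
  rw [k1, k2, k3, k4, k5, k6, k7, k8, k9, I1.2, I2.2, I3.2, I4.2, I5.2, I6.2, I7.2, I8.2, I9.2,
    I10.2]
  norm_num

end EnergyInequality

section EnergyEstimate

variable {u w b : E3 → E3}

lemma abs_u_le_fieldSize (x : E3) (j : Fin 3) : |u x j| ≤ fieldSize u w b x :=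
  le_trans (by linarith [abs_nonneg (b x j), abs_nonneg (w x j)])
    (Finset.single_le_sum (f := fun j => |u x j| + |b x j| + |w x j|) (fun i _ => by positivity)
      (Finset.mem_univ j))

lemma abs_b_le_fieldSize (x : E3) (j : Fin 3) : |b x j| ≤ fieldSize u w b x :=
  le_trans (by linarith [abs_nonneg (u x j), abs_nonneg (w x j)])
    (Finset.single_le_sum (f := fun j => |u x j| + |b x j| + |w x j|) (fun i _ => by positivity)
      (Finset.mem_univ j))

lemma abs_w_le_fieldSize (x : E3) (j : Fin 3) : |w x j| ≤ fieldSize u w b x :=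
  le_trans (by linarith [abs_nonneg (u x j), abs_nonneg (b x j)])
    (Finset.single_le_sum (f := fun j => |u x j| + |b x j| + |w x j|) (fun i _ => by positivity)
      (Finset.mem_univ j))

lemma fieldSize_nonneg (x : E3) : 0 ≤ fieldSize u w b x :=
  Finset.sum_nonneg fun i _ => by positivity

lemma derivSize_nonneg (x : E3) : 0 ≤ derivSize u w b x :=
  Finset.sum_nonneg fun i _ => by positivity

lemma energyDensity_nonneg (x : E3) : 0 ≤ energyDensity u w b x := by
  unfold energyDensity gradSq; positivity

lemma abs_w_le_derivSize (x : E3) (j : Fin 3) : |w x j| ≤ derivSize u w b x :=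
  le_trans (le_add_of_nonneg_left (Finset.sum_nonneg fun i _ => by positivity))
    (Finset.single_le_sum (f := fun j => ∑ i, (|pd i (fun y => u y j) x| +
      |pd i (fun y => b y j) x| + |pd i (fun y => w y j) x|) + |w x j|)
      (fun i _ => by positivity) (Finset.mem_univ j))

lemma abs_jac_add_le_derivSize (x : E3) (i j : Fin 3) :
    |jac u x i j| + |jac b x i j| + |jac w x i j| ≤ derivSize u w b x :=
  le_trans ((Finset.single_le_sum (f := fun i => |pd i (fun y => u y j) x| +
      |pd i (fun y => b y j) x| + |pd i (fun y => w y j) x|)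
      (fun i _ => by positivity) (Finset.mem_univ i)).trans
      (le_add_of_nonneg_right (abs_nonneg (w x j))))
    (Finset.single_le_sum (f := fun j => ∑ i, (|pd i (fun y => u y j) x| +
      |pd i (fun y => b y j) x| + |pd i (fun y => w y j) x|) + |w x j|)
      (fun i _ => by positivity) (Finset.mem_univ j))

lemma derivSize_sq_le (x : E3) : derivSize u w b x ^ 2 ≤ 100 * energyDensity u w b x := by
  have key : ∀ v : E3 → E3, (∑ j, ∑ i, |jac v x i j|) ^ 2 ≤ 9 * gradSq v x := fun v => by
    have := sq_sum_le_card_mul_sum_sq (s := (Finset.univ : Finset (Fin 3 × Fin 3)))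
      (f := fun p => |jac v x p.2 p.1|)
    simp only [Fintype.sum_prod_type, sq_abs] at this
    simpa [gradSq, jac] using this
  have kw : (∑ j, |w x j|) ^ 2 ≤ 3 * ∑ j, w x j ^ 2 := by
    have := sq_sum_le_card_mul_sum_sq (s := (Finset.univ : Finset (Fin 3))) (f := fun j => |w x j|)
    simp only [sq_abs] at this
    simpa using this
  have e : derivSize u w b x = (∑ j, ∑ i, |jac u x i j|) + (∑ j, ∑ i, |jac b x i j|) +
      (∑ j, ∑ i, |jac w x i j|) + ∑ j, |w x j| := by
    simp only [derivSize, jac, Finset.sum_add_distrib]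
  have h1 := key u
  have h2 := key b
  have h3 := key w
  have n1 : 0 ≤ gradSq u x := by unfold gradSq; positivity
  have n2 : 0 ≤ gradSq b x := by unfold gradSq; positivity
  have n3 : 0 ≤ gradSq w x := by unfold gradSq; positivity
  have n4 : 0 ≤ ∑ j, w x j ^ 2 := by positivity
  rw [e, energyDensity]
  generalize (∑ j, ∑ i, |jac u x i j|) = A at *
  generalize (∑ j, ∑ i, |jac b x i j|) = B at *
  generalize (∑ j, ∑ i, |jac w x i j|) = C at *
  generalize (∑ j, |w x j|) = D at *
  nlinarith [sq_nonneg (A - B), sq_nonneg (A - C), sq_nonneg (A - D), sq_nonneg (B - C),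
    sq_nonneg (B - D), sq_nonneg (C - D)]

lemma continuous_jac {v : E3 → E3} (hv : ContDiff ℝ (⊤ : ℕ∞) v) (i j : Fin 3) :
    Continuous fun x => jac v x i j :=
  continuous_pd i (contDiff_component hv j).smooth_one

lemma continuous_fieldSize (hu : ContDiff ℝ (⊤ : ℕ∞) u) (hb : ContDiff ℝ (⊤ : ℕ∞) b)
    (hw : ContDiff ℝ (⊤ : ℕ∞) w) : Continuous (fieldSize u w b) := by
  have h1 := fun j => (contDiff_component hu j).continuous
  have h2 := fun j => (contDiff_component hb j).continuous
  have h3 := fun j => (contDiff_component hw j).continuous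
  unfold fieldSize
  fun_prop

lemma continuous_derivSize (hu : ContDiff ℝ (⊤ : ℕ∞) u) (hb : ContDiff ℝ (⊤ : ℕ∞) b)
    (hw : ContDiff ℝ (⊤ : ℕ∞) w) : Continuous (derivSize u w b) := by
  have h1 := continuous_jac hu
  have h2 := continuous_jac hb
  have h3 := continuous_jac hw
  have h4 := fun j => (contDiff_component hw j).continuous
  unfold jac at h1 h2 h3
  unfold derivSize
  fun_prop

lemma continuous_energyDensity (hu : ContDiff ℝ (⊤ : ℕ∞) u) (hb : ContDiff ℝ (⊤ : ℕ∞) b)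
    (hw : ContDiff ℝ (⊤ : ℕ∞) w) : Continuous (energyDensity u w b) := by
  have h1 := continuous_jac hu
  have h2 := continuous_jac hb
  have h3 := continuous_jac hw
  have h4 := fun j => (contDiff_component hw j).continuous
  unfold jac at h1 h2 h3
  unfold energyDensity gradSq
  fun_prop

/-- The local energy inequality. -/
lemma integral_mul_energyDensity_le {P : E3 → ℝ} (hsol : IsMMPSolution u w b P) {r r' G : ℝ}
    (hr : r < r') {η : E3 → ℝ} (hη : ContDiff ℝ 1 η) (hη0 : ∀ x, 0 ≤ η x) (hηs : SuppIn r η)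
    (hηG : ∀ i x, |pd i η x| ≤ G) {ξ : Fin 3 → E3 → ℝ} (hξ : ∀ j, ContDiff ℝ 1 (ξ j))
    (hξs : ∀ j, SuppIn r (ξ j)) (hdiv : ∀ x, ∑ j, pd j (ξ j) x = ∑ j, u x j * pd j η x) :
    ∫ x in ball3 r', η x * energyDensity u w b x ≤
      400 * ∫ x in ball3 r', (G * fieldSize u w b x * derivSize u w b x + G * fieldSize u w b x ^ 3
        + (∑ j, |ξ j x|) * fieldSize u w b x * derivSize u w b x
        + (∑ i, ∑ j, |pd i (ξ j) x|) * derivSize u w b x) := by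
  have hbal := integral_energyBalance hsol hη hηs hξ hξs hdiv
  set EB := fun x => energyBalance (η x) (fun i => pd i η x) (u x) (b x) (w x)
      (fun j => ξ j x) (jac u x) (jac b x) (jac w x) (fun i j => pd i (ξ j) x) with hEB
  have hsupp : SuppIn r EB := by
    intro x hx
    have h1 := hηs x hx
    have h2 := fun i => hηs.pd i x hx
    have h3 := fun j => hξs j x hx
    have h4 := fun i j => (hξs j).pd i x hx
    simp [hEB, energyBalance, h1, h2, h3, h4, curlMat, Fin.sum_univ_three]
  have hcm := continuous_fieldSize hsol.smooth_u hsol.smooth_b hsol.smooth_w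
  have hcg := continuous_derivSize hsol.smooth_u hsol.smooth_b hsol.smooth_w
  have hce := continuous_energyDensity hsol.smooth_u hsol.smooth_b hsol.smooth_w
  have hcξ := fun j => (hξ j).continuous
  have hcdξ := fun i j => continuous_pd i (hξ j)
  have hcη := hη.continuous
  have hEB0 : ∫ x in ball3 r', EB x = 0 := by
    rw [setIntegral_eq_integral_of_suppIn hsupp hr, hbal.2]
  set T := fun x => G * fieldSize u w b x * derivSize u w b x + G * fieldSize u w b x ^ 3
        + (∑ j, |ξ j x|) * fieldSize u w b x * derivSize u w b x
        + (∑ i, ∑ j, |pd i (ξ j) x|) * derivSize u w b x with hT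
  have hcT : Continuous T := by rw [hT]; fun_prop
  have hpt : ∀ x, η x * energyDensity u w b x ≤ 4 * EB x + 400 * T x := fun x => by
    have hj := abs_jac_add_le_derivSize (u := u) (w := w) (b := b) x
    have hX : ∀ j, |ξ j x| ≤ ∑ j, |ξ j x| := fun j =>
      Finset.single_le_sum (f := fun j => |ξ j x|) (fun _ _ => abs_nonneg _) (Finset.mem_univ j)
    have hY : ∀ i j, |pd i (ξ j) x| ≤ ∑ i, ∑ j, |pd i (ξ j) x| := fun i j =>
      (Finset.single_le_sum (f := fun j => |pd i (ξ j) x|) (fun _ _ => abs_nonneg _)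
        (Finset.mem_univ j)).trans (Finset.single_le_sum (f := fun i => ∑ j, |pd i (ξ j) x|)
        (fun _ _ => by positivity) (Finset.mem_univ i))
    have hdu : ∀ i j, |jac u x i j| ≤ derivSize u w b x := fun i j => by
      linarith [hj i j, abs_nonneg (jac b x i j), abs_nonneg (jac w x i j)]
    have hdb : ∀ i j, |jac b x i j| ≤ derivSize u w b x := fun i j => by
      linarith [hj i j, abs_nonneg (jac u x i j), abs_nonneg (jac w x i j)]
    have hdw : ∀ i j, |jac w x i j| ≤ derivSize u w b x := fun i j => by
      linarith [hj i j, abs_nonneg (jac b x i j), abs_nonneg (jac u x i j)]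
    have := le_energyBalance (hη0 x) (fun i => hηG i x)
      (abs_u_le_fieldSize (w := w) (b := b) x) (abs_b_le_fieldSize (u := u) (w := w) x)
      (abs_w_le_fieldSize (u := u) (b := b) x) (abs_w_le_derivSize (u := u) (b := b) x)
      hdu hdb hdw hX hY
    simp only [hEB, hT, energyDensity, gradSq]
    simp only [jac] at this ⊢
    linarith
  calc ∫ x in ball3 r', η x * energyDensity u w b x
      ≤ ∫ x in ball3 r', (4 * EB x + 400 * T x) :=
        setIntegral_mono (integrableOn_ball3 (hcη.mul hce) r')
          ((hbal.1.integrableOn.const_mul 4).add ((integrableOn_ball3 hcT r').const_mul 400)) hpt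
    _ = 400 * ∫ x in ball3 r', T x := by
        rw [integral_add (hbal.1.integrableOn.const_mul 4)
          ((integrableOn_ball3 hcT r').const_mul 400), integral_const_mul, integral_const_mul, hEB0]
        ring

end EnergyEstimate

section TestField

lemma SuppIn.abs_rpow {r q : ℝ} {f : E3 → ℝ} (h : SuppIn r f) (hq : 0 < q) :
    SuppIn r fun x => |f x| ^ q := fun x hx => by
  simp [h x hx, Real.zero_rpow hq.ne']

lemma continuous_abs_rpow {f : E3 → ℝ} (hf : Continuous f) {q : ℝ} (hq : 0 ≤ q) :
    Continuous fun x => |f x| ^ q := hf.abs.rpow_const fun _ => Or.inr hq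

/-- A field with divergence `v · ∇η`, controlled by the potentials of `v` and supported where
`η` is. -/
lemma exists_divergence_eq_cutoff {s : ℝ} (hs : 1 < s) {N C : ℝ} (hN : 0 < N) (hC : 0 < C) :
    ∃ K : ℝ, 0 < K ∧ ∀ (R r τ : ℝ) (η : E3 → ℝ) (A : Fin 3 → Fin 3 → E3 → ℝ) (v : Fin 3 → E3 → ℝ),
    1 ≤ R → 0 < τ → τ ≤ R → 0 < r → r < 2 * R → ContDiff ℝ (⊤ : ℕ∞) η → SuppIn r η →
    (∀ i x, |pd i η x| ≤ C * τ⁻¹) → (∀ i k x, |pd k (pd i η) x| ≤ C * τ⁻¹ ^ 2) →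
    (∀ i j, ContDiff ℝ 1 (A i j)) → (∀ j, ContDiff ℝ 1 (v j)) →
    (∀ j x, ∑ i, pd i (A i j) x = v j x) → (∀ x, ∑ j, pd j (v j) x = 0) →
    (∀ i j, ∫ x in ball3 (2 * R), |A i j x| ^ s ≤ N * R ^ (2 + s / 3)) →
    ∃ Z : Fin 3 → E3 → ℝ, (∀ i, ContDiff ℝ 1 (Z i)) ∧ (∀ i, SuppIn r (Z i)) ∧
      (∀ x, ∑ i, pd i (Z i) x = ∑ j, v j x * pd j η x) ∧
      ∀ i, ∫ x, |Z i x| ^ s ≤ K * ((R * τ⁻¹ ^ 2) ^ s * R ^ (2 + s / 3)) := by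
  have hs0 : 0 < s := by linarith
  set K₀ : ℝ := (2 : ℝ) ^ s * (2 * 64 ^ s) with hK₀
  have hK₀p : 0 < K₀ := by positivity
  refine ⟨2 ^ s * (1 + K₀ * 2 ^ s) * C ^ s * (9 ^ s * N), by positivity, ?_⟩
  intro R r τ η A v hR hτ hτR hr hrR hη hηs hη1 hη2 hA hv hAv hdv hAN
  have hR0 : 0 ≤ R := by linarith
  have hη' := hη.smooth_one
  have hηi : ∀ i, ContDiff ℝ 1 (pd i η) := fun i => (contDiff_smooth_pd i hη).smooth_one
  have hηij : ∀ i j, ContDiff ℝ 1 (pd i (pd j η)) :=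
    fun i j => (contDiff_smooth_pd i (contDiff_smooth_pd j hη)).smooth_one
  have cA : ∀ i j, Continuous (A i j) := fun i j => (hA i j).continuous
  set g : E3 → ℝ := fun x => ∑ i, ∑ j, A i j x * pd i (pd j η) x with hg
  have cg : ContDiff ℝ 1 g := ContDiff.sum fun i _ => ContDiff.sum fun j _ => (hA i j).mul (hηij i j)
  have gs : SuppIn r g := SuppIn.sum fun i _ => SuppIn.sum fun j _ => ((hηs.pd j).pd i).mul_left _
  set H : Fin 3 → E3 → ℝ := fun i x => ∑ j, A i j x * pd j η x with hH
  have cH : ∀ i, ContDiff ℝ 1 (H i) := fun i => ContDiff.sum fun j _ => (hA i j).mul (hηi j)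
  have Hs : ∀ i, SuppIn r (H i) := fun i => SuppIn.sum fun j _ => (hηs.pd j).mul_left _
  have hdH : ∀ x, ∑ i, pd i (H i) x = (∑ j, v j x * pd j η x) + g x := by
    intro x
    have e : ∀ i, pd i (H i) x = ∑ j, (pd i (A i j) x * pd j η x + A i j x * pd i (pd j η) x) :=
      fun i => by
        rw [hH, pd_sum _ _ fun j _ => (hA i j).mul (hηi j)]
        exact Finset.sum_congr rfl fun j _ => pd_mul i (hA i j) (hηi j) x
    simp only [e, Finset.sum_add_distrib, hg]
    rw [Finset.sum_comm]
    simp only [← Finset.sum_mul, hAv]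
  have hg0 : ∫ x, g x = 0 := by
    have h1 := (integral_sum_pd_eq_zero Finset.univ (fun i => i) cH Hs).2
    have h2 := (integral_sum_pd_eq_zero Finset.univ (r := r) (fun i => i)
      (A := fun j x => η x * v j x) (fun j => hη'.mul (hv j)) (fun j => hηs.mul_right _)).2
    have e2 : ∀ x, ∑ j, pd j (fun x => η x * v j x) x = ∑ j, v j x * pd j η x := fun x => by
      have : ∀ j, pd j (fun x => η x * v j x) x = v j x * pd j η x + η x * pd j (v j) x := fun j => by
        rw [pd_mul j hη' (hv j)]; ring
      simp only [this, Finset.sum_add_distrib, ← Finset.mul_sum, hdv]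
      ring
    simp only [e2] at h2
    simp only [hdH] at h1
    have c3 : Continuous fun x => ∑ j, v j x * pd j η x :=
      continuous_finsetSum _ fun j _ => (hv j).continuous.mul (hηi j).continuous
    have s3 : SuppIn r fun x => ∑ j, v j x * pd j η x :=
      SuppIn.sum fun j _ => (hηs.pd j).mul_left _
    rwa [integral_add (integrable_of_suppIn c3 s3) (integrable_of_suppIn cg.continuous gs), h2,
      zero_add] at h1
  obtain ⟨V, cV, Vs, hdV, hVb⟩ := exists_sum_pd_eq hs hr cg gs hg0
  refine ⟨fun i x => H i x - V i x, fun i => (cH i).sub (cV i), fun i => (Hs i).sub (Vs i), ?_, ?_⟩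
  · intro x
    simp only [pd_sub _ (cH _) (cV _), Finset.sum_sub_distrib, hdH, hdV]
    ring
  set S : E3 → ℝ := fun x => ∑ i, ∑ j, |A i j x| with hS
  have cS : Continuous S := by rw [hS]; fun_prop
  have S0 : ∀ x, 0 ≤ S x := fun x => by positivity
  have cSs : Continuous fun x => S x ^ s := cS.rpow_const fun _ => Or.inr hs0.le
  have hAS : ∀ i j x, |A i j x| ≤ S x := fun i j x =>
    (Finset.single_le_sum (f := fun j => |A i j x|) (fun _ _ => abs_nonneg _)
        (Finset.mem_univ j)).trans (Finset.single_le_sum (f := fun i => ∑ j, |A i j x|)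
        (fun _ _ => by positivity) (Finset.mem_univ i))
  have hSN : ∫ x in ball3 (2 * R), S x ^ s ≤ 9 ^ s * N * R ^ (2 + s / 3) := by
    have hpt : ∀ x, S x ^ s ≤ 9 ^ (s - 1) * ∑ p : Fin 3 × Fin 3, |A p.1 p.2 x| ^ s := fun x => by
      have := Real.rpow_sum_le_const_mul_sum_rpow (Finset.univ : Finset (Fin 3 × Fin 3))
        (fun p => A p.1 p.2 x) hs.le
      rw [Fintype.sum_prod_type] at this
      simpa using this
    have hci : ∀ p : Fin 3 × Fin 3, Continuous fun x => |A p.1 p.2 x| ^ s :=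
      fun p => continuous_abs_rpow (cA _ _) hs0.le
    calc ∫ x in ball3 (2 * R), S x ^ s
        ≤ ∫ x in ball3 (2 * R), 9 ^ (s - 1) * ∑ p : Fin 3 × Fin 3, |A p.1 p.2 x| ^ s :=
          integral_ball3_mono cSs (continuous_const.mul (continuous_finsetSum _ fun p _ => hci p)) hpt
      _ = 9 ^ (s - 1) * ∑ p : Fin 3 × Fin 3, ∫ x in ball3 (2 * R), |A p.1 p.2 x| ^ s := by
          rw [integral_const_mul, integral_finsetSum _ fun p _ => integrableOn_ball3 (hci p) _]
      _ ≤ 9 ^ (s - 1) * ∑ p : Fin 3 × Fin 3, N * R ^ (2 + s / 3) := by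
          gcongr with p; exact hAN p.1 p.2
      _ = 9 ^ s * N * R ^ (2 + s / 3) := by
          rw [Real.rpow_sub_one (by norm_num)]
          simp
          ring
  set J := ∫ x in ball3 (2 * R), S x ^ s with hJ
  have hJ0 : 0 ≤ J := integral_nonneg fun x => by have := S0 x; positivity
  have hgS : ∫ x, |g x| ^ s ≤ (C * τ⁻¹ ^ 2) ^ s * J := by
    rw [← setIntegral_eq_integral_of_suppIn (gs.abs_rpow hs0) hrR, hJ, ← integral_const_mul]
    refine integral_ball3_mono (continuous_abs_rpow cg.continuous hs0.le)
      (continuous_const.mul cSs) fun x => ?_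
    rw [Pi.mul_apply, ← Real.mul_rpow (by positivity) (S0 x)]
    refine Real.rpow_le_rpow (abs_nonneg _) ?_ hs0.le
    rw [hg, hS, Finset.mul_sum]
    refine (Finset.abs_sum_le_sum_abs _ _).trans (Finset.sum_le_sum fun i _ => ?_)
    rw [Finset.mul_sum]
    refine (Finset.abs_sum_le_sum_abs _ _).trans (Finset.sum_le_sum fun j _ => ?_)
    rw [abs_mul, mul_comm]
    gcongr
    exact hη2 j i x
  intro i
  have hHS : ∀ x, |H i x| ≤ C * τ⁻¹ * S x := fun x => by
    have : ∑ j, |A i j x| ≤ S x := Finset.single_le_sum (f := fun i => ∑ j, |A i j x|)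
        (fun _ _ => by positivity) (Finset.mem_univ i)
    refine le_trans ?_ (mul_le_mul_of_nonneg_left this (by positivity))
    rw [Finset.mul_sum]
    refine (Finset.abs_sum_le_sum_abs _ _).trans (Finset.sum_le_sum fun j _ => ?_)
    rw [abs_mul, mul_comm]
    gcongr
    exact hη1 j x
  have hiV : IntegrableOn (fun x => |V i x| ^ s) (ball3 (2 * R)) :=
    integrableOn_ball3 (continuous_abs_rpow (cV i).continuous hs0.le) _
  have hττ : τ⁻¹ ≤ R * τ⁻¹ ^ 2 := by
    have : 1 ≤ R * τ⁻¹ := by rw [← div_eq_mul_inv]; exact (one_le_div hτ).2 hτR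
    have h0 : 0 < τ⁻¹ := by positivity
    nlinarith
  calc ∫ x, |H i x - V i x| ^ s
      = ∫ x in ball3 (2 * R), |H i x - V i x| ^ s :=
        (setIntegral_eq_integral_of_suppIn (((Hs i).sub (Vs i)).abs_rpow hs0) hrR).symm
    _ ≤ ∫ x in ball3 (2 * R), 2 ^ s * ((C * τ⁻¹) ^ s * S x ^ s + |V i x| ^ s) := by
        refine integral_ball3_mono (continuous_abs_rpow ((cH i).sub (cV i)).continuous hs0.le)
          (continuous_const.mul ((continuous_const.mul cSs).add
            (continuous_abs_rpow (cV i).continuous hs0.le))) fun x => ?_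
        refine (abs_sub_rpow_le hs.le).trans ?_
        simp only [Pi.mul_apply, Pi.add_apply]
        rw [← Real.mul_rpow (by positivity) (S0 x)]
        gcongr
        exact hHS x
    _ = 2 ^ s * ((C * τ⁻¹) ^ s * J + ∫ x, |V i x| ^ s) := by
        rw [integral_const_mul, integral_add ((integrableOn_ball3 cSs _).const_mul _) hiV,
          integral_const_mul, setIntegral_eq_integral_of_suppIn ((Vs i).abs_rpow hs0) hrR]
    _ ≤ 2 ^ s * ((C * (R * τ⁻¹ ^ 2)) ^ s * J + K₀ * (2 * R) ^ s * ((C * τ⁻¹ ^ 2) ^ s * J)) := by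
        have h1 := hVb i
        have h2 : K₀ * r ^ s * ∫ x, |g x| ^ s ≤ K₀ * (2 * R) ^ s * ((C * τ⁻¹ ^ 2) ^ s * J) := by
          have : 0 ≤ ∫ x, |g x| ^ s := integral_nonneg fun x => by positivity
          gcongr
        have h3 : (C * τ⁻¹) ^ s * J ≤ (C * (R * τ⁻¹ ^ 2)) ^ s * J := by gcongr
        have : (0 : ℝ) ≤ 2 ^ s := by positivity
        exact mul_le_mul_of_nonneg_left (add_le_add h3 (h1.trans h2)) this
    _ = 2 ^ s * (1 + K₀ * 2 ^ s) * C ^ s * (R * τ⁻¹ ^ 2) ^ s * J := by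
        have e1 : (C * (R * τ⁻¹ ^ 2)) ^ s = C ^ s * (R * τ⁻¹ ^ 2) ^ s :=
          Real.mul_rpow hC.le (by positivity)
        have e2 : (2 * R) ^ s * (C * τ⁻¹ ^ 2) ^ s = 2 ^ s * (C * (R * τ⁻¹ ^ 2)) ^ s := by
          rw [← Real.mul_rpow (by positivity) (by positivity),
            ← Real.mul_rpow (by positivity) (by positivity)]
          congr 1; ring
        have e3 : K₀ * (2 * R) ^ s * ((C * τ⁻¹ ^ 2) ^ s * J) =
            K₀ * J * ((2 * R) ^ s * (C * τ⁻¹ ^ 2) ^ s) := by ring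
        rw [e3, e2, e1]
        ring
    _ ≤ 2 ^ s * (1 + K₀ * 2 ^ s) * C ^ s * (R * τ⁻¹ ^ 2) ^ s * (9 ^ s * N * R ^ (2 + s / 3)) := by
        gcongr
    _ = _ := by ring

end TestField

section TestFieldBounds

lemma integral_sq_le_rpow {s : ℝ} (hs : 2 ≤ s) {f : E3 → ℝ} (hf : Continuous f) (r : ℝ) :
    ∫ x in ball3 r, f x ^ 2 ≤
      (∫ x in ball3 r, |f x| ^ s) ^ (2 / s) * (volume.real (ball3 r)) ^ (1 - 2 / s) := by
  have hs0 : 0 < s := by linarith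
  have h2s : 2 / s ≤ 1 := (div_le_one hs0).2 hs
  have := holder_two r (a := fun x => |f x| ^ s) (b := fun _ => 1)
    (continuous_abs_rpow hf hs0.le) (by fun_prop) (fun x => by positivity) (fun _ => zero_le_one)
    (p := 2 / s) (q := 1 - 2 / s) (by positivity) (by linarith) (by ring)
  have e : ∀ x, (|f x| ^ s) ^ (2 / s) = f x ^ 2 := fun x => by
    rw [← Real.rpow_mul (abs_nonneg _), mul_div_cancel₀ _ hs0.ne', ← sq_abs,
      ← Real.rpow_natCast, Nat.cast_ofNat]
  simpa [e, setIntegral_const] using this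

/-- A cutoff together with a two-parameter family of correctors for its divergence defect. -/
lemma exists_testField {s : ℝ} (hs : 2 ≤ s) {N : ℝ} (hN : 0 < N) :
    ∃ K : ℝ, 0 < K ∧ ∀ (R ρ τ : ℝ) (A : Fin 3 → Fin 3 → E3 → ℝ) (v : Fin 3 → E3 → ℝ)
      (m g : E3 → ℝ),
    1 ≤ R → 0 < τ → τ ≤ R → 0 < ρ → ρ + τ ≤ 2 * R →
    (∀ i j, ContDiff ℝ 1 (A i j)) → (∀ j, ContDiff ℝ 1 (v j)) →
    (∀ j x, ∑ i, pd i (A i j) x = v j x) → (∀ x, ∑ j, pd j (v j) x = 0) →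
    (∀ i j, ∫ x in ball3 (2 * R), |A i j x| ^ s ≤ N * R ^ (2 + s / 3)) →
    Continuous m → Continuous g → (∀ j x, |v j x| ≤ m x) → (∀ i j x, |pd i (v j) x| ≤ g x) →
    ∃ η : E3 → ℝ, ContDiff ℝ 1 η ∧ (∀ x, 0 ≤ η x) ∧ (∀ x, ‖x‖ ≤ ρ → η x = 1) ∧
      SuppIn (ρ + 3 * τ / 8) η ∧ (∀ i x, |pd i η x| ≤ K * τ⁻¹) ∧
      ∀ δ, 0 < δ → δ ≤ τ / 8 → ∃ ξ₁ ξ₂ : Fin 3 → E3 → ℝ,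
        (∀ i, ContDiff ℝ 1 (ξ₁ i)) ∧ (∀ i, ContDiff ℝ 1 (ξ₂ i)) ∧
        (∀ i, SuppIn (ρ + 3 * τ / 8) (ξ₁ i)) ∧ (∀ i, SuppIn (ρ + 3 * τ / 8) (ξ₂ i)) ∧
        (∀ x, ∑ i, pd i (ξ₁ i) x + ∑ i, pd i (ξ₂ i) x = ∑ j, v j x * pd j η x) ∧
        (∀ i, ∫ x in ball3 (ρ + τ / 2), |ξ₁ i x| ^ 3 ≤
          K * ((δ * τ⁻¹) ^ 3 * ∫ x in ball3 (ρ + τ / 2), m x ^ 3)) ∧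
        (∀ i k, ∫ x in ball3 (ρ + τ / 2), pd k (ξ₁ i) x ^ 2 ≤
          K * (δ ^ 2 * (τ⁻¹ ^ 2 * (∫ x in ball3 (ρ + τ / 2), g x ^ 2) +
            τ⁻¹ ^ 4 * ∫ x in ball3 (ρ + τ / 2), m x ^ 2))) ∧
        (∀ i, ∫ x in ball3 (ρ + τ / 2), |ξ₂ i x| ^ s ≤
          K * ((R * τ⁻¹ ^ 2) ^ s * R ^ (2 + s / 3))) ∧
        (∀ i k, ∫ x in ball3 (ρ + τ / 2), pd k (ξ₂ i) x ^ 2 ≤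
          K * (δ⁻¹ ^ 2 * ((R * τ⁻¹ ^ 2) ^ 2 * R ^ (11 / 3 - 2 / s)))) := by
  have hs0 : 0 < s := by linarith
  have h2s : 2 / s ≤ 1 := (div_le_one hs0).2 hs
  obtain ⟨C₁, hC₁, hcut⟩ := exists_cutoff
  obtain ⟨C₂, hC₂, hreg⟩ := exists_regularization
  obtain ⟨c, hc, hvol⟩ := exists_volume_ball3_le
  obtain ⟨K, hK, hZ⟩ := exists_divergence_eq_cutoff (s := s) (by linarith) hN
    (C := 16 * C₁) (by positivity)
  have hc0 : 0 < c := by linarith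
  set L := 16 * C₁ with hL
  have hL0 : 0 < L := by positivity
  refine ⟨L + (3 * L) ^ 3 + 18 * L ^ 2 + K + C₂ ^ 2 * (K ^ (2 / s) * c ^ (1 - 2 / s)),
    by positivity, ?_⟩
  set M := L + (3 * L) ^ 3 + 18 * L ^ 2 + K + C₂ ^ 2 * (K ^ (2 / s) * c ^ (1 - 2 / s)) with hM
  have hm1 : L ≤ M := by rw [hM]; linarith [show 0 < (3 * L) ^ 3 + 18 * L ^ 2 + K + C₂ ^ 2 * (K ^ (2 / s) * c ^ (1 - 2 / s)) by positivity]
  have hm2 : (3 * L) ^ 3 ≤ M := by rw [hM]; linarith [show 0 < L + 18 * L ^ 2 + K + C₂ ^ 2 * (K ^ (2 / s) * c ^ (1 - 2 / s)) by positivity]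
  have hm3 : 18 * L ^ 2 ≤ M := by rw [hM]; linarith [show 0 < L + (3 * L) ^ 3 + K + C₂ ^ 2 * (K ^ (2 / s) * c ^ (1 - 2 / s)) by positivity]
  have hm4 : K ≤ M := by rw [hM]; linarith [show 0 < L + (3 * L) ^ 3 + 18 * L ^ 2 + C₂ ^ 2 * (K ^ (2 / s) * c ^ (1 - 2 / s)) by positivity]
  have hm5 : C₂ ^ 2 * (K ^ (2 / s) * c ^ (1 - 2 / s)) ≤ M := by rw [hM]; linarith [show 0 < L + (3 * L) ^ 3 + 18 * L ^ 2 + K by positivity]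
  intro R ρ τ A v m g hR hτ hτR hρ hρR hA hv hAv hdv hAN hcm hcg hvm hvg
  have hR0 : 0 < R := by linarith
  obtain ⟨η, hη, hη0, -, hη1, hηs, hηd, hηdd⟩ := hcut ρ (τ / 4) hρ (by positivity)
  have e4 : (τ / 4)⁻¹ = 4 * τ⁻¹ := by field_simp
  have hηd' : ∀ i x, |pd i η x| ≤ L * τ⁻¹ := fun i x => (hηd i x).trans (by
    rw [e4, hL]; have : 0 < C₁ * τ⁻¹ := by positivity
    linarith)
  have hηdd' : ∀ i k x, |pd k (pd i η) x| ≤ L * τ⁻¹ ^ 2 := fun i k x => (hηdd i k x).trans (by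
    rw [e4, hL]; apply le_of_eq; ring)
  have hη' := hη.smooth_one
  have hηi : ∀ i, ContDiff ℝ 1 (pd i η) := fun i => (contDiff_smooth_pd i hη).smooth_one
  have hηij : ∀ i j, Continuous (pd i (pd j η)) := fun i j => continuous_pd i (hηi j)
  obtain ⟨Z, cZ, Zs, hdZ, hZb⟩ := hZ R (ρ + τ / 4) τ η A v hR hτ hτR (by positivity) (by linarith)
    hη hηs hηd' hηdd' hA hv hAv hdv hAN
  set f : E3 → ℝ := fun x => ∑ j, v j x * pd j η x with hf
  have cf : ContDiff ℝ 1 f := ContDiff.sum fun j _ => (hv j).mul (hηi j)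
  have fs : SuppIn (ρ + τ / 4) f := SuppIn.sum fun j _ => (hηs.pd j).mul_left _
  have hm0 : ∀ x, 0 ≤ m x := fun x => (abs_nonneg _).trans (hvm 0 x)
  have hg0 : ∀ x, 0 ≤ g x := fun x => (abs_nonneg _).trans (hvg 0 0 x)
  have hfm : ∀ x, |f x| ≤ 3 * L * τ⁻¹ * m x := fun x => by
    refine (Finset.abs_sum_le_sum_abs _ _).trans ((Finset.sum_le_sum fun j _ =>
      (abs_mul (v j x) (pd j η x)).le.trans
      (mul_le_mul (hvm j x) (hηd' j x) (abs_nonneg _) (hm0 x))).trans (le_of_eq ?_))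
    simp; ring
  have hpf : ∀ k x, |pd k f x| ≤ 3 * L * τ⁻¹ * g x + 3 * L * τ⁻¹ ^ 2 * m x := fun k x => by
    rw [hf, pd_sum _ _ fun j _ => (hv j).mul (hηi j)]
    refine (Finset.abs_sum_le_sum_abs _ _).trans ((Finset.sum_le_sum fun j _ => ?_).trans
      (le_of_eq (?_ : ∑ j : Fin 3, (g x * (L * τ⁻¹) + m x * (L * τ⁻¹ ^ 2)) = _)))
    · rw [pd_mul k (hv j) (hηi j)]
      refine (abs_add_le _ _).trans (add_le_add ?_ ?_)
      · rw [abs_mul]; exact mul_le_mul (hvg k j x) (hηd' j x) (abs_nonneg _) (hg0 x)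
      · rw [abs_mul]; exact mul_le_mul (hvm j x) (hηdd' j k x) (abs_nonneg _) (hm0 x)
    · simp; ring
  have hI3 : ∫ x, |f x| ^ (3 : ℝ) ≤ (3 * L * τ⁻¹) ^ 3 * ∫ x in ball3 (ρ + τ / 2), m x ^ 3 := by
    rw [← setIntegral_eq_integral_of_suppIn (fs.abs_rpow (by norm_num : (0 : ℝ) < 3))
      (by linarith : ρ + τ / 4 < ρ + τ / 2), ← integral_const_mul]
    refine integral_ball3_mono (continuous_abs_rpow cf.continuous (by norm_num))
      (by fun_prop) fun x => ?_
    rw [← mul_pow, show (3 : ℝ) = ((3 : ℕ) : ℝ) by norm_num, Real.rpow_natCast]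
    simpa using pow_le_pow_left₀ (abs_nonneg _) (hfm x) 3
  have hI2 : ∀ k, ∫ x, |pd k f x| ^ (2 : ℝ) ≤ 18 * L ^ 2 * (τ⁻¹ ^ 2 *
      (∫ x in ball3 (ρ + τ / 2), g x ^ 2) + τ⁻¹ ^ 4 * ∫ x in ball3 (ρ + τ / 2), m x ^ 2) := fun k => by
    rw [← setIntegral_eq_integral_of_suppIn ((fs.pd k).abs_rpow (by norm_num : (0 : ℝ) < 2))
      (by linarith : ρ + τ / 4 < ρ + τ / 2), ← integral_const_mul, ← integral_const_mul,
      ← integral_add ((integrableOn_ball3 (by fun_prop) _).const_mul _)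
        ((integrableOn_ball3 (by fun_prop) _).const_mul _), ← integral_const_mul]
    refine integral_ball3_mono (continuous_abs_rpow (continuous_pd k cf) (by norm_num))
      (by fun_prop) fun x => ?_
    rw [show (2 : ℝ) = ((2 : ℕ) : ℝ) by norm_num, Real.rpow_natCast]
    refine (pow_le_pow_left₀ (abs_nonneg _) (hpf k x) 2).trans ?_
    nlinarith [sq_nonneg (3 * L * τ⁻¹ * g x - 3 * L * τ⁻¹ ^ 2 * m x)]
  have hIZ : ∀ i, ∫ x, |Z i x| ^ (2 : ℝ) ≤ K ^ (2 / s) * c ^ (1 - 2 / s) *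
      ((R * τ⁻¹ ^ 2) ^ 2 * R ^ (11 / 3 - 2 / s)) := fun i => by
    have h1 := integral_sq_le_rpow hs (cZ i).continuous (2 * R)
    rw [setIntegral_eq_integral_of_suppIn ((Zs i).abs_rpow hs0)
      (by linarith : ρ + τ / 4 < 2 * R)] at h1
    have e : ∫ x in ball3 (2 * R), Z i x ^ 2 = ∫ x, |Z i x| ^ (2 : ℝ) := by
      rw [← setIntegral_eq_integral_of_suppIn ((Zs i).abs_rpow (by norm_num : (0 : ℝ) < 2))
      (by linarith : ρ + τ / 4 < 2 * R)]
      refine integral_congr_ae (ae_of_all _ fun x => ?_)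
      simp
    rw [e] at h1
    refine h1.trans ?_
    have h2 : 0 ≤ ∫ x, |Z i x| ^ s := integral_nonneg fun x => by positivity
    calc (∫ x, |Z i x| ^ s) ^ (2 / s) * volume.real (ball3 (2 * R)) ^ (1 - 2 / s)
        ≤ (K * ((R * τ⁻¹ ^ 2) ^ s * R ^ (2 + s / 3))) ^ (2 / s) * (c * R ^ 3) ^ (1 - 2 / s) := by
          gcongr
          · exact hZb i
          · exact hvol R hR0.le
      _ = _ := by
          have e1 : (K * ((R * τ⁻¹ ^ 2) ^ s * R ^ (2 + s / 3))) ^ (2 / s) =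
              K ^ (2 / s) * ((R * τ⁻¹ ^ 2) ^ 2 * R ^ ((2 + s / 3) * (2 / s))) := by
            rw [Real.mul_rpow (by positivity) (by positivity),
              Real.mul_rpow (x := (R * τ⁻¹ ^ 2) ^ s) (by positivity) (by positivity),
              ← Real.rpow_mul (by positivity), mul_div_cancel₀ _ hs0.ne', ← Real.rpow_mul hR0.le,
              Real.rpow_two]
          have e2 : (c * R ^ 3) ^ (1 - 2 / s) =
              c ^ (1 - 2 / s) * R ^ (((3 : ℕ) : ℝ) * (1 - 2 / s)) := by
            rw [Real.mul_rpow (by positivity) (by positivity), ← Real.rpow_natCast R 3,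
              ← Real.rpow_mul hR0.le]
          have e3 : R ^ (11 / 3 - 2 / s) =
              R ^ ((2 + s / 3) * (2 / s)) * R ^ (((3 : ℕ) : ℝ) * (1 - 2 / s)) := by
            rw [← Real.rpow_add hR0]; congr 1; push_cast; field_simp; ring
          rw [e1, e2, e3]
          ring
  refine ⟨η, hη', hη0, hη1, hηs.mono (by linarith), fun i x => (hηd' i x).trans (by gcongr), ?_⟩
  intro δ hδ hδτ
  obtain ⟨ξ₁, ξ₂, c1, c2, s1, s2, hdiv, b1, b2, b3, b4⟩ :=
    hreg (ρ + τ / 4) δ Z f hδ cZ Zs cf hdZ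
  have hsub : ∀ {h : E3 → ℝ}, SuppIn (ρ + τ / 4 + δ) h → SuppIn (ρ + 3 * τ / 8) h :=
    fun h => h.mono (by linarith)
  have hset : ∀ {h : E3 → ℝ}, SuppIn (ρ + τ / 4 + δ) h →
      ∫ x in ball3 (ρ + τ / 2), h x = ∫ x, h x := fun hs =>
    setIntegral_eq_integral_of_suppIn (hsub hs) (by linarith)
  have p2 : ∀ a : ℝ, a ^ 2 = |a| ^ (2 : ℝ) := fun a => by simp
  have p3 : ∀ a : ℝ, |a| ^ 3 = |a| ^ (3 : ℝ) := fun a => by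
    rw [show (3 : ℝ) = ((3 : ℕ) : ℝ) by norm_num, Real.rpow_natCast]
  refine ⟨ξ₁, ξ₂, c1, c2, fun i => hsub (s1 i), fun i => hsub (s2 i), hdiv, ?_, ?_, ?_, ?_⟩
  · intro i
    simp only [p3]
    rw [hset ((s1 i).abs_rpow (by norm_num))]
    refine (b1 3 (by norm_num) i).trans ?_
    have hp : 0 ≤ ∫ x in ball3 (ρ + τ / 2), m x ^ 3 :=
      integral_nonneg fun x => pow_nonneg (hm0 x) 3
    calc δ ^ (3 : ℝ) * ∫ x, |f x| ^ (3 : ℝ)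
        ≤ δ ^ (3 : ℝ) * ((3 * L * τ⁻¹) ^ 3 * ∫ x in ball3 (ρ + τ / 2), m x ^ 3) := by gcongr
      _ = (3 * L) ^ 3 * ((δ * τ⁻¹) ^ 3 * ∫ x in ball3 (ρ + τ / 2), m x ^ 3) := by
          rw [show (3 : ℝ) = ((3 : ℕ) : ℝ) by norm_num, Real.rpow_natCast]; push_cast; ring
      _ ≤ _ := by gcongr
  · intro i k
    simp only [p2 (pd k (ξ₁ i) _)]
    rw [hset (((s1 i).pd k).abs_rpow (by norm_num))]
    refine (b2 2 (by norm_num) i k).trans ?_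
    have hp : 0 ≤ ∫ x in ball3 (ρ + τ / 2), m x ^ 2 := integral_nonneg fun x => sq_nonneg _
    have hp' : 0 ≤ ∫ x in ball3 (ρ + τ / 2), g x ^ 2 := integral_nonneg fun x => sq_nonneg _
    rw [Real.rpow_two]
    refine (mul_le_mul_of_nonneg_left (hI2 k) (sq_nonneg δ)).trans ?_
    rw [mul_left_comm]
    gcongr
  · intro i
    rw [hset ((s2 i).abs_rpow hs0)]
    refine (b3 s (by linarith) i).trans ((hZb i).trans ?_)
    gcongr
  · intro i k
    simp only [p2 (pd k (ξ₂ i) _)]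
    rw [hset (((s2 i).pd k).abs_rpow (by norm_num))]
    refine (b4 2 (by norm_num) i k).trans ?_
    rw [Real.rpow_two]
    refine (mul_le_mul_of_nonneg_left (hIZ i) (sq_nonneg _)).trans ?_
    calc (C₂ * δ⁻¹) ^ 2 * (K ^ (2 / s) * c ^ (1 - 2 / s) *
          ((R * τ⁻¹ ^ 2) ^ 2 * R ^ (11 / 3 - 2 / s)))
        = C₂ ^ 2 * (K ^ (2 / s) * c ^ (1 - 2 / s)) *
          (δ⁻¹ ^ 2 * ((R * τ⁻¹ ^ 2) ^ 2 * R ^ (11 / 3 - 2 / s))) := by ring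
      _ ≤ _ := by gcongr

end TestFieldBounds

section ErrorTerms

lemma rpow_le_mul_exp {x C e p : ℝ} (hx : 0 ≤ x) (hC : 1 ≤ C) (hp : 0 ≤ p) (hp1 : p ≤ 1)
    (h : x ≤ C * Real.exp e) : x ^ p ≤ C * Real.exp (e * p) := by
  calc x ^ p ≤ (C * Real.exp e) ^ p := Real.rpow_le_rpow hx h hp
    _ = C ^ p * Real.exp (e * p) := by
        rw [Real.mul_rpow (by linarith) (Real.exp_pos e).le, Real.exp_mul]
    _ ≤ C * Real.exp (e * p) := by
        gcongr
        exact Real.rpow_le_self_of_one_le hC hp1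

variable {r Q : ℝ} {f m g : E3 → ℝ}

lemma integral_mul_le_mul_exp (hQ : 1 ≤ Q) (hf : Continuous f) (hg : Continuous g)
    (hg0 : ∀ x, 0 ≤ g x) {x y : ℝ}
    (h1 : ∫ z in ball3 r, f z ^ 2 ≤ Q * Real.exp x) (h2 : ∫ z in ball3 r, g z ^ 2 ≤ Q * Real.exp y) :
    ∫ z in ball3 r, |f z| * g z ≤ Q ^ 2 * Real.exp (x / 2 + y / 2) := by
  have h := holder_two r (hf.pow 2) (hg.pow 2) (fun z => sq_nonneg _) (fun z => sq_nonneg _)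
    (p := 1 / 2) (q := 1 / 2) (by norm_num) (by norm_num) (by norm_num)
  have e : ∀ z, (f z ^ 2) ^ ((1 : ℝ) / 2) * (g z ^ 2) ^ ((1 : ℝ) / 2) = |f z| * g z := fun z => by
    rw [← Real.sqrt_eq_rpow, ← Real.sqrt_eq_rpow, Real.sqrt_sq_eq_abs, Real.sqrt_sq (hg0 z)]
  simp only [Pi.pow_apply, e] at h
  have i1 := rpow_le_mul_exp (p := 1 / 2) (integral_nonneg fun z => sq_nonneg (f z)) hQ
    (by norm_num) (by norm_num) h1
  have i2 := rpow_le_mul_exp (p := 1 / 2) (integral_nonneg fun z => sq_nonneg (g z)) hQ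
    (by norm_num) (by norm_num) h2
  refine h.trans ((mul_le_mul i1 i2 (Real.rpow_nonneg (integral_nonneg fun z => sq_nonneg (g z)) _)
    (by positivity)).trans_eq ?_)
  rw [Real.exp_add, show x * (1 / 2) = x / 2 by ring, show y * (1 / 2) = y / 2 by ring]
  ring

lemma rpow_pow_inv_self {a : ℝ} (ha : 0 ≤ a) {n : ℕ} (p : ℝ) : (a ^ n) ^ p = a ^ (n * p) := by
  rw [← Real.rpow_natCast, ← Real.rpow_mul ha]

lemma integral_mul_mul_le_mul_exp (hQ : 1 ≤ Q) (hf : Continuous f) (hm : Continuous m)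
    (hg : Continuous g) (hm0 : ∀ x, 0 ≤ m x) (hg0 : ∀ x, 0 ≤ g x) {x y z : ℝ}
    (h1 : ∫ t in ball3 r, |f t| ^ 3 ≤ Q * Real.exp x)
    (h2 : ∫ t in ball3 r, m t ^ 6 ≤ Q * Real.exp y)
    (h3 : ∫ t in ball3 r, g t ^ 2 ≤ Q * Real.exp z) :
    ∫ t in ball3 r, |f t| * m t * g t ≤ Q ^ 3 * Real.exp (x / 3 + y / 6 + z / 2) := by
  have n1 : ∀ t, 0 ≤ |f t| ^ 3 := fun t => by positivity
  have n2 : ∀ t, 0 ≤ m t ^ 6 := fun t => pow_nonneg (hm0 t) 6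
  have n3 : ∀ t, 0 ≤ g t ^ 2 := fun t => sq_nonneg _
  have h := holder_three r (hf.abs.pow 3) (hm.pow 6) (hg.pow 2) n1 n2 n3
    (p := 1 / 3) (q := 1 / 6) (t := 1 / 2) (by norm_num) (by norm_num) (by norm_num) (by norm_num)
  have e : ∀ t, (|f t| ^ 3) ^ ((1 : ℝ) / 3) * (m t ^ 6) ^ ((1 : ℝ) / 6) * (g t ^ 2) ^ ((1 : ℝ) / 2)
      = |f t| * m t * g t := fun t => by
    rw [rpow_pow_inv_self (abs_nonneg _), rpow_pow_inv_self (hm0 t), rpow_pow_inv_self (hg0 t)]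
    norm_num
  simp only [Pi.pow_apply, e] at h
  have i1 := rpow_le_mul_exp (p := 1 / 3) (integral_nonneg n1) hQ (by norm_num) (by norm_num) h1
  have i2 := rpow_le_mul_exp (p := 1 / 6) (integral_nonneg n2) hQ (by norm_num) (by norm_num) h2
  have i3 := rpow_le_mul_exp (p := 1 / 2) (integral_nonneg n3) hQ (by norm_num) (by norm_num) h3
  refine h.trans ((mul_le_mul (mul_le_mul i1 i2 (Real.rpow_nonneg (integral_nonneg n2) _)
    (by positivity)) i3 (Real.rpow_nonneg (integral_nonneg n3) _) (by positivity)).trans_eq ?_)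
  rw [Real.exp_add, Real.exp_add, show x * (1 / 3) = x / 3 by ring,
    show y * (1 / 6) = y / 6 by ring, show z * (1 / 2) = z / 2 by ring]
  ring

lemma integral_mul_le_mul_exp_of_volume (hQ : 1 ≤ Q) (hm : Continuous m) (hg : Continuous g)
    (hm0 : ∀ x, 0 ≤ m x) (hg0 : ∀ x, 0 ≤ g x) {x y z : ℝ}
    (h1 : ∫ t in ball3 r, m t ^ 3 ≤ Q * Real.exp x)
    (h2 : ∫ t in ball3 r, g t ^ 2 ≤ Q * Real.exp y)
    (h3 : volume.real (ball3 r) ≤ Q * Real.exp z) :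
    ∫ t in ball3 r, m t * g t ≤ Q ^ 3 * Real.exp (x / 3 + y / 2 + z / 6) := by
  have n1 : ∀ t, 0 ≤ m t ^ 3 := fun t => pow_nonneg (hm0 t) 3
  have n2 : ∀ t, 0 ≤ g t ^ 2 := fun t => sq_nonneg _
  have h := holder_three r (hm.pow 3) (hg.pow 2) (continuous_const (y := (1 : ℝ))) n1 n2
    (fun _ => zero_le_one)
    (p := 1 / 3) (q := 1 / 2) (t := 1 / 6) (by norm_num) (by norm_num) (by norm_num) (by norm_num)
  have e : ∀ t, (m t ^ 3) ^ ((1 : ℝ) / 3) * (g t ^ 2) ^ ((1 : ℝ) / 2) * (1 : ℝ) ^ ((1 : ℝ) / 6)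
      = m t * g t := fun t => by
    rw [rpow_pow_inv_self (hm0 t), rpow_pow_inv_self (hg0 t)]
    norm_num
  simp only [Pi.pow_apply, e] at h
  rw [setIntegral_const, smul_eq_mul, mul_one] at h
  have i1 := rpow_le_mul_exp (p := 1 / 3) (integral_nonneg n1) hQ (by norm_num) (by norm_num) h1
  have i2 := rpow_le_mul_exp (p := 1 / 2) (integral_nonneg n2) hQ (by norm_num) (by norm_num) h2
  have i3 := rpow_le_mul_exp (p := 1 / 6) measureReal_nonneg hQ (by norm_num) (by norm_num) h3
  refine h.trans ((mul_le_mul (mul_le_mul i1 i2 (Real.rpow_nonneg (integral_nonneg n2) _)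
    (by positivity)) i3 (Real.rpow_nonneg measureReal_nonneg _) (by positivity)).trans_eq ?_)
  rw [Real.exp_add, Real.exp_add, show x * (1 / 3) = x / 3 by ring,
    show z * (1 / 6) = z / 6 by ring, show y * (1 / 2) = y / 2 by ring]
  ring

lemma integral_mul_mul_le_mul_exp_interpolated {s : ℝ} (hs3 : 3 < s) (hs6 : s ≤ 6)
    (hQ : 1 ≤ Q) (hf : Continuous f) (hm : Continuous m)
    (hg : Continuous g) (hm0 : ∀ x, 0 ≤ m x) (hg0 : ∀ x, 0 ≤ g x) {x y z v : ℝ}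
    (h1 : ∫ t in ball3 r, |f t| ^ s ≤ Q * Real.exp x)
    (h2 : ∫ t in ball3 r, g t ^ 2 ≤ Q * Real.exp y)
    (h3 : ∫ t in ball3 r, m t ^ 3 ≤ Q * Real.exp z)
    (h4 : ∫ t in ball3 r, m t ^ 6 ≤ Q * Real.exp v) :
    ∫ t in ball3 r, |f t| * m t * g t ≤
      Q ^ 4 * Real.exp (x * (1 / s) + y / 2 + z * (2 / 3 - 2 / s) + v * (1 / s - 1 / 6)) := by
  have hs0 : 0 < s := by linarith
  have h6 : 1 / 6 ≤ 1 / s := one_div_le_one_div_of_le hs0 hs6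
  have h3' : 1 / s ≤ 1 / 3 := one_div_le_one_div_of_le (by norm_num) hs3.le
  have h2s : 2 / s = 2 * (1 / s) := by ring
  have n1 : ∀ t, 0 ≤ |f t| ^ s := fun t => by positivity
  have n2 : ∀ t, 0 ≤ g t ^ 2 := fun t => sq_nonneg _
  have n3 : ∀ t, 0 ≤ m t ^ 3 := fun t => pow_nonneg (hm0 t) 3
  have n4 : ∀ t, 0 ≤ m t ^ 6 := fun t => pow_nonneg (hm0 t) 6
  have h := holder_four r (continuous_abs_rpow hf hs0.le) (hg.pow 2) (hm.pow 3) (hm.pow 6) n1 n2 n3 n4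
    (p := 1 / s) (q := 1 / 2) (t := 2 / 3 - 2 / s) (v := 1 / s - 1 / 6) (by positivity)
    (by norm_num) (by linarith) (by linarith) (by linarith)
  have e : ∀ t, (|f t| ^ s) ^ ((1 : ℝ) / s) * (g t ^ 2) ^ ((1 : ℝ) / 2) *
      (m t ^ 3) ^ (2 / 3 - 2 / s) * (m t ^ 6) ^ (1 / s - 1 / 6)
      = |f t| * m t * g t := fun t => by
    rw [rpow_pow_inv_self (hm0 t), rpow_pow_inv_self (hm0 t), rpow_pow_inv_self (hg0 t),
      ← Real.rpow_mul (abs_nonneg _), mul_one_div_cancel hs0.ne', mul_assoc,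
      ← Real.rpow_add_of_nonneg (hm0 t) (by push_cast; linarith) (by push_cast; linarith)]
    have : ((3 : ℕ) : ℝ) * (2 / 3 - 2 / s) + ((6 : ℕ) : ℝ) * (1 / s - 1 / 6) = 1 := by
      push_cast; ring
    rw [this]
    norm_num
    ring
  simp only [Pi.pow_apply, e] at h
  have i1 := rpow_le_mul_exp (p := 1 / s) (integral_nonneg n1) hQ (by positivity) (by linarith) h1
  have i2 := rpow_le_mul_exp (p := 1 / 2) (integral_nonneg n2) hQ (by norm_num) (by norm_num) h2
  have i3 := rpow_le_mul_exp (p := 2 / 3 - 2 / s) (integral_nonneg n3) hQ (by linarith)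
    (by linarith) h3
  have i4 := rpow_le_mul_exp (p := 1 / s - 1 / 6) (integral_nonneg n4) hQ (by linarith)
    (by linarith) h4
  refine h.trans ((mul_le_mul (mul_le_mul (mul_le_mul i1 i2
    (Real.rpow_nonneg (integral_nonneg n2) _) (by positivity)) i3
    (Real.rpow_nonneg (integral_nonneg n3) _) (by positivity)) i4
    (Real.rpow_nonneg (integral_nonneg n4) _) (by positivity)).trans_eq ?_)
  rw [Real.exp_add, Real.exp_add, Real.exp_add, show y * (1 / 2) = y / 2 by ring]
  ring

end ErrorTerms

section ErrorIntegral

lemma integral_ball3_error_le {r G : ℝ} {m g : E3 → ℝ} (hm : Continuous m) (hg : Continuous g)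
    (hm0 : ∀ x, 0 ≤ m x) (hg0 : ∀ x, 0 ≤ g x) {ξ₁ ξ₂ : Fin 3 → E3 → ℝ}
    (c1 : ∀ j, ContDiff ℝ 1 (ξ₁ j)) (c2 : ∀ j, ContDiff ℝ 1 (ξ₂ j)) :
    ∫ x in ball3 r, (G * m x * g x + G * m x ^ 3
        + (∑ j, |ξ₁ j x + ξ₂ j x|) * m x * g x
        + (∑ i, ∑ j, |pd i (fun y => ξ₁ j y + ξ₂ j y) x|) * g x) ≤
      G * (∫ x in ball3 r, m x * g x) + G * (∫ x in ball3 r, m x ^ 3)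
        + ∑ j, ((∫ x in ball3 r, |ξ₁ j x| * m x * g x) + ∫ x in ball3 r, |ξ₂ j x| * m x * g x)
        + ∑ i, ∑ j, ((∫ x in ball3 r, |pd i (ξ₁ j) x| * g x) +
          ∫ x in ball3 r, |pd i (ξ₂ j) x| * g x) := by
  have k1 := fun j => (c1 j).continuous
  have k2 := fun j => (c2 j).continuous
  have d1 := fun i j => continuous_pd i (c1 j)
  have d2 := fun i j => continuous_pd i (c2 j)
  have hpd : ∀ i j x, pd i (fun y => ξ₁ j y + ξ₂ j y) x = pd i (ξ₁ j) x + pd i (ξ₂ j) x :=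
    fun i j x => pd_add i (c1 j) (c2 j) x
  simp only [hpd]
  refine (integral_ball3_mono (g := fun x => G * (m x * g x) + G * m x ^ 3 +
    ∑ j, (|ξ₁ j x| * m x * g x + |ξ₂ j x| * m x * g x) +
    ∑ i, ∑ j, (|pd i (ξ₁ j) x| * g x + |pd i (ξ₂ j) x| * g x)) (by fun_prop) (by fun_prop)
    fun x => ?_).trans_eq ?_
  · have a1 : (∑ j, |ξ₁ j x + ξ₂ j x|) * m x * g x ≤
        ∑ j, (|ξ₁ j x| * m x * g x + |ξ₂ j x| * m x * g x) := by
      rw [Finset.sum_mul, Finset.sum_mul]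
      refine Finset.sum_le_sum fun j _ => ?_
      rw [← add_mul, ← add_mul]
      have := hm0 x
      have := hg0 x
      gcongr
      exact abs_add_le _ _
    have a2 : (∑ i, ∑ j, |pd i (ξ₁ j) x + pd i (ξ₂ j) x|) * g x ≤
        ∑ i, ∑ j, (|pd i (ξ₁ j) x| * g x + |pd i (ξ₂ j) x| * g x) := by
      rw [Finset.sum_mul]
      refine Finset.sum_le_sum fun i _ => ?_
      rw [Finset.sum_mul]
      refine Finset.sum_le_sum fun j _ => ?_
      rw [← add_mul]
      have := hg0 x
      gcongr
      exact abs_add_le _ _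
    linarith [mul_assoc G (m x) (g x)]
  · have I : ∀ {h : E3 → ℝ}, Continuous h → IntegrableOn h (ball3 r) := fun hh =>
      integrableOn_ball3 hh r
    rw [integral_add (I (by fun_prop)) (I (by fun_prop)),
      integral_add (I (by fun_prop)) (I (by fun_prop)),
      integral_add (I (by fun_prop)) (I (by fun_prop)), integral_const_mul, integral_const_mul,
      integral_finsetSum _ fun j _ => I (by fun_prop),
      integral_finsetSum _ fun i _ => I (by fun_prop)]
    congr 1
    · congr 1
      exact Finset.sum_congr rfl fun j _ => integral_add (I (by fun_prop)) (I (by fun_prop))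
    · refine Finset.sum_congr rfl fun i _ => ?_
      rw [integral_finsetSum _ fun j _ => I (by fun_prop)]
      exact Finset.sum_congr rfl fun j _ => integral_add (I (by fun_prop)) (I (by fun_prop))

lemma integral_ball3_error_le_exp {s : ℝ} (hs3 : 3 < s) (hs6 : s ≤ 6) {a k d e q θ r G Q : ℝ}
    (ha : 0 ≤ a) (hk : 0 ≤ k) (hd : 0 ≤ d) (hq : 0 ≤ q)
    (hθ1 : 3 / (s + 6) + 1 / 2 ≤ θ) (hθ2 : 9 / (s + 6) ≤ θ) (hQ : 1 ≤ Q)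
    (he : e ≤ q + 2 * k + (5 / 6 - 1 / s) * a - d / 2)
    (he' : Real.exp (-e) ≤ Real.exp (-(q + 2 * k + (5 / 6 - 1 / s) * a - d / 2)) +
      8 * Real.exp (k - a))
    {m g : E3 → ℝ} (hm : Continuous m) (hg : Continuous g)
    (hm0 : ∀ x, 0 ≤ m x) (hg0 : ∀ x, 0 ≤ g x) {ξ₁ ξ₂ : Fin 3 → E3 → ℝ}
    (c1 : ∀ j, ContDiff ℝ 1 (ξ₁ j)) (c2 : ∀ j, ContDiff ℝ 1 (ξ₂ j))
    (hG : G ≤ Q * Real.exp (k - a))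
    (hM3 : ∫ x in ball3 r, m x ^ 3 ≤ Q * Real.exp (3 * k + a + 9 / (s + 6) * d))
    (hM6 : ∫ x in ball3 r, m x ^ 6 ≤ Q * Real.exp (12 * k + 3 * d))
    (hG2 : ∫ x in ball3 r, g x ^ 2 ≤ Q * Real.exp d)
    (hV : volume.real (ball3 r) ≤ Q * Real.exp (3 * a))
    (hX1 : ∀ j, ∫ x in ball3 r, |ξ₁ j x| ^ 3 ≤
      Q * Real.exp (3 * (e + k - a) + (3 * k + a + 9 / (s + 6) * d)))
    (hY1 : ∀ i j, ∫ x in ball3 r, pd i (ξ₁ j) x ^ 2 ≤ Q * Real.exp (2 * e + 6 * k - 2 * a + d))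
    (hX2 : ∀ j, ∫ x in ball3 r, |ξ₂ j x| ^ s ≤
      Q * Real.exp ((2 * k - a) * s + (2 + s / 3) * a))
    (hY2 : ∀ i j, ∫ x in ball3 r, pd i (ξ₂ j) x ^ 2 ≤
      Q * Real.exp (-2 * e + 2 * (2 * k - a) + (11 / 3 - 2 / s) * a)) :
    ∫ x in ball3 r, (G * m x * g x + G * m x ^ 3
        + (∑ j, |ξ₁ j x + ξ₂ j x|) * m x * g x
        + (∑ i, ∑ j, |pd i (fun y => ξ₁ j y + ξ₂ j y) x|) * g x) ≤
      200 * Q ^ 4 * (Real.exp (d - q) + Real.exp (q + 8 * k + θ * d)) := by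
  have hs0 : 0 < s := by linarith
  obtain ⟨σ, hσ⟩ : ∃ σ, σ = 1 / s := ⟨_, rfl⟩
  obtain ⟨β, hβ⟩ : ∃ β, β = 3 / (s + 6) := ⟨_, rfl⟩
  have h6 : 1 / 6 ≤ σ := by rw [hσ]; exact one_div_le_one_div_of_le hs0 hs6
  have h3 : σ ≤ 1 / 3 := by rw [hσ]; exact one_div_le_one_div_of_le (by norm_num) hs3.le
  have h2σ : 2 / s = 2 * σ := by rw [hσ]; ring
  have h9β : 9 / (s + 6) = 3 * β := by rw [hβ]; ring
  have hβσ : β * (1 + 6 * σ) = 3 * σ := by rw [hσ, hβ]; field_simp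
  have hsσ : s * σ = 1 := by rw [hσ]; field_simp
  rw [← hσ] at he he'
  rw [h9β] at hM3 hX1 hθ2
  rw [← hβ] at hθ1
  rw [h2σ] at hY2
  have hθ0 : 1 / 2 ≤ θ := by
    have : 0 ≤ β := by rw [hβ]; positivity
    linarith
  have Q0 : 0 ≤ Q := by linarith
  set T := Real.exp (q + 8 * k + θ * d) with hT
  have hT0 : 0 ≤ T := (Real.exp_pos _).le
  have σa : 0 ≤ (σ - 1 / 6) * a := mul_nonneg (by linarith) ha
  have σa' : 0 ≤ σ * a := mul_nonneg (by linarith) ha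
  have θd : 1 / 2 * d ≤ θ * d := mul_le_mul_of_nonneg_right hθ0 hd
  have θd1 : (β + 1 / 2) * d ≤ θ * d := mul_le_mul_of_nonneg_right hθ1 hd
  have θd2 : 3 * β * d ≤ θ * d := mul_le_mul_of_nonneg_right hθ2 hd
  have mono : ∀ {n : ℕ} {x : ℝ}, n ≤ 4 → x ≤ q + 8 * k + θ * d → Q ^ n * Real.exp x ≤ Q ^ 4 * T :=
    fun hn hx => mul_le_mul (pow_le_pow_right₀ hQ hn) (Real.exp_le_exp.2 hx) (Real.exp_pos _).le
      (by positivity)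
  have I0 : ∀ h : E3 → ℝ, (∀ x, 0 ≤ h x) → 0 ≤ ∫ x in ball3 r, h x := fun h hh => integral_nonneg hh
  have t1 : G * (∫ x in ball3 r, m x * g x) ≤ Q ^ 4 * T := by
    have h := integral_mul_le_mul_exp_of_volume hQ hm hg hm0 hg0 hM3 hG2 hV
    refine (mul_le_mul hG h (I0 _ fun x => mul_nonneg (hm0 x) (hg0 x)) (by positivity)).trans ?_
    rw [show ∀ A B : ℝ, Q * A * (Q ^ 3 * B) = Q ^ 4 * (A * B) by intros; ring, ← Real.exp_add]
    exact mono le_rfl (by linarith)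
  have t2 : G * (∫ x in ball3 r, m x ^ 3) ≤ Q ^ 4 * T := by
    refine (mul_le_mul hG hM3 (I0 _ fun x => pow_nonneg (hm0 x) 3) (by positivity)).trans ?_
    rw [show ∀ A B : ℝ, Q * A * (Q * B) = Q ^ 2 * (A * B) by intros; ring, ← Real.exp_add]
    exact mono (by norm_num) (by linarith)
  have t3 : ∀ j, ∫ x in ball3 r, |ξ₁ j x| * m x * g x ≤ Q ^ 4 * T := fun j =>
    (integral_mul_mul_le_mul_exp hQ (c1 j).continuous hm hg hm0 hg0 (hX1 j) hM6 hG2).trans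
      (mono (by norm_num) (by linarith))
  have t4 : ∀ j, ∫ x in ball3 r, |ξ₂ j x| * m x * g x ≤ Q ^ 4 * T := fun j => by
    refine (integral_mul_mul_le_mul_exp_interpolated hs3 hs6 hQ (c2 j).continuous hm hg hm0 hg0
      (hX2 j) hG2 hM3 hM6).trans (mono le_rfl ?_)
    rw [h2σ, ← hσ]
    have e1 : ((2 * k - a) * s + (2 + s / 3) * a) * σ = 2 * k - a + 2 * σ * a + a / 3 := by
      linear_combination (2 * k - a + a / 3) * hsσ
    have e2 : d / 2 + 3 * β * d * (2 / 3 - 2 * σ) + 3 * d * (σ - 1 / 6) = 3 * β * d := by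
      linear_combination (-d) * hβσ
    have e3 : σ * k ≤ 1 / 3 * k := mul_le_mul_of_nonneg_right h3 hk
    nlinarith
  have t5 : ∀ i j, ∫ x in ball3 r, |pd i (ξ₁ j) x| * g x ≤ Q ^ 4 * T := fun i j =>
    (integral_mul_le_mul_exp hQ (continuous_pd i (c1 j)) hg hg0 (hY1 i j) hG2).trans
      (mono (by norm_num) (by linarith))
  have t6 : ∀ i j, ∫ x in ball3 r, |pd i (ξ₂ j) x| * g x ≤
      Q ^ 4 * (Real.exp (d - q) + 8 * T) := fun i j => by
    refine (integral_mul_le_mul_exp hQ (continuous_pd i (c2 j)) hg hg0 (hY2 i j) hG2).trans ?_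
    have e1 : (-2 * e + 2 * (2 * k - a) + (11 / 3 - 2 * σ) * a) / 2 + d / 2 =
        -e + (2 * k + (5 / 6 - σ) * a + d / 2) := by ring
    rw [e1, Real.exp_add]
    refine mul_le_mul (pow_le_pow_right₀ hQ (by norm_num)) ?_ (by positivity) (by positivity)
    refine (mul_le_mul_of_nonneg_right he' (Real.exp_pos _).le).trans ?_
    rw [add_mul, mul_assoc, ← Real.exp_add, ← Real.exp_add]
    gcongr
    · linarith
    · exact Real.exp_le_exp.2 (by linarith)
  refine (integral_ball3_error_le hm hg hm0 hg0 c1 c2).trans ?_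
  have s1 : ∑ j, ((∫ x in ball3 r, |ξ₁ j x| * m x * g x) + ∫ x in ball3 r, |ξ₂ j x| * m x * g x) ≤
      ∑ _j : Fin 3, (Q ^ 4 * T + Q ^ 4 * T) :=
    Finset.sum_le_sum fun j _ => add_le_add (t3 j) (t4 j)
  have s2 : ∑ i, ∑ j, ((∫ x in ball3 r, |pd i (ξ₁ j) x| * g x) +
      ∫ x in ball3 r, |pd i (ξ₂ j) x| * g x) ≤
      ∑ _i : Fin 3, ∑ _j : Fin 3, (Q ^ 4 * T + Q ^ 4 * (Real.exp (d - q) + 8 * T)) :=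
    Finset.sum_le_sum fun i _ => Finset.sum_le_sum fun j _ => add_le_add (t5 i j) (t6 i j)
  simp only [Finset.sum_const, Finset.card_univ, Fintype.card_fin, nsmul_eq_mul] at s1 s2
  push_cast at s1 s2
  have p1 : 0 ≤ Q ^ 4 * T := by positivity
  have p2 : 0 ≤ Q ^ 4 * Real.exp (d - q) := by positivity
  linarith

end ErrorIntegral

section PotentialBound

/-- `v` is the divergence of a matrix field whose `L^s` norm on the ball of radius `2 * R` is
controlled at the growth rate of the hypothesis. -/
def HasPotentialBound (s N R : ℝ) (v : E3 → E3) : Prop :=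
  ∃ A : Fin 3 → Fin 3 → E3 → ℝ, (∀ i j, ContDiff ℝ 1 (A i j)) ∧
    (∀ j x, ∑ i, pd i (A i j) x = v x j) ∧
    ∀ i j, ∫ x in ball3 (2 * R), |A i j x| ^ s ≤ N * R ^ (2 + s / 3)

lemma abs_le_frob (A : Fin 3 → Fin 3 → ℝ) (i j : Fin 3) : |A i j| ≤ frob A := by
  refine Real.abs_le_sqrt ?_
  exact (Finset.single_le_sum (f := fun j => A i j ^ 2) (fun _ _ => sq_nonneg _)
    (Finset.mem_univ j)).trans (Finset.single_le_sum (f := fun i => ∑ j, A i j ^ 2)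
      (fun _ _ => by positivity) (Finset.mem_univ i))

lemma meanOsc_nonneg (Φ : E3 → Fin 3 → Fin 3 → ℝ) (s r : ℝ) : 0 ≤ meanOsc Φ s r :=
  Real.rpow_nonneg (mul_nonneg (by positivity)
    (integral_nonneg fun _ => Real.rpow_nonneg (Real.sqrt_nonneg _) _)) _

lemma exists_hasPotentialBound {s : ℝ} (hs : 0 < s) {C₀ : ℝ} (hC₀ : 0 < C₀) :
    ∃ N : ℝ, 0 < N ∧ ∀ (R : ℝ) (v : E3 → E3) (Φ : E3 → Fin 3 → Fin 3 → ℝ), 1 ≤ R →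
    (∀ i j, ContDiff ℝ (⊤ : ℕ∞) fun x => Φ x i j) → (∀ x j, mdiv Φ x j = v x j) →
    meanOsc Φ s (2 * R) ≤ C₀ * (2 * R) ^ ((1 : ℝ) / 3 - 1 / s) → HasPotentialBound s N R v := by
  obtain ⟨c, hc, hvol⟩ := exists_volume_ball3_le
  have hc0 : 0 < c := by linarith
  refine ⟨c * C₀ ^ s * 2 ^ (s / 3 - 1), by positivity, ?_⟩
  intro R v Φ hR hΦ hdiv hosc
  have hR0 : 0 < R := by linarith
  have hΦ1 := fun i j => (hΦ i j).smooth_one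
  refine ⟨fun i j x => Φ x i j - mavg Φ (2 * R) i j, fun i j => (hΦ1 i j).sub contDiff_const,
    fun j x => ?_, fun i j => ?_⟩
  · rw [← hdiv x j, mdiv]
    exact Finset.sum_congr rfl fun i _ => pd_sub_const i _ _
  · set F : E3 → ℝ := fun x => frob fun i j => Φ x i j - mavg Φ (2 * R) i j with hF
    have hF0 : ∀ x, 0 ≤ F x := fun x => Real.sqrt_nonneg _
    have hc' := fun i j => (hΦ1 i j).continuous
    have hFc : Continuous F := by
      simp only [hF, frob]
      fun_prop
    have hFs : Continuous fun x => F x ^ s := hFc.rpow_const fun _ => Or.inr hs.le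
    have hV0 : 0 < volume.real (ball3 (2 * R)) :=
      ENNReal.toReal_pos (measure_ball_pos _ _ (by positivity)).ne' measure_ball_lt_top.ne
    have h1 : ∫ x in ball3 (2 * R), |Φ x i j - mavg Φ (2 * R) i j| ^ s ≤
        ∫ x in ball3 (2 * R), F x ^ s :=
      integral_ball3_mono (continuous_abs_rpow (by fun_prop) hs.le) hFs fun x =>
        Real.rpow_le_rpow (abs_nonneg _)
          (abs_le_frob (fun i j => Φ x i j - mavg Φ (2 * R) i j) i j) hs.le
    have hX0 : 0 ≤ (volume.real (ball3 (2 * R)))⁻¹ * ∫ x in ball3 (2 * R), F x ^ s :=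
      mul_nonneg (by positivity) (integral_nonneg fun x => Real.rpow_nonneg (hF0 x) s)
    have h2 : (volume.real (ball3 (2 * R)))⁻¹ * ∫ x in ball3 (2 * R), F x ^ s ≤
        (C₀ * (2 * R) ^ ((1 : ℝ) / 3 - 1 / s)) ^ s := by
      have h := Real.rpow_le_rpow (meanOsc_nonneg Φ s (2 * R)) hosc hs.le
      rwa [show meanOsc Φ s (2 * R) = ((volume.real (ball3 (2 * R)))⁻¹ *
        ∫ x in ball3 (2 * R), F x ^ s) ^ (1 / s) from rfl, ← Real.rpow_mul hX0,
        one_div_mul_cancel hs.ne', Real.rpow_one] at h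
    rw [inv_mul_le_iff₀ hV0] at h2
    refine h1.trans (h2.trans ?_)
    calc volume.real (ball3 (2 * R)) * (C₀ * (2 * R) ^ ((1 : ℝ) / 3 - 1 / s)) ^ s
        ≤ c * R ^ 3 * (C₀ * (2 * R) ^ ((1 : ℝ) / 3 - 1 / s)) ^ s := by
          gcongr
          exact hvol R hR0.le
      _ = c * C₀ ^ s * 2 ^ (s / 3 - 1) * R ^ (2 + s / 3) := by
          rw [Real.mul_rpow hC₀.le (by positivity), ← Real.rpow_mul (by positivity),
            show ((1 : ℝ) / 3 - 1 / s) * s = s / 3 - 1 by field_simp,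
            Real.mul_rpow (by norm_num) hR0.le,
            show 2 + s / 3 = ((3 : ℕ) : ℝ) + (s / 3 - 1) by push_cast; ring,
            Real.rpow_add hR0, Real.rpow_natCast]
          ring

variable {u w b : E3 → E3}

lemma continuous_gradSq {v : E3 → E3} (hv : ContDiff ℝ (⊤ : ℕ∞) v) : Continuous (gradSq v) := by
  have : ∀ i j, Continuous fun x => pd i (fun y => v y j) x := fun i j =>
    continuous_pd i (contDiff_component hv j).smooth_one
  unfold gradSq
  fun_prop

lemma sum_three_pow_le (n : ℕ) {f : Fin 3 → ℝ} (hf : ∀ j, 0 ≤ f j) :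
    (∑ j, f j) ^ (n + 1) ≤ 3 ^ n * ∑ j, f j ^ (n + 1) := by
  have h := pow_sum_div_card_le_sum_pow (s := (Finset.univ : Finset (Fin 3))) (f := f)
    (fun j _ => hf j) n
  rw [div_le_iff₀ (by simp)] at h
  simpa [mul_comm] using h

lemma fieldSize_pow_le (n : ℕ) (x : E3) : fieldSize u w b x ^ (n + 1) ≤
    3 ^ n * ∑ j, 3 ^ n * (|u x j| ^ (n + 1) + |b x j| ^ (n + 1) + |w x j| ^ (n + 1)) := by
  refine (sum_three_pow_le n fun j => by positivity).trans ?_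
  gcongr with j
  have h := sum_three_pow_le n (f := ![|u x j|, |b x j|, |w x j|])
    (by intro k; fin_cases k <;> simp)
  simpa [Fin.sum_univ_three] using h

lemma integral_fieldSize_pow_le (hu : ContDiff ℝ (⊤ : ℕ∞) u) (hw : ContDiff ℝ (⊤ : ℕ∞) w)
    (hb : ContDiff ℝ (⊤ : ℕ∞) b) (n : ℕ) {r X : ℝ}
    (h1 : ∀ j, ∫ x in ball3 r, |u x j| ^ (n + 1) ≤ X)
    (h2 : ∀ j, ∫ x in ball3 r, |b x j| ^ (n + 1) ≤ X)
    (h3 : ∀ j, ∫ x in ball3 r, |w x j| ^ (n + 1) ≤ X) :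
    ∫ x in ball3 r, fieldSize u w b x ^ (n + 1) ≤ 9 ^ (n + 1) * X := by
  have cu := fun j => (contDiff_component hu j).continuous
  have cb := fun j => (contDiff_component hb j).continuous
  have cw := fun j => (contDiff_component hw j).continuous
  have I : ∀ {h : E3 → ℝ}, Continuous h → IntegrableOn h (ball3 r) := fun hh =>
    integrableOn_ball3 hh r
  refine (integral_ball3_mono ((continuous_fieldSize hu hb hw).pow _) (by fun_prop)
    (fieldSize_pow_le n)).trans ?_
  rw [integral_const_mul, integral_finsetSum _ fun j _ => I (by fun_prop)]
  have h : ∀ j, ∫ x in ball3 r, 3 ^ n *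
      (|u x j| ^ (n + 1) + |b x j| ^ (n + 1) + |w x j| ^ (n + 1)) ≤ 3 ^ n * (X + X + X) := fun j => by
    rw [integral_const_mul, integral_add (I (by fun_prop)) (I (by fun_prop)),
      integral_add (I (by fun_prop)) (I (by fun_prop))]
    gcongr
    exacts [h1 j, h2 j, h3 j]
  calc (3 : ℝ) ^ n * ∑ j, ∫ x in ball3 r, 3 ^ n *
        (|u x j| ^ (n + 1) + |b x j| ^ (n + 1) + |w x j| ^ (n + 1))
      ≤ 3 ^ n * ∑ _j : Fin 3, 3 ^ n * (X + X + X) := by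
        gcongr with j
        exact h j
    _ = 9 ^ (n + 1) * X := by
        simp only [Finset.sum_const, Finset.card_univ, Fintype.card_fin, nsmul_eq_mul]
        rw [show (9 : ℝ) = 3 * 3 by norm_num, mul_pow]
        push_cast
        ring

/-- The right-hand energy used to absorb the error terms. -/
def energyBound (u w b : E3 → E3) (r : ℝ) : ℝ :=
  1 + 100 * ∫ x in ball3 r, energyDensity u w b x

lemma one_le_energyBound (r : ℝ) : 1 ≤ energyBound u w b r := by
  have : 0 ≤ ∫ x in ball3 r, energyDensity u w b x := integral_nonneg energyDensity_nonneg
  unfold energyBound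
  linarith

lemma sum_sq_pd_le_gradSq (v : E3 → E3) (x : E3) (j : Fin 3) :
    ∑ i, pd i (fun y => v y j) x ^ 2 ≤ gradSq v x :=
  Finset.single_le_sum (f := fun j => ∑ i, pd i (fun y => v y j) x ^ 2)
    (fun _ _ => by positivity) (Finset.mem_univ j)

lemma gradSq_nonneg (v : E3 → E3) (x : E3) : 0 ≤ gradSq v x := by
  unfold gradSq; positivity

lemma exists_integral_fieldSize_le {s : ℝ} (hs3 : 3 < s) (hs6 : s ≤ 6) {N : ℝ} (hN : 0 < N) :
    ∃ C : ℝ, 0 < C ∧ ∀ (u w b : E3 → E3) (R ρ τ : ℝ), ContDiff ℝ (⊤ : ℕ∞) u →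
    ContDiff ℝ (⊤ : ℕ∞) w → ContDiff ℝ (⊤ : ℕ∞) b → 1 ≤ R → 0 < τ → τ ≤ R → 0 < ρ →
    ρ + τ ≤ 2 * R → HasPotentialBound s N R u → HasPotentialBound s N R w →
    HasPotentialBound s N R b →
    (∫ x in ball3 (ρ + τ / 2), fieldSize u w b x ^ 3) ≤
      C * ((R / τ) ^ 3 * R * energyBound u w b (ρ + τ) ^ (9 / (s + 6))) ∧
    (∫ x in ball3 (ρ + τ / 2), fieldSize u w b x ^ 6) ≤
      C * ((R / τ) ^ 12 * energyBound u w b (ρ + τ) ^ 3) := by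
  obtain ⟨C, hC, hcub⟩ := exists_cubic_bound hs3 hs6 hN
  refine ⟨9 ^ 6 * C, by positivity, ?_⟩
  intro u w b R ρ τ hu hw hb hR hτ hτR hρ hρτ pu pw pb
  have hR0 : 0 < R := by linarith
  set D := energyBound u w b (ρ + τ) with hD
  have hD1 : 1 ≤ D := one_le_energyBound _
  have hD0 : 0 < D := by linarith
  have key : ∀ v : E3 → E3, ContDiff ℝ (⊤ : ℕ∞) v → HasPotentialBound s N R v →
      (∀ x, gradSq v x ≤ energyDensity u w b x) → ∀ j,
      (∫ x in ball3 (ρ + τ / 2), |v x j| ^ 3) ≤ C * ((R / τ) ^ 3 * R * D ^ (9 / (s + 6))) ∧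
      (∫ x in ball3 (ρ + τ / 2), |v x j| ^ 6) ≤ C * ((R / τ) ^ 12 * D ^ 3) := by
    rintro v hv ⟨A, hA, hdiv, hAs⟩ hle j
    refine hcub R ρ τ D (fun x => v x j) (fun i => A i j) hR hτ hτR hρ hρτ hD1
      (contDiff_component hv j).smooth_one (fun i => hA i j) (hdiv j) (fun i => hAs i j) ?_
    have cp := fun i => continuous_pd i (contDiff_component hv j).smooth_one
    have ce := continuous_energyDensity hu hb hw
    have h := integral_ball3_mono (r := ρ + τ) (f := fun x => ∑ i, pd i (fun y => v y j) x ^ 2)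
      (by fun_prop) ce fun x => (sum_sq_pd_le_gradSq v x j).trans (hle x)
    have h0 : 0 ≤ ∫ x in ball3 (ρ + τ), energyDensity u w b x := integral_nonneg energyDensity_nonneg
    refine h.trans ?_
    rw [hD, energyBound]
    linarith
  have hw2 : ∀ x, 0 ≤ ∑ j, w x j ^ 2 := fun x => by positivity
  have ku := key u hu pu fun x => by
    unfold energyDensity; linarith [gradSq_nonneg b x, gradSq_nonneg w x, hw2 x]
  have kb := key b hb pb fun x => by
    unfold energyDensity; linarith [gradSq_nonneg u x, gradSq_nonneg w x, hw2 x]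
  have kw := key w hw pw fun x => by
    unfold energyDensity; linarith [gradSq_nonneg b x, gradSq_nonneg u x, hw2 x]
  constructor
  · refine (integral_fieldSize_pow_le hu hw hb 2 (fun j => (ku j).1) (fun j => (kb j).1)
      fun j => (kw j).1).trans ?_
    rw [← mul_assoc]
    exact mul_le_mul_of_nonneg_right (by norm_num; linarith) (by positivity)
  · refine (integral_fieldSize_pow_le hu hw hb 5 (fun j => (ku j).2) (fun j => (kb j).2)
      fun j => (kw j).2).trans_eq ?_
    ring

end PotentialBound

section EnergyRecursion

lemma exists_energy_le {s : ℝ} (hs3 : 3 < s) (hs6 : s ≤ 6) {N θ : ℝ} (hN : 0 < N)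
    (hθ1 : 3 / (s + 6) + 1 / 2 ≤ θ) (hθ2 : 9 / (s + 6) ≤ θ) :
    ∃ c : ℝ, 0 < c ∧ ∀ (u w b : E3 → E3) (P : E3 → ℝ) (K R ρ τ : ℝ), IsMMPSolution u w b P →
    1 ≤ K → 1 ≤ R → 0 < τ → τ ≤ R → 0 < ρ → ρ + τ ≤ 2 * R → HasPotentialBound s N R u →
    HasPotentialBound s N R w → HasPotentialBound s N R b →
    (∫ x in ball3 ρ, energyDensity u w b x) ≤
      c * (energyBound u w b (ρ + τ) / K +
        K * (R / τ) ^ 8 * energyBound u w b (ρ + τ) ^ θ) := by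
  obtain ⟨C, hC, hfield⟩ := exists_integral_fieldSize_le hs3 hs6 hN
  obtain ⟨L, hL, htest⟩ := exists_testField (s := s) (by linarith) hN
  obtain ⟨v, hv, hvol⟩ := exists_volume_ball3_le
  obtain ⟨M, hM⟩ : ∃ M, M = C + L + v := ⟨_, rfl⟩
  have hM1 : 1 ≤ M := by linarith
  have hCM : C ≤ M := by linarith
  have hLM : L ≤ M := by linarith
  have hvM : v ≤ M := by linarith
  have hM0 : 0 < M := by linarith
  have hM2 : M ^ 1 ≤ M ^ 3 := pow_le_pow_right₀ hM1 (by norm_num)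
  have hM3 : M ^ 2 ≤ M ^ 3 := pow_le_pow_right₀ hM1 (by norm_num)
  obtain ⟨Q, hQ⟩ : ∃ Q, Q = 2 * M ^ 3 := ⟨_, rfl⟩
  have hMQ : M ≤ Q := by nlinarith
  have hM2Q : M ^ 2 ≤ Q := by nlinarith [sq_nonneg M]
  have hQ1 : 1 ≤ Q := hM1.trans hMQ
  refine ⟨400 * (200 * Q ^ 4), by positivity, ?_⟩
  intro u w b P K R ρ τ hsol hK hR hτ hτR hρ hρτ pu pw pb
  have hR0 : 0 < R := by linarith
  obtain ⟨A, hA, hAdiv, hAs⟩ := id pu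
  have hu := hsol.smooth_u
  have hw := hsol.smooth_w
  have hb := hsol.smooth_b
  obtain ⟨hM3, hM6⟩ := hfield u w b R ρ τ hu hw hb hR hτ hτR hρ hρτ pu pw pb
  have hcm := continuous_fieldSize hu hb hw
  have hcg := continuous_derivSize hu hb hw
  have hce := continuous_energyDensity hu hb hw
  have hm0 := fieldSize_nonneg (u := u) (w := w) (b := b)
  have hg0 := derivSize_nonneg (u := u) (w := w) (b := b)
  have he0 := energyDensity_nonneg (u := u) (w := w) (b := b)
  obtain ⟨η, cη, hη0, hη1, hηs, hηd, htest⟩ := htest R ρ τ A (fun j x => u x j)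
    (fieldSize u w b) (derivSize u w b) hR hτ hτR hρ hρτ hA
    (fun j => (contDiff_component hu j).smooth_one) hAdiv (fun x => hsol.div_u x) hAs hcm hcg
    (fun j x => abs_u_le_fieldSize x j) (fun i j x => by
      have := abs_jac_add_le_derivSize (u := u) (w := w) (b := b) x i j
      have h1 := abs_nonneg (jac b x i j)
      have h2 := abs_nonneg (jac w x i j)
      exact le_trans (by simp only [jac] at *; linarith) this)
  have hG2 : ∫ x in ball3 (ρ + τ / 2), derivSize u w b x ^ 2 ≤ energyBound u w b (ρ + τ) := by
    have h1 := integral_ball3_mono (r := ρ + τ / 2) (hcg.pow 2) (hce.const_mul 100) derivSize_sq_le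
    have h2 := integral_ball3_mono_radius hce he0 (by linarith : ρ + τ / 2 ≤ ρ + τ)
    rw [integral_const_mul] at h1
    simp only [Pi.pow_apply] at h1
    unfold energyBound
    linarith
  have hV : volume.real (ball3 (ρ + τ / 2)) ≤ v * R ^ 3 :=
    (measureReal_mono (ball_subset_ball (by linarith)) measure_ball_lt_top.ne).trans
      (hvol R hR0.le)
  have hD1 : 1 ≤ energyBound u w b (ρ + τ) := one_le_energyBound _
  obtain ⟨D, hD⟩ : ∃ D, D = energyBound u w b (ρ + τ) := ⟨_, rfl⟩
  rw [← hD] at hM3 hM6 hG2 hD1 ⊢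
  obtain ⟨d, hd, rfl⟩ := exists_exp_eq hD1
  obtain ⟨q, hq, rfl⟩ := exists_exp_eq hK
  obtain ⟨k, hk, hκ⟩ := exists_exp_eq ((one_le_div hτ).2 hτR)
  obtain ⟨a, ha, rfl⟩ := exists_exp_eq hR
  have hτe : τ = Real.exp (a - k) := by
    rw [Real.exp_sub, ← hκ]; field_simp
  have hτi : τ⁻¹ = Real.exp (k - a) := by rw [hτe, ← Real.exp_neg]; ring_nf
  rw [hκ] at hM3 hM6 ⊢
  have hM3' : ∫ x in ball3 (ρ + τ / 2), fieldSize u w b x ^ 3 ≤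
      M * Real.exp (3 * k + a + 9 / (s + 6) * d) := by
    refine hM3.trans ?_
    rw [← Real.exp_nat_mul, ← Real.exp_mul, ← Real.exp_add, ← Real.exp_add]
    push_cast
    rw [mul_comm d]
    gcongr
  have hM6' : ∫ x in ball3 (ρ + τ / 2), fieldSize u w b x ^ 6 ≤
      M * Real.exp (12 * k + 3 * d) := by
    refine hM6.trans ?_
    rw [← Real.exp_nat_mul, ← Real.exp_nat_mul, ← Real.exp_add]
    push_cast
    gcongr
  have hV' : volume.real (ball3 (ρ + τ / 2)) ≤ M * Real.exp (3 * a) := by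
    refine hV.trans ?_
    rw [← Real.exp_nat_mul]
    push_cast
    gcongr
  have hM2' : ∫ x in ball3 (ρ + τ / 2), fieldSize u w b x ^ 2 ≤
      M ^ 2 * Real.exp (2 * k + 5 / 3 * a + d) := by
    have h1 := rpow_le_mul_exp (p := 2 / 3)
      (integral_nonneg fun x => pow_nonneg (hm0 x) 3) hM1 (by norm_num) (by norm_num) hM3'
    have h2 := rpow_le_mul_exp (p := 1 / 3) measureReal_nonneg hM1 (by norm_num) (by norm_num) hV'
    refine (integral_sq_le_cube hcm hm0 _).trans ((mul_le_mul h1 h2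
      (Real.rpow_nonneg measureReal_nonneg _) (by positivity)).trans ?_)
    rw [show ∀ x y : ℝ, M * x * (M * y) = M ^ 2 * (x * y) by intros; ring, ← Real.exp_add]
    have h3 : 9 / (s + 6) ≤ 1 := (div_le_one (by linarith)).2 (by linarith)
    have h4 := mul_le_mul_of_nonneg_right h3 hd
    exact mul_le_mul_of_nonneg_left (Real.exp_le_exp.2 (by linarith)) (by positivity)
  -- the regularization scale
  obtain ⟨t, ht⟩ : ∃ t, t = q + 2 * k + (5 / 6 - 1 / s) * a - d / 2 := ⟨_, rfl⟩
  have hδ0 : 0 < min (Real.exp t) (τ / 8) := lt_min (Real.exp_pos t) (by positivity)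
  obtain ⟨e, he⟩ : ∃ e, Real.exp e = min (Real.exp t) (τ / 8) := ⟨_, Real.exp_log hδ0⟩
  have het : e ≤ t := Real.exp_le_exp.1 (he.trans_le (min_le_left _ _))
  have het' : Real.exp (-e) ≤ Real.exp (-t) + 8 * Real.exp (k - a) := by
    have p1 := Real.exp_pos (-t)
    have p2 := Real.exp_pos (k - a)
    rw [Real.exp_neg, he]
    rcases min_choice (Real.exp t) (τ / 8) with h | h
    · rw [h, ← Real.exp_neg]; linarith
    · rw [h, inv_div, div_eq_mul_inv, hτi]; linarith
  obtain ⟨ξ₁, ξ₂, c1, c2, s1, s2, hdiv, hX1, hY1, hX2, hY2⟩ :=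
    htest (Real.exp e) (Real.exp_pos e) (he.trans_le (min_le_right _ _))
  rw [hτi] at hX1 hY1 hX2 hY2 hηd
  have Q1 : ∀ {x y : ℝ}, x ≤ y → M * Real.exp x ≤ Q * Real.exp y := fun h =>
    mul_le_mul hMQ (Real.exp_le_exp.2 h) (Real.exp_pos _).le (by linarith)
  have herr := integral_ball3_error_le_exp hs3 hs6 ha hk hd hq hθ1 hθ2 hQ1 (ht ▸ het) (ht ▸ het')
    hcm hcg hm0 hg0 c1 c2 (G := L * Real.exp (k - a)) (by gcongr; exact hLM.trans hMQ)
    (hM3'.trans (Q1 le_rfl)) (hM6'.trans (Q1 le_rfl))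
    (hG2.trans (le_mul_of_one_le_left (Real.exp_pos d).le hQ1)) (hV'.trans (Q1 le_rfl))
    (fun j => (hX1 j).trans (by
      rw [← Real.exp_add, ← Real.exp_nat_mul]
      refine (mul_le_mul hLM (mul_le_mul_of_nonneg_left hM3' (Real.exp_pos _).le)
        (mul_nonneg (Real.exp_pos _).le (integral_nonneg fun x => pow_nonneg (hm0 x) 3))
        hM0.le).trans ?_
      rw [show ∀ x y : ℝ, M * (x * (M * y)) = M ^ 2 * (x * y) by intros; ring, ← Real.exp_add]
      push_cast
      refine mul_le_mul hM2Q (Real.exp_le_exp.2 (by linarith)) (Real.exp_pos _).le (by linarith)))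
    (fun i j => (hY1 j i).trans (by
      rw [← Real.exp_nat_mul, ← Real.exp_nat_mul, ← Real.exp_nat_mul]
      push_cast
      have h1 : Real.exp (2 * (k - a)) * (∫ x in ball3 (ρ + τ / 2), derivSize u w b x ^ 2) ≤
          M ^ 2 * Real.exp (6 * k - 2 * a + d) := by
        refine (mul_le_mul_of_nonneg_left hG2 (Real.exp_pos _).le).trans ?_
        rw [← Real.exp_add]
        refine (Real.exp_le_exp.2 ?_).trans
          (le_mul_of_one_le_left (Real.exp_pos _).le (one_le_pow₀ hM1))
        linarith
      have h2 : Real.exp (4 * (k - a)) * (∫ x in ball3 (ρ + τ / 2), fieldSize u w b x ^ 2) ≤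
          M ^ 2 * Real.exp (6 * k - 2 * a + d) := by
        refine (mul_le_mul_of_nonneg_left hM2' (Real.exp_pos _).le).trans ?_
        rw [mul_left_comm, ← Real.exp_add]
        exact mul_le_mul_of_nonneg_left (Real.exp_le_exp.2 (by linarith)) (by positivity)
      have h0 : 0 ≤ Real.exp (2 * (k - a)) * (∫ x in ball3 (ρ + τ / 2), derivSize u w b x ^ 2) +
          Real.exp (4 * (k - a)) * (∫ x in ball3 (ρ + τ / 2), fieldSize u w b x ^ 2) :=
        add_nonneg (mul_nonneg (Real.exp_pos _).le (integral_nonneg fun x => sq_nonneg _))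
          (mul_nonneg (Real.exp_pos _).le (integral_nonneg fun x => sq_nonneg _))
      refine (mul_le_mul hLM (mul_le_mul_of_nonneg_left (add_le_add h1 h2) (Real.exp_pos _).le)
        (mul_nonneg (Real.exp_pos _).le h0) hM0.le).trans_eq ?_
      rw [show 2 * e + 6 * k - 2 * a + d = 2 * e + (6 * k - 2 * a + d) by ring, Real.exp_add (2 * e),
        hQ]
      ring))
    (fun j => (hX2 j).trans (by
      rw [← Real.exp_nat_mul, ← Real.exp_add, ← Real.exp_mul, ← Real.exp_mul, ← Real.exp_add]
      push_cast
      refine (mul_le_mul_of_nonneg_right hLM (Real.exp_pos _).le).trans (Q1 (le_of_eq (by ring)))))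
    (fun i j => (hY2 j i).trans (by
      rw [← Real.exp_neg, ← Real.exp_nat_mul, ← Real.exp_nat_mul, ← Real.exp_add,
        ← Real.exp_nat_mul, ← Real.exp_mul, ← Real.exp_add, ← Real.exp_add]
      push_cast
      refine (mul_le_mul_of_nonneg_right hLM (Real.exp_pos _).le).trans (Q1 (le_of_eq (by ring)))))
  have hloc := integral_mul_energyDensity_le hsol (by linarith : ρ + 3 * τ / 8 < ρ + τ / 2) cη hη0
    hηs hηd (ξ := fun j x => ξ₁ j x + ξ₂ j x) (fun j => (c1 j).add (c2 j))
    (fun j => (s1 j).add (s2 j)) (fun x => by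
      rw [← hdiv x, ← Finset.sum_add_distrib]
      exact Finset.sum_congr rfl fun j _ => pd_add j (c1 j) (c2 j) x)
  have hEη : ∫ x in ball3 ρ, energyDensity u w b x ≤
      ∫ x in ball3 (ρ + τ / 2), η x * energyDensity u w b x := by
    rw [setIntegral_congr_fun (g := fun x => η x * energyDensity u w b x) (measurableSet_ball3 ρ)
      fun x hx => by simp [hη1 x (mem_ball_zero_iff.1 hx).le]]
    exact integral_ball3_mono_radius (cη.continuous.mul hce) (fun x => mul_nonneg (hη0 x) (he0 x))
      (by linarith)
  refine hEη.trans (hloc.trans ((mul_le_mul_of_nonneg_left herr (by norm_num)).trans_eq ?_))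
  rw [← Real.exp_sub, ← Real.exp_nat_mul, ← Real.exp_mul, ← Real.exp_add, ← Real.exp_add]
  push_cast
  rw [mul_comm d θ]
  ring

end EnergyRecursion

section EnergyIteration

lemma mul_rpow_le_add {X D ε θ : ℝ} (hX : 0 ≤ X) (hD : 0 ≤ D) (hε : 0 < ε) (hθ0 : 0 < θ)
    (hθ1 : θ < 1) : X * D ^ θ ≤ ε * D + (X * ε ^ (-θ)) ^ (1 / (1 - θ)) := by
  have h1 : 0 < 1 - θ := by linarith
  have hY : 0 ≤ X * ε ^ (-θ) := by positivity
  have h := Real.geom_mean_le_arith_mean2_weighted hθ0.le h1.le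
    (by positivity : 0 ≤ ε * D) (Real.rpow_nonneg hY (1 / (1 - θ))) (by ring)
  rw [← Real.rpow_mul hY, one_div_mul_cancel h1.ne', Real.rpow_one, Real.mul_rpow hε.le hD,
    Real.rpow_neg hε.le] at h
  have hp : ε ^ θ ≠ 0 := (Real.rpow_pos_of_pos hε θ).ne'
  have e : ε ^ θ * D ^ θ * (X * (ε ^ θ)⁻¹) = X * D ^ θ := by field_simp
  rw [e] at h
  rw [Real.rpow_neg hε.le]
  have i1 : θ * (ε * D) ≤ 1 * (ε * D) := mul_le_mul_of_nonneg_right hθ1.le (by positivity)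
  have i2 : (1 - θ) * (X * (ε ^ θ)⁻¹) ^ (1 / (1 - θ)) ≤ 1 * (X * (ε ^ θ)⁻¹) ^ (1 / (1 - θ)) :=
    mul_le_mul_of_nonneg_right (by linarith) (by positivity)
  linarith

/-- The energy on a ball is controlled by a small fraction of that on a larger ball. -/
lemma exists_energy_le_mul_add {s : ℝ} (hs3 : 3 < s) (hs6 : s ≤ 6) {N : ℝ} (hN : 0 < N) :
    ∃ p : ℝ, 0 < p ∧ ∀ ε : ℝ, 0 < ε → ∃ B : ℝ, 0 < B ∧
    ∀ (u w b : E3 → E3) (P : E3 → ℝ) (R ρ τ : ℝ), IsMMPSolution u w b P →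
    1 ≤ R → 0 < τ → τ ≤ R → 0 < ρ → ρ + τ ≤ 2 * R → HasPotentialBound s N R u →
    HasPotentialBound s N R w → HasPotentialBound s N R b →
    (∫ x in ball3 ρ, energyDensity u w b x) ≤
      ε * (∫ x in ball3 (ρ + τ), energyDensity u w b x) + B * (R / τ) ^ p := by
  set θ := max (3 / (s + 6) + 1 / 2) (9 / (s + 6)) with hθ
  have hθ1 : 3 / (s + 6) + 1 / 2 ≤ θ := le_max_left _ _
  have hθ2 : 9 / (s + 6) ≤ θ := le_max_right _ _
  have hθ0 : 0 < θ := lt_of_lt_of_le (by positivity) hθ2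
  have hθlt : θ < 1 := by
    have h9 : 9 / (s + 6) < 1 := (div_lt_one (by linarith)).2 (by linarith)
    have h3 : 3 / (s + 6) = 9 / (s + 6) / 3 := by ring
    refine max_lt ?_ h9
    linarith
  have h1θ : 0 < 1 - θ := by linarith
  obtain ⟨c, hc, hstep⟩ := exists_energy_le hs3 hs6 hN hθ1 hθ2
  refine ⟨8 * (1 / (1 - θ)), by positivity, fun ε hε => ?_⟩
  set K := 1 + 200 * c / ε with hK
  have hK1 : 1 ≤ K := by
    have : 0 ≤ 200 * c / ε := by positivity
    linarith
  have hK0 : 0 < K := by linarith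
  have hcK : c / K ≤ ε / 200 := by
    rw [div_le_div_iff₀ hK0 (by norm_num), hK]
    have : ε * (200 * c / ε) = 200 * c := by field_simp
    nlinarith
  set ε' := ε / (200 * c) with hε'
  have hε0 : 0 < ε' := by positivity
  have hcε : c * ε' = ε / 200 := by rw [hε']; field_simp
  set Y := (K * ε' ^ (-θ)) ^ (1 / (1 - θ)) with hY
  have hY0 : 0 < Y := by positivity
  refine ⟨ε / 100 + c * Y, by positivity, ?_⟩
  intro u w b P R ρ τ hsol hR hτ hτR hρ hρτ pu pw pb
  have h := hstep u w b P K R ρ τ hsol hK1 hR hτ hτR hρ hρτ pu pw pb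
  set D := energyBound u w b (ρ + τ) with hD
  have hD1 : 1 ≤ D := one_le_energyBound _
  have hκ : 1 ≤ R / τ := (one_le_div hτ).2 hτR
  have hκp : 1 ≤ (R / τ) ^ (8 * (1 / (1 - θ))) := Real.one_le_rpow hκ (by positivity)
  have hy := mul_rpow_le_add (X := K * (R / τ) ^ 8) (D := D) (by positivity) (by linarith) hε0
    hθ0 hθlt
  have hy' : (K * (R / τ) ^ 8 * ε' ^ (-θ)) ^ (1 / (1 - θ)) = Y * (R / τ) ^ (8 * (1 / (1 - θ))) := by
    rw [mul_right_comm, Real.mul_rpow (by positivity) (by positivity), ← Real.rpow_natCast,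
      ← Real.rpow_mul (by positivity), hY]
    norm_num
  rw [hy'] at hy
  have h2 : c * (D / K + K * (R / τ) ^ 8 * D ^ θ) ≤
      ε / 100 * D + c * Y * (R / τ) ^ (8 * (1 / (1 - θ))) := by
    have i1 : c * (D / K) ≤ ε / 200 * D := by
      rw [← mul_div_assoc, mul_div_right_comm]
      exact mul_le_mul_of_nonneg_right hcK (by linarith)
    have i2 := mul_le_mul_of_nonneg_left hy hc.le
    have i3 : c * (ε' * D) = ε / 200 * D := by rw [← mul_assoc, hcε]
    nlinarith
  refine h.trans (h2.trans ?_)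
  rw [hD, energyBound]
  have i4 := mul_le_mul_of_nonneg_left hκp (by positivity : 0 ≤ ε / 100)
  linarith

lemma le_of_forall_le_mul_add {E : ℝ → ℝ} {R ε B p T : ℝ} (hR : 0 < R) (hε0 : 0 < ε) (hε : ε ≤ 1 / 2)
    (hεp : ε * 2 ^ p ≤ 1 / 2) (hB : 0 < B) (hE : ∀ r ≤ 2 * R, E r ≤ T)
    (h : ∀ ρ τ, 0 < τ → τ ≤ R → 0 < ρ → ρ + τ ≤ 2 * R →
      E ρ ≤ ε * E (ρ + τ) + B * (R / τ) ^ p) : E R ≤ 2 * (B * 2 ^ p) := by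
  have key : ∀ n : ℕ, E R ≤ ε ^ n * E (R * (2 - (1 / 2) ^ n)) +
      2 * (B * 2 ^ p) * (1 - (1 / 2) ^ n) := by
    intro n
    induction n with
    | zero => norm_num
    | succ n ih =>
      have hx0 : (0 : ℝ) < (1 / 2) ^ n := by positivity
      have hx1 : (1 / 2 : ℝ) ^ n ≤ 1 := pow_le_one₀ (by norm_num) (by norm_num)
      have hs := h (R * (2 - (1 / 2) ^ n)) (R * (1 / 2) ^ (n + 1)) (by positivity)
        (by rw [pow_succ]; nlinarith) (mul_pos hR (by linarith)) (by rw [pow_succ]; nlinarith)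
      have e1 : R * (2 - (1 / 2) ^ n) + R * (1 / 2) ^ (n + 1) = R * (2 - (1 / 2) ^ (n + 1)) := by
        rw [pow_succ]; ring
      have e2 : (R / (R * (1 / 2) ^ (n + 1))) ^ p = (2 : ℝ) ^ p * ((2 : ℝ) ^ p) ^ n := by
        rw [div_mul_eq_div_div, div_self hR.ne', one_div_pow, one_div_one_div, pow_succ',
          Real.mul_rpow (by norm_num) (by positivity), ← Real.rpow_natCast, ← Real.rpow_natCast,
          ← Real.rpow_mul (by norm_num), ← Real.rpow_mul (by norm_num), mul_comm p]
      rw [e1, e2] at hs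
      have h1 := mul_le_mul_of_nonneg_left hs (pow_nonneg hε0.le n)
      have h2 : (ε * 2 ^ p) ^ n ≤ (1 / 2 : ℝ) ^ n := pow_le_pow_left₀ (by positivity) hεp n
      rw [mul_pow] at h2
      have h3 := mul_le_mul_of_nonneg_left h2 (by positivity : 0 ≤ B * 2 ^ p)
      refine ih.trans ?_
      rw [pow_succ ε, pow_succ (1 / 2 : ℝ) n] at *
      nlinarith
  have hlim : Tendsto (fun n : ℕ => (1 / 2 : ℝ) ^ n * |T| + 2 * (B * 2 ^ p)) atTop
      (𝓝 (0 * |T| + 2 * (B * 2 ^ p))) :=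
    ((tendsto_pow_atTop_nhds_zero_of_lt_one (by norm_num) (by norm_num)).mul_const _).add_const _
  rw [zero_mul, zero_add] at hlim
  refine ge_of_tendsto' hlim fun n => (key n).trans ?_
  have hx0 : (0 : ℝ) < (1 / 2) ^ n := by positivity
  have h1 : E (R * (2 - (1 / 2) ^ n)) ≤ |T| :=
    (hE _ (by nlinarith)).trans (le_abs_self T)
  have h2 : ε ^ n ≤ (1 / 2) ^ n := pow_le_pow_left₀ hε0.le hε n
  have h3 : ε ^ n * E (R * (2 - (1 / 2) ^ n)) ≤ (1 / 2) ^ n * |T| :=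
    mul_le_mul_of_nonneg_left h1 (by positivity) |>.trans
      (mul_le_mul_of_nonneg_right h2 (abs_nonneg T))
  have h4 : 0 ≤ 2 * (B * 2 ^ p) * (1 / 2) ^ n := by positivity
  linarith

/-- The energy is bounded uniformly on all balls. -/
lemma exists_integral_energyDensity_le {s : ℝ} (hs3 : 3 < s) (hs6 : s ≤ 6) {N : ℝ} (hN : 0 < N)
    {u w b : E3 → E3} {P : E3 → ℝ} (hsol : IsMMPSolution u w b P)
    (pu : ∀ R, 1 ≤ R → HasPotentialBound s N R u) (pw : ∀ R, 1 ≤ R → HasPotentialBound s N R w)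
    (pb : ∀ R, 1 ≤ R → HasPotentialBound s N R b) :
    ∃ C : ℝ, 0 < C ∧ ∀ R : ℝ, 1 ≤ R → ∫ x in ball3 R, energyDensity u w b x ≤ C := by
  obtain ⟨p, hp, hstep⟩ := exists_energy_le_mul_add hs3 hs6 hN
  have h2p : (1 : ℝ) ≤ 2 ^ p := Real.one_le_rpow (by norm_num) hp.le
  have h2p0 : (0 : ℝ) < 2 ^ p := by positivity
  obtain ⟨B, hB, hstep⟩ := hstep (1 / 2 * (2 ^ p)⁻¹) (by positivity)
  refine ⟨2 * (B * 2 ^ p), by positivity, fun R hR => ?_⟩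
  refine le_of_forall_le_mul_add (E := fun r => ∫ x in ball3 r, energyDensity u w b x)
    (ε := 1 / 2 * (2 ^ p)⁻¹) (T := ∫ x in ball3 (2 * R), energyDensity u w b x)
    (by linarith) (by positivity) ?_ (le_of_eq (by field_simp)) hB
    (fun r hr => integral_ball3_mono_radius
      (continuous_energyDensity hsol.smooth_u hsol.smooth_b hsol.smooth_w) energyDensity_nonneg hr)
    fun ρ τ hτ hτR hρ hρτ => hstep u w b P R ρ τ hsol hR hτ hτR hρ hρτ (pu R hR) (pw R hR) (pb R hR)
  have := inv_le_one_of_one_le₀ h2p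
  linarith

end EnergyIteration

/-- Growth estimate for the Dirichlet integral under the potential growth hypothesis. -/
theorem dirichlet_growth_estimate
    (u w b : E3 → E3) (P : E3 → ℝ) (hsol : IsMMPSolution u w b P)
    (Φ Ψ Υ : E3 → Fin 3 → Fin 3 → ℝ)
    (hΦ : ∀ i j, ContDiff ℝ (⊤ : ℕ∞) (fun x => Φ x i j))
    (hΨ : ∀ i j, ContDiff ℝ (⊤ : ℕ∞) (fun x => Ψ x i j))
    (hΥ : ∀ i j, ContDiff ℝ (⊤ : ℕ∞) (fun x => Υ x i j))
    (hΦu : ∀ (x : E3) (j : Fin 3), mdiv Φ x j = u x j)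
    (hΨb : ∀ (x : E3) (j : Fin 3), mdiv Ψ x j = b x j)
    (hΥw : ∀ (x : E3) (j : Fin 3), mdiv Υ x j = w x j)
    (s : ℝ) (hs1 : 3 < s) (hs2 : s ≤ 6)
    (C₀ : ℝ) (hC₀ : 0 < C₀)
    (hosc : ∀ r : ℝ, 1 < r →
      meanOsc Φ s r + meanOsc Ψ s r + meanOsc Υ s r ≤ C₀ * r ^ ((1:ℝ)/3 - 1/s))
    : ∃ C : ℝ, 0 < C ∧ ∀ ρ R : ℝ, 1 < ρ → ρ < R →
      (∫ x in ball3 ρ, (gradSq u x + gradSq b x + gradSq w x)) ≤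
        C * R ^ ((s + 6) / (s - 3)) * ((R - ρ)⁻¹) ^ ((s + 6) / (s - 3)) := by
  have hs0 : 0 < s := by linarith
  obtain ⟨N, hN, hpot⟩ := exists_hasPotentialBound hs0 hC₀
  have hosc' : ∀ R : ℝ, 1 ≤ R →
      meanOsc Φ s (2 * R) + meanOsc Ψ s (2 * R) + meanOsc Υ s (2 * R) ≤
        C₀ * (2 * R) ^ ((1 : ℝ) / 3 - 1 / s) := fun R hR => hosc (2 * R) (by linarith)
  obtain ⟨C, hC, hbound⟩ := exists_integral_energyDensity_le hs1 hs2 hN hsol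
    (fun R hR => hpot R u Φ hR hΦ hΦu (by
      linarith [hosc' R hR, meanOsc_nonneg Ψ s (2 * R), meanOsc_nonneg Υ s (2 * R)]))
    (fun R hR => hpot R w Υ hR hΥ hΥw (by
      linarith [hosc' R hR, meanOsc_nonneg Ψ s (2 * R), meanOsc_nonneg Φ s (2 * R)]))
    (fun R hR => hpot R b Ψ hR hΨ hΨb (by
      linarith [hosc' R hR, meanOsc_nonneg Φ s (2 * R), meanOsc_nonneg Υ s (2 * R)]))
  refine ⟨C, hC, fun ρ R hρ hρR => ?_⟩
  have hcu := continuous_gradSq hsol.smooth_u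
  have hcb := continuous_gradSq hsol.smooth_b
  have hcw := continuous_gradSq hsol.smooth_w
  have h1 : ∫ x in ball3 ρ, (gradSq u x + gradSq b x + gradSq w x) ≤
      ∫ x in ball3 ρ, energyDensity u w b x :=
    integral_ball3_mono ((hcu.add hcb).add hcw)
      (continuous_energyDensity hsol.smooth_u hsol.smooth_b hsol.smooth_w) fun x =>
        le_add_of_nonneg_right (Finset.sum_nonneg fun j _ => sq_nonneg (w x j))
  have hRρ : 0 < R - ρ := by linarith
  have hratio : 1 ≤ R * (R - ρ)⁻¹ := by
    rw [← div_eq_mul_inv, one_le_div hRρ]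
    linarith
  have hpow : 1 ≤ R ^ ((s + 6) / (s - 3)) * ((R - ρ)⁻¹) ^ ((s + 6) / (s - 3)) := by
    rw [← Real.mul_rpow (by linarith) (by positivity)]
    exact Real.one_le_rpow hratio (div_nonneg (by linarith) (by linarith))
  calc ∫ x in ball3 ρ, (gradSq u x + gradSq b x + gradSq w x)
      ≤ C * 1 := by rw [mul_one]; exact h1.trans (hbound ρ hρ.le)
    _ ≤ C * (R ^ ((s + 6) / (s - 3)) * ((R - ρ)⁻¹) ^ ((s + 6) / (s - 3))) := by gcongr
    _ = C * R ^ ((s + 6) / (s - 3)) * ((R - ρ)⁻¹) ^ ((s + 6) / (s - 3)) := by ring
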